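/- arXiv:2308.11987 — 3 statements merged into one kernel-verified Lean document; each statement's English description precedes it below -/
import Mathlib

section
/- For every ε ∈ (0, 1/2) there exist constants 0 < c₁(ε) < c₂(ε) and x₀ = x₀(ε) such that the following holds for all x ≥ x₀. Let r be an integer with (1+ε)·Log₂ x ≤ r ≤ (2−ε)·Log₂ x, set α := r/Log₂ x − 1, and let y ∈ 𝒴 and u ∈ 𝒰. Then c₁(ε)·2^{−u}/Log₂ x ≤ ∏_{p < x}(1 + 1/p)^{-1} · ∑_{n ∈ S_{<x}, ω(n) = r, ω(n_{<y}) = Log₂ y/log 2 + u} 1/n ≤ c₂(ε)·2^{−u}/Log₂ x. -/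
open Filter Topology
open scoped Classical

noncomputable def LLog (x : ℝ) : ℝ := max 1 (Real.log x)
noncomputable def LLog2 (x : ℝ) : ℝ := LLog (LLog x)
noncomputable def LLog3 (x : ℝ) : ℝ := LLog (LLog2 x)

/-- `Δ^{(v)}(n)`: the maximal number of divisors of `n` in an interval `(e^u, e^{u+v}]`. -/
noncomputable def DeltaV (v : ℝ) (n : ℕ) : ℕ :=
  ⨆ u : ℝ, (n.divisors.filter fun d => Real.exp u < (d : ℝ) ∧ (d : ℝ) ≤ Real.exp (u + v)).card

/-- The Erdős–Hooley Delta function. -/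
noncomputable def Delta (n : ℕ) : ℕ := DeltaV 1 n

/-- `S_{[y,x)}`: squarefree positive integers all of whose prime factors `p` satisfy `y ≤ p < x`. -/
def Sset (y x : ℝ) : Set ℕ :=
  {n | 0 < n ∧ Squarefree n ∧ ∀ p ∈ n.primeFactors, y ≤ (p : ℝ) ∧ (p : ℝ) < x}

/-- `∏_{y ≤ p < x} (1 + 1/p)⁻¹`, product over primes. -/
noncomputable def primeProd (y x : ℝ) : ℝ :=
  ∏ᶠ p ∈ {p : ℕ | p.Prime ∧ y ≤ (p : ℝ) ∧ (p : ℝ) < x}, ((1 : ℝ) + 1 / p)⁻¹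

/-- number of distinct prime factors -/
def omegaN (n : ℕ) : ℕ := n.primeFactors.card

/-- number of divisors -/
def tauN (n : ℕ) : ℕ := n.divisors.card

/-- `n_{<y}`: the largest divisor of `n` (squarefree) composed of primes `< y`. -/
noncomputable def nsmall (n : ℕ) (y : ℝ) : ℕ :=
  ∏ p ∈ n.primeFactors.filter (fun p : ℕ => (p : ℝ) < y), p

def Yset (α x : ℝ) : Set ℝ :=
  {y | 0 < y ∧ |LLog2 y - α * LLog2 x| ≤ Real.sqrt (LLog2 x) ∧ ∃ m : ℤ, LLog2 y = m * Real.log 2}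

def Uset (α x : ℝ) : Set ℤ :=
  {u | |(u : ℝ) - (Real.log 4 - 1) / Real.log 2 * (α * LLog2 x)| ≤ Real.sqrt (LLog2 x)}

noncomputable def Qfun (t : ℝ) : ℝ := t * Real.log t - t + 1

namespace S11

open Real

/-- Mertens' partial sum `∑_{p ≤ N} log p / p`. -/
noncomputable def RR (N : ℕ) : ℝ := ∑ p ∈ Nat.primesLE N, Real.log p / p

/-- `∑_{p ≤ N} 1 / p`. -/
noncomputable def TT (N : ℕ) : ℝ := ∑ p ∈ Nat.primesLE N, (p : ℝ)⁻¹

lemma log_factorial_eq (N : ℕ) :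
    Real.log (N.factorial : ℝ)
      = ∑ p ∈ Nat.primesLE N, (N.factorial.factorization p : ℝ) * Real.log p := by
  have h : N.factorial = ∏ p ∈ Nat.primesLE N, p ^ (N.factorial.factorization p) := by
    conv_lhs => rw [← Nat.prod_factorization_pow_eq_self (Nat.factorial_ne_zero N)]
    rw [Nat.prod_factorization_eq_prod_primeFactors]
    apply Finset.prod_congr
    · ext p
      simp only [Nat.mem_primeFactors, Nat.mem_primesLE]
      constructor
      · rintro ⟨hp, hd, _⟩
        exact ⟨(hp.dvd_factorial).1 hd, hp⟩
      · rintro ⟨h1, h2⟩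
        exact ⟨h2, (h2.dvd_factorial).2 h1, Nat.factorial_ne_zero N⟩
    · intros; rfl
  conv_lhs => rw [h]
  push_cast
  rw [Real.log_prod]
  · apply Finset.sum_congr rfl
    intro p _
    rw [Real.log_pow]
  · intro p hp
    have := (Nat.prime_of_mem_primesLE hp).pos
    positivity

lemma fact_lower (N p : ℕ) (hp : p.Prime) (hpN : p ≤ N) :
    (N : ℝ) / p - 1 ≤ (N.factorial.factorization p : ℝ) := by
  have h1 : N / p ≤ N.factorial.factorization p := by
    rw [Nat.factorization_factorial hp (Nat.lt_succ_self (Nat.log p N))]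
    have hlog : 1 ≤ Nat.log p N := Nat.log_pos hp.one_lt hpN
    have : N / p ^ 1 ≤ ∑ i ∈ Finset.Ico 1 (Nat.log p N).succ, N / p ^ i :=
      Finset.single_le_sum (f := fun i => N / p ^ i) (fun _ _ => Nat.zero_le _)
        (Finset.mem_Ico.2 ⟨le_refl 1, by omega⟩)
    simpa using this
  have h2 : (N : ℝ) / p < ((N / p : ℕ) : ℝ) + 1 := by
    rw [div_lt_iff₀ (by exact_mod_cast hp.pos)]
    have := Nat.lt_div_mul_add (a := N) (b := p) hp.pos
    have h3 : (N : ℝ) < (N / p : ℕ) * p + p := by exact_mod_cast this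
    linarith
  have h3 : ((N / p : ℕ) : ℝ) ≤ (N.factorial.factorization p : ℝ) := by exact_mod_cast h1
  linarith

lemma fact_upper (N p : ℕ) (hp : p.Prime) :
    (N.factorial.factorization p : ℝ) ≤ N / ((p : ℝ) - 1) := by
  have h2 : (2 : ℝ) ≤ p := by exact_mod_cast hp.two_le
  rw [le_div_iff₀ (by linarith)]
  have h := Nat.sub_one_mul_factorization_factorial (n := N) hp
  have h' : (p - 1) * N.factorial.factorization p ≤ N := by rw [h]; exact Nat.sub_le _ _
  have h3 : (((p - 1 : ℕ) : ℝ)) * N.factorial.factorization p ≤ N := by exact_mod_cast h'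
  rw [Nat.cast_sub hp.one_le] at h3
  push_cast at h3
  linarith

lemma exists_sum_bound : ∃ C : ℝ, 0 ≤ C ∧ ∀ N : ℕ,
    ∑ p ∈ Nat.primesLE N, Real.log p / (p * ((p : ℝ) - 1)) ≤ C := by
  have hs : Summable (fun n : ℕ => 4 * (1 / (n : ℝ) ^ (3/2 : ℝ))) :=
    (Real.summable_one_div_nat_rpow.2 (by norm_num)).mul_left 4
  refine ⟨∑' n : ℕ, 4 * (1 / (n : ℝ) ^ (3/2 : ℝ)), tsum_nonneg (fun n => by positivity), fun N => ?_⟩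
  refine le_trans (Finset.sum_le_sum ?_) (hs.sum_le_tsum (Nat.primesLE N) (fun n _ => by positivity))
  intro p hp
  have hp2 : (2 : ℝ) ≤ p := by exact_mod_cast Nat.two_le_of_mem_primesLE hp
  have hp0 : (0 : ℝ) < p := by linarith
  have hlog : Real.log p ≤ 2 * (p : ℝ) ^ (1/2 : ℝ) := by
    have := Real.log_le_rpow_div hp0.le (ε := 1/2) (by norm_num)
    linarith
  have hpow : (p : ℝ) ^ (1/2 : ℝ) * (p : ℝ) ^ (3/2 : ℝ) = p ^ 2 := by
    rw [← Real.rpow_add hp0, ← Real.rpow_natCast]; norm_num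
  have h32 : 0 < (p : ℝ) ^ (3/2 : ℝ) := by positivity
  rw [← mul_one_div, mul_one_div, mul_one_div, div_le_div_iff₀ (by nlinarith) h32]
  calc Real.log p * (p : ℝ) ^ (3/2 : ℝ) ≤ 2 * (p : ℝ) ^ (1/2 : ℝ) * (p : ℝ) ^ (3/2 : ℝ) := by gcongr
    _ = 2 * (p : ℝ)^2 := by rw [mul_assoc, hpow]
    _ ≤ 4 * (p * (p - 1)) := by nlinarith

lemma mertens1 : ∃ C : ℝ, 0 ≤ C ∧ ∀ N : ℕ, 1 ≤ N → |RR N - Real.log N| ≤ C := by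
  obtain ⟨C, hC0, hC⟩ := exists_sum_bound
  refine ⟨C + 1 + Real.log 4, by positivity, fun N hN => ?_⟩
  have hN0 : (0 : ℝ) < N := by exact_mod_cast hN
  have hl4 : 0 ≤ Real.log 4 := by positivity
  have hfe := log_factorial_eq N
  have h1 : N * RR N - Chebyshev.theta N ≤ Real.log (N.factorial : ℝ) := by
    rw [hfe, RR, Chebyshev.theta_eq_sum_primesLE_log, Finset.mul_sum, ← Finset.sum_sub_distrib]
    apply Finset.sum_le_sum
    intro p hp
    have hpp := Nat.prime_of_mem_primesLE hp
    have := fact_lower N p hpp (Nat.le_of_mem_primesLE hp)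
    have hl : 0 ≤ Real.log p := Real.log_natCast_nonneg p
    calc (N : ℝ) * (Real.log p / p) - Real.log p = ((N : ℝ) / p - 1) * Real.log p := by ring
      _ ≤ _ := by gcongr
  have h2 : Real.log (N.factorial : ℝ) ≤ N * (RR N + C) := by
    have h3 : Real.log (N.factorial : ℝ) ≤
        N * (RR N + ∑ p ∈ Nat.primesLE N, Real.log p / (p * ((p : ℝ) - 1))) := by
      rw [hfe, RR, ← Finset.sum_add_distrib, Finset.mul_sum]
      apply Finset.sum_le_sum
      intro p hp
      have hpp := Nat.prime_of_mem_primesLE hp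
      have hp2 : (2 : ℝ) ≤ p := by exact_mod_cast hpp.two_le
      have hl : 0 ≤ Real.log p := Real.log_natCast_nonneg p
      have := fact_upper N p hpp
      have e : (N : ℝ) * (Real.log p / p + Real.log p / (p * ((p : ℝ) - 1)))
          = N / ((p : ℝ) - 1) * Real.log p := by
        have : (p : ℝ) - 1 ≠ 0 := by linarith
        field_simp
        ring
      rw [e]
      gcongr
    exact h3.trans (by gcongr; exact hC N)
  have h3 : Real.log (N.factorial : ℝ) ≤ N * Real.log N := by
    rw [← Real.log_pow]
    apply Real.log_le_log (by positivity)
    exact_mod_cast Nat.factorial_le_pow N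
  have h4 : N * Real.log N - N ≤ Real.log (N.factorial : ℝ) := by
    have h := Stirling.le_log_factorial_stirling (n := N) (by omega)
    have : 0 ≤ Real.log N := Real.log_natCast_nonneg N
    have : 0 ≤ Real.log (2 * π) := Real.log_nonneg (by linarith [Real.pi_gt_three])
    linarith
  have h5 := Chebyshev.theta_le_log4_mul_x (x := N) hN0.le
  rw [abs_le]
  constructor
  · have : N * (Real.log N - 1) ≤ N * (RR N + C) := by linarith
    have := le_of_mul_le_mul_left this hN0
    linarith
  · have : N * RR N ≤ N * (Real.log N + Real.log 4) := by linarith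
    have := le_of_mul_le_mul_left this hN0
    linarith

lemma RR_succ (n : ℕ) : RR (n+1) = RR n + if (n+1).Prime then Real.log (n+1 : ℕ) / (n+1 : ℕ) else 0 := by
  unfold RR
  rw [Nat.primesLE_eq_filter_range, Nat.primesLE_eq_filter_range, Finset.sum_filter,
    Finset.sum_filter, Finset.sum_range_succ]

lemma TT_succ (n : ℕ) : TT (n+1) = TT n + if (n+1).Prime then ((n+1 : ℕ) : ℝ)⁻¹ else 0 := by
  unfold TT
  rw [Nat.primesLE_eq_filter_range, Nat.primesLE_eq_filter_range, Finset.sum_filter,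
    Finset.sum_filter, Finset.sum_range_succ]

lemma mertens2_nat : ∃ C : ℝ, 0 ≤ C ∧ ∀ N : ℕ, 2 ≤ N → |TT N - Real.log (Real.log N)| ≤ C := by
  obtain ⟨C, hC0, hC⟩ := mertens1
  set D : ℕ → ℝ := fun n => TT n - Real.log (Real.log n) - (RR n - Real.log n) / Real.log n with hD
  have hlog2 : 0 < Real.log 2 := Real.log_pos (by norm_num)
  have key : ∀ N : ℕ, 2 ≤ N → |D N| ≤ |D 2| + (C + 1) * (1 / Real.log 2 - 1 / Real.log N) := by
    intro N hN
    induction N, hN using Nat.le_induction with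
    | base => simp
    | succ n hn ih =>
      have hn2 : (2 : ℝ) ≤ n := by exact_mod_cast hn
      set a := Real.log n with ha
      set b := Real.log ((n + 1 : ℕ) : ℝ) with hb
      have ha0 : 0 < a := Real.log_pos (by linarith)
      have hab : a ≤ b := Real.log_le_log (by linarith) (by push_cast; linarith)
      have hb0 : 0 < b := by linarith
      have hba : b - a ≤ 1 := by
        rw [ha, hb, ← Real.log_div (by positivity) (by positivity)]
        have := Real.log_le_sub_one_of_pos (x := ((n + 1 : ℕ) : ℝ) / n) (by positivity)
        have h2 : ((n + 1 : ℕ) : ℝ) / n ≤ 2 := by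
          rw [div_le_iff₀ (by positivity)]; push_cast; linarith
        linarith
      have hl1 : Real.log b - Real.log a ≤ (b - a) / a := by
        rw [← Real.log_div hb0.ne' ha0.ne']
        have := Real.log_le_sub_one_of_pos (x := b / a) (by positivity)
        have e : (b - a) / a = b / a - 1 := by field_simp
        linarith
      have hl2 : (b - a) / b ≤ Real.log b - Real.log a := by
        have h := Real.log_le_sub_one_of_pos (x := a / b) (by positivity)
        rw [Real.log_div ha0.ne' hb0.ne'] at h
        have e : (b - a) / b = 1 - a / b := by field_simp
        linarith
      have hE := hC n (by omega)
      have hinv : 1 / b ≤ 1 / a := one_div_le_one_div_of_le ha0 hab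
      have hstep : D (n+1) - D n = -(Real.log b - Real.log a) + (b - a) / b
          + (RR n - a) * (1 / a - 1 / b) := by
        simp only [hD, RR_succ, TT_succ]
        rw [← ha, ← hb]
        split_ifs with hp
        · have : ((n+1 : ℕ) : ℝ) ≠ 0 := by positivity
          field_simp
          ring
        · field_simp
          ring
      have hd : |D (n+1) - D n| ≤ (C + 1) * (1 / a - 1 / b) := by
        rw [hstep]
        have h1 : |(RR n - a) * (1 / a - 1 / b)| ≤ C * (1 / a - 1 / b) := by
          rw [abs_mul, abs_of_nonneg (sub_nonneg.2 hinv)]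
          exact mul_le_mul_of_nonneg_right hE (sub_nonneg.2 hinv)
        have h2 : (b - a) / a - (b - a) / b ≤ 1 / a - 1 / b := by
          have e : (b - a) / a - (b - a) / b = (b - a) * (1 / a - 1 / b) := by ring
          rw [e]
          nlinarith [sub_nonneg.2 hinv]
        rw [abs_le] at h1 ⊢
        constructor <;> linarith [h1.1, h1.2]
      have : |D (n+1)| ≤ |D n| + |D (n+1) - D n| := by
        have := abs_add_le (D n) (D (n+1) - D n)
        simpa using this
      calc |D (n+1)| ≤ _ := this
        _ ≤ |D 2| + (C + 1) * (1 / Real.log 2 - 1 / a) + (C + 1) * (1 / a - 1 / b) := by linarith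
        _ = _ := by ring
  refine ⟨|D 2| + (C + 1) * (1 / Real.log 2) + C / Real.log 2, by positivity, fun N hN => ?_⟩
  have hk := key N hN
  have hN2 : (2 : ℝ) ≤ N := by exact_mod_cast hN
  have hlN : Real.log 2 ≤ Real.log N := Real.log_le_log (by norm_num) hN2
  have e : TT N - Real.log (Real.log N) = D N + (RR N - Real.log N) / Real.log N := by
    simp only [hD]; ring
  have h1 : |(RR N - Real.log N) / Real.log N| ≤ C / Real.log 2 := by
    rw [abs_div, abs_of_pos (a := Real.log N) (by linarith)]
    have := hC N (by omega)
    gcongr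
  have h2 : (C + 1) * (1 / Real.log 2 - 1 / Real.log N) ≤ (C + 1) * (1 / Real.log 2) := by
    have : 0 < 1 / Real.log N := by apply one_div_pos.2; linarith
    gcongr; linarith
  rw [e]
  linarith [abs_add_le (D N) ((RR N - Real.log N) / Real.log N)]

/-- Primes below a real number. -/
noncomputable def pp (x : ℝ) : Finset ℕ := Nat.primesBelow ⌈x⌉₊

lemma mem_pp {x : ℝ} {p : ℕ} : p ∈ pp x ↔ p.Prime ∧ (p : ℝ) < x := by
  simp [pp, Nat.mem_primesBelow, Nat.lt_ceil, and_comm]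

/-- Sum of prime reciprocals. -/
noncomputable def PS (A : Finset ℕ) : ℝ := ∑ p ∈ A, (p : ℝ)⁻¹

lemma mertens2 : ∃ C : ℝ, 0 ≤ C ∧ ∀ x : ℝ, 3 ≤ x → |PS (pp x) - Real.log (Real.log x)| ≤ C := by
  obtain ⟨C, hC0, hC⟩ := mertens2_nat
  have hlog2 : 0 < Real.log 2 := Real.log_pos (by norm_num)
  refine ⟨C + 1 / Real.log 2, by positivity, fun x hx => ?_⟩
  obtain ⟨N, hN⟩ : ∃ N, ⌈x⌉₊ = N + 1 := by
    have : 0 < ⌈x⌉₊ := Nat.ceil_pos.2 (by linarith)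
    exact ⟨⌈x⌉₊ - 1, by omega⟩
  have hxN : x ≤ N + 1 := by
    have := Nat.le_ceil x
    rw [hN] at this; exact_mod_cast this
  have hNx : (N : ℝ) < x := Nat.lt_ceil.1 (by omega)
  have hN2 : 2 ≤ N := by
    have : (3 : ℝ) ≤ N + 1 := by linarith
    have : 3 ≤ N + 1 := by exact_mod_cast this
    omega
  have hN2' : (2 : ℝ) ≤ N := by exact_mod_cast hN2
  have e : PS (pp x) = TT N := by
    simp only [PS, TT, pp, hN]; rfl
  rw [e]
  have h := hC N hN2
  have hl : Real.log 2 ≤ Real.log N := Real.log_le_log (by norm_num) hN2'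
  have hl2 : Real.log N ≤ Real.log x := Real.log_le_log (by linarith) hNx.le
  have h1 : Real.log (Real.log N) ≤ Real.log (Real.log x) := Real.log_le_log (by linarith) hl2
  have h2 : Real.log x - Real.log N ≤ 1 := by
    rw [← Real.log_div (by linarith) (by linarith)]
    have := Real.log_le_sub_one_of_pos (x := x / N) (div_pos (by linarith) (by linarith))
    have h2 : x / N ≤ 2 := by
      rw [div_le_iff₀ (by linarith)]; linarith
    linarith
  have h3 : Real.log (Real.log x) - Real.log (Real.log N) ≤ 1 / Real.log 2 := by
    have hp : 0 < Real.log N := by linarith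
    rw [← Real.log_div (by linarith) hp.ne']
    have := Real.log_le_sub_one_of_pos (x := Real.log x / Real.log N) (div_pos (by linarith) hp)
    have h4 : Real.log x / Real.log N - 1 = (Real.log x - Real.log N) / Real.log N := by
      field_simp
    have h5 : (Real.log x - Real.log N) / Real.log N ≤ 1 / Real.log 2 := by
      gcongr
    linarith
  rw [abs_le] at h ⊢
  constructor <;> linarith [h.1, h.2]

/-- Elementary symmetric function of the reciprocals. -/
noncomputable def EE (A : Finset ℕ) (k : ℕ) : ℝ :=
  ∑ s ∈ A.powersetCard k, ∏ p ∈ s, (p : ℝ)⁻¹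

/-- Sum of inverse squares. -/
noncomputable def PQ (A : Finset ℕ) : ℝ := ∑ p ∈ A, ((p : ℝ)⁻¹) ^ 2

lemma EE_zero (A : Finset ℕ) : EE A 0 = 1 := by simp [EE]

lemma EE_nonneg (A : Finset ℕ) (k : ℕ) : 0 ≤ EE A k := by
  unfold EE; positivity

lemma PS_nonneg (A : Finset ℕ) : 0 ≤ PS A := by
  unfold PS; positivity

lemma PQ_nonneg (A : Finset ℕ) : 0 ≤ PQ A := by
  unfold PQ; positivity

lemma EE_insert {A : Finset ℕ} {a : ℕ} (ha : a ∉ A) (k : ℕ) :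
    EE (insert a A) (k + 1) = EE A (k + 1) + (a : ℝ)⁻¹ * EE A k := by
  unfold EE
  rw [Finset.powersetCard_succ_insert ha, Finset.sum_union, Finset.sum_image, Finset.mul_sum]
  · congr 1
    apply Finset.sum_congr rfl
    intro s hs
    rw [Finset.prod_insert]
    intro h
    exact ha ((Finset.mem_powersetCard.1 hs).1 h)
  · intro s hs t ht hst
    have h1 : a ∉ s := fun h => ha ((Finset.mem_powersetCard.1 hs).1 h)
    have h2 : a ∉ t := fun h => ha ((Finset.mem_powersetCard.1 ht).1 h)
    have := congrArg (fun u => Finset.erase u a) hst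
    simpa [Finset.erase_insert h1, Finset.erase_insert h2] using this
  · rw [Finset.disjoint_left]
    intro s hs hs'
    obtain ⟨t, ht, rfl⟩ := Finset.mem_image.1 hs'
    exact ha ((Finset.mem_powersetCard.1 hs).1 (Finset.mem_insert_self a t))

lemma EE_empty_succ (k : ℕ) : EE ∅ (k+1) = 0 := by
  rw [EE, Finset.powersetCard_eq_empty.2 (by simp), Finset.sum_empty]

lemma EE_upper1 (A : Finset ℕ) : ∀ k : ℕ, (k + 1 : ℝ) * EE A (k + 1) ≤ PS A * EE A k := by
  induction A using Finset.induction_on with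
  | empty => intro k; simp [EE_empty_succ, PS]
  | insert a A ha ih =>
    intro k
    have e : PS (insert a A) = (a : ℝ)⁻¹ + PS A := by unfold PS; rw [Finset.sum_insert ha]
    have ha0 : (0 : ℝ) ≤ (a : ℝ)⁻¹ := by positivity
    rw [e, EE_insert ha]
    cases k with
    | zero =>
      have := ih 0
      simp only [EE_zero] at *
      push_cast at *
      linarith
    | succ k =>
      rw [EE_insert ha]
      have h1 := ih (k+1)
      have h2 := mul_le_mul_of_nonneg_left (ih k) ha0
      have h3 := mul_nonneg (mul_nonneg ha0 ha0) (EE_nonneg A k)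
      push_cast at *
      linarith

lemma EE_lower1 (A : Finset ℕ) : (∀ k : ℕ, PS A * EE A (k + 1) - PQ A * EE A k ≤
    (k + 2 : ℝ) * EE A (k + 2)) ∧ PS A = EE A 1 := by
  induction A using Finset.induction_on with
  | empty => simp [EE_empty_succ, PS, PQ]
  | insert a A ha ih =>
    obtain ⟨ih, ih1⟩ := ih
    have e : PS (insert a A) = (a : ℝ)⁻¹ + PS A := by unfold PS; rw [Finset.sum_insert ha]
    have e' : PQ (insert a A) = ((a : ℝ)⁻¹)^2 + PQ A := by unfold PQ; rw [Finset.sum_insert ha]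
    have ha0 : (0 : ℝ) ≤ (a : ℝ)⁻¹ := by positivity
    refine ⟨?_, ?_⟩
    · intro k
      rw [e, e', EE_insert ha, EE_insert ha]
      cases k with
      | zero =>
        have := ih 0
        simp only [EE_zero, zero_add, ← ih1] at *
        push_cast at *
        linarith
      | succ k =>
        rw [EE_insert ha]
        have h1 := ih (k+1)
        have h2 := mul_le_mul_of_nonneg_left (ih k) ha0
        have h3 := mul_nonneg (mul_nonneg (mul_nonneg ha0 ha0) ha0) (EE_nonneg A k)
        push_cast at *
        linarith
    · rw [e, EE_insert ha, EE_zero, ih1]; ring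

lemma EE_upper (A : Finset ℕ) (k : ℕ) : (k.factorial : ℝ) * EE A k ≤ PS A ^ k := by
  induction k with
  | zero => simp [EE_zero]
  | succ k ih =>
    have h := mul_le_mul_of_nonneg_left (EE_upper1 A k) (Nat.cast_nonneg (α := ℝ) k.factorial)
    have h2 := mul_le_mul_of_nonneg_left ih (PS_nonneg A)
    rw [Nat.factorial_succ, pow_succ]
    push_cast
    linarith

lemma EE_lower (A : Finset ℕ) (hP : 0 < PS A) (k : ℕ) :
    PS A ^ k * (1 - (k : ℝ)^2 * PQ A / (2 * PS A ^ 2)) ≤ (k.factorial : ℝ) * EE A k := by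
  have key : ∀ k : ℕ, PS A ^ (k+1) * (1 - ((k+1 : ℕ) : ℝ) * k * PQ A / (2 * PS A ^ 2))
      ≤ ((k+1).factorial : ℝ) * EE A (k+1) := by
    intro k
    induction k with
    | zero => simp [← (EE_lower1 A).2]
    | succ k ih =>
      have h := mul_le_mul_of_nonneg_left ((EE_lower1 A).1 k)
        (Nat.cast_nonneg (α := ℝ) (k+1).factorial)
      have h2 := mul_le_mul_of_nonneg_left ih (PS_nonneg A)
      have h3 := mul_le_mul_of_nonneg_left (EE_upper A k)
        (mul_nonneg (PQ_nonneg A) (by positivity : (0:ℝ) ≤ k + 1))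
      have e1 : ((k+1+1).factorial : ℝ) = (k + 2) * (k+1).factorial := by
        rw [Nat.factorial_succ (k+1)]; push_cast; ring
      have e2 : ((k+1).factorial : ℝ) = (k + 1) * k.factorial := by
        rw [Nat.factorial_succ k]; push_cast; ring
      have e3 : PS A ^ (k+1+1) * (1 - ((k+1+1 : ℕ) : ℝ) * (k+1 : ℕ) * PQ A / (2 * PS A ^ 2))
          = PS A * (PS A ^ (k+1) * (1 - ((k+1 : ℕ) : ℝ) * k * PQ A / (2 * PS A ^ 2)))
            - PQ A * (k+1) * PS A ^ k := by
        push_cast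
        field_simp
        ring
      have e4 : k + 1 + 1 = k + 2 := rfl
      rw [e3, e1, e4]
      have h5 : PS A * (((k+1).factorial : ℝ) * EE A (k+1)) - PQ A * (k+1) * ((k.factorial : ℝ) * EE A k)
          ≤ (k + 2) * (k+1).factorial * EE A (k+2) := by
        rw [e2] at h ⊢
        linarith
      linarith
  cases k with
  | zero => simp [EE_zero]
  | succ k =>
    refine le_trans ?_ (key k)
    have : ((k+1 : ℕ) : ℝ) * k * PQ A / (2 * PS A ^ 2) ≤ ((k+1 : ℕ) : ℝ)^2 * PQ A / (2 * PS A ^ 2) := by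
      have := PQ_nonneg A
      gcongr
      push_cast; nlinarith
    gcongr

lemma EE_mono {A B : Finset ℕ} (h : A ⊆ B) (k : ℕ) : EE A k ≤ EE B k := by
  unfold EE
  apply Finset.sum_le_sum_of_subset_of_nonneg (Finset.powersetCard_mono h)
  intros; positivity

lemma PQ_le (A : Finset ℕ) (m : ℕ) (hm : 2 ≤ m) (h : ∀ p ∈ A, m ≤ p) : PQ A ≤ 1 / ((m : ℝ) - 1) := by
  have key : ∀ n : ℕ, m ≤ n → ∑ p ∈ Finset.Ico m n, ((p : ℝ)⁻¹)^2 ≤ 1 / ((m : ℝ) - 1) - 1 / ((n : ℝ) - 1) := by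
    intro n hn
    induction n, hn using Nat.le_induction with
    | base => simp
    | succ n hn ih =>
      rw [Finset.sum_Ico_succ_top hn]
      have h2 : (2 : ℝ) ≤ n := by exact_mod_cast hm.trans hn
      have : ((n : ℝ)⁻¹)^2 ≤ 1 / ((n : ℝ) - 1) - 1 / (((n + 1 : ℕ) : ℝ) - 1) := by
        push_cast
        have h3 : (n : ℝ) - 1 > 0 := by linarith
        have e : 1 / ((n : ℝ) - 1) - 1 / ((n : ℝ) + 1 - 1) = 1 / (n * (n - 1)) := by
          have : (n : ℝ) - 1 ≠ 0 := h3.ne'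
          rw [add_sub_cancel_right]
          field_simp
          ring
        rw [e, inv_pow, ← one_div]
        apply one_div_le_one_div_of_le
        · positivity
        · nlinarith
      linarith
  obtain ⟨n, hn⟩ : ∃ n, ∀ p ∈ A, p < n := ⟨A.sup id + 1, fun p hp => by
    have := Finset.le_sup (f := id) hp
    simp at this; omega⟩
  have hsub : A ⊆ Finset.Ico m (max m n) := by
    intro p hp
    rw [Finset.mem_Ico]
    exact ⟨h p hp, lt_of_lt_of_le (hn p hp) (le_max_right _ _)⟩
  have h1 : PQ A ≤ ∑ p ∈ Finset.Ico m (max m n), ((p : ℝ)⁻¹)^2 :=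
    Finset.sum_le_sum_of_subset_of_nonneg hsub (fun _ _ _ => by positivity)
  have h2 := key (max m n) (le_max_left _ _)
  have h3 : 0 ≤ 1 / (((max m n : ℕ) : ℝ) - 1) := by
    have : (2 : ℝ) ≤ ((max m n : ℕ) : ℝ) := by exact_mod_cast hm.trans (le_max_left _ _)
    apply one_div_nonneg.2; linarith
  linarith

/-- Lower bound for elementary symmetric functions of primes at least 11. -/
lemma EE_lower' (A : Finset ℕ) (hA : ∀ p ∈ A, 11 ≤ p) (hP : 0 < PS A) (k : ℕ)
    (hk : (k : ℝ) ≤ 3 * PS A) : PS A ^ k / 2 ≤ (k.factorial : ℝ) * EE A k := by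
  refine le_trans ?_ (EE_lower A hP k)
  have hq := PQ_le A 11 (by norm_num) hA
  have hq0 := PQ_nonneg A
  have h1 : (k : ℝ)^2 * PQ A / (2 * PS A ^ 2) ≤ 1/2 := by
    rw [div_le_iff₀ (by positivity)]
    have : (k : ℝ)^2 ≤ 9 * PS A ^ 2 := by
      have : (k : ℝ)^2 ≤ (3 * PS A)^2 := by gcongr
      linarith
    norm_num at hq
    calc (k : ℝ)^2 * PQ A ≤ (9 * PS A ^ 2) * (1 / 10) := by gcongr
      _ ≤ _ := by nlinarith [sq_nonneg (PS A)]
  calc PS A ^ k / 2 = PS A ^ k * (1 - 1/2) := by ring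
    _ ≤ _ := by gcongr

lemma stirling_upper (k : ℕ) (hk : 1 ≤ k) :
    (k.factorial : ℝ) ≤ Real.exp 1 * (√k * ((k : ℝ) / Real.exp 1) ^ k) := by
  have h := Stirling.stirlingSeq'_antitone (Nat.zero_le (k - 1))
  have e : (k - 1).succ = k := by omega
  simp only [Function.comp, e] at h
  rw [show Nat.succ 0 = 1 from rfl, Stirling.stirlingSeq_one] at h
  have hk0 : (0 : ℝ) < k := by exact_mod_cast hk
  unfold Stirling.stirlingSeq at h
  rw [div_le_iff₀ (by positivity)] at h
  refine h.trans (le_of_eq ?_)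
  rw [Real.sqrt_mul (by norm_num)]
  have : √(2 : ℝ) ≠ 0 := by positivity
  field_simp

lemma stirling_lower (k : ℕ) :
    √k * ((k : ℝ) / Real.exp 1) ^ k ≤ (k.factorial : ℝ) := by
  refine le_trans ?_ (Stirling.le_factorial_stirling k)
  gcongr
  nlinarith [Real.pi_gt_three, Nat.cast_nonneg (α := ℝ) k]

lemma pow_eq (P l : ℝ) (k : ℕ) (hP : 0 < P) (hl : 0 < l) (hk : 1 ≤ k) :
    P ^ k * l ^ k = ((k : ℝ) / Real.exp 1) ^ k *
      Real.exp (l * P * ((k / (l * P)) - (k / (l * P)) * Real.log (k / (l * P)))) := by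
  have hk0 : (0 : ℝ) < k := by exact_mod_cast hk
  have e : l * P * ((k / (l * P)) - (k / (l * P)) * Real.log (k / (l * P)))
      = (k : ℝ) * (1 - Real.log (k / (l * P))) := by
    field_simp
  rw [e, Real.exp_nat_mul, ← mul_pow, ← mul_pow, Real.exp_sub, Real.exp_log (by positivity)]
  congr 1
  have := Real.exp_pos 1
  field_simp

lemma poisson_upper (P l : ℝ) (k : ℕ) (hP : 0 < P) (hl : 0 < l) (hk : 1 ≤ k) :
    P ^ k * l ^ k * √k ≤ Real.exp (l * P) * k.factorial := by
  have hk0 : (0 : ℝ) < k := by exact_mod_cast hk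
  rw [pow_eq P l k hP hl hk]
  set t : ℝ := k / (l * P) with ht
  have ht0 : 0 < t := by positivity
  have h1 : t - t * Real.log t ≤ 1 := by
    have h := Real.log_le_sub_one_of_pos (x := t⁻¹) (by positivity)
    rw [Real.log_inv] at h
    have := mul_le_mul_of_nonneg_left h ht0.le
    have e : t * (t⁻¹ - 1) = 1 - t := by field_simp
    rw [e] at this
    linarith
  have h2 : Real.exp (l * P * (t - t * Real.log t)) ≤ Real.exp (l * P) := by
    rw [Real.exp_le_exp]
    nlinarith [mul_pos hl hP]
  calc _ = Real.exp (l * P * (t - t * Real.log t)) * (√k * ((k : ℝ) / Real.exp 1) ^ k) := by ring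
    _ ≤ _ := mul_le_mul h2 (stirling_lower k) (by positivity) (by positivity)

lemma poisson_lower (P l Q : ℝ) (k : ℕ) (hP : 0 < P) (hl : 1 ≤ l) (hk : 1 ≤ k)
    (hQ : ((k : ℝ) - l * P) ^ 2 ≤ Q * P) :
    Real.exp (l * P - Q) * k.factorial ≤ Real.exp 1 * (P ^ k * l ^ k * √k) := by
  have hk0 : (0 : ℝ) < k := by exact_mod_cast hk
  have hl0 : 0 < l := by linarith
  rw [pow_eq P l k hP hl0 hk]
  set t : ℝ := k / (l * P) with ht
  have ht0 : 0 < t := by positivity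
  have h1 : 1 - (t - 1) ^ 2 ≤ t - t * Real.log t := by
    have h := Real.log_le_sub_one_of_pos ht0
    have := mul_le_mul_of_nonneg_left h ht0.le
    nlinarith
  have h3 : l * P * (t - 1) ^ 2 ≤ Q := by
    have e : l * P * (t - 1) ^ 2 = ((k : ℝ) - l * P) ^ 2 / (l * P) := by
      rw [ht]; field_simp
    rw [e, div_le_iff₀ (by positivity)]
    have hQ0 : 0 ≤ Q := by
      by_contra hneg
      push Not at hneg
      nlinarith [sq_nonneg ((k : ℝ) - l * P)]
    nlinarith [mul_nonneg hQ0 hP.le]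
  have h2 : Real.exp (l * P - Q) ≤ Real.exp (l * P * (t - t * Real.log t)) := by
    rw [Real.exp_le_exp]
    nlinarith [mul_pos hl0 hP]
  calc _ ≤ Real.exp (l * P * (t - t * Real.log t)) *
        (Real.exp 1 * (√k * ((k : ℝ) / Real.exp 1) ^ k)) :=
        mul_le_mul h2 (stirling_upper k hk) (by positivity) (by positivity)
    _ = _ := by ring

lemma primeProd_eq (x : ℝ) : primeProd 1 x = ∏ p ∈ pp x, ((1 : ℝ) + 1 / p)⁻¹ := by
  unfold primeProd
  have : {p : ℕ | p.Prime ∧ (1 : ℝ) ≤ (p : ℝ) ∧ (p : ℝ) < x} = ((pp x : Finset ℕ) : Set ℕ) := by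
    ext p
    simp only [Set.mem_ofPred_eq, Finset.mem_coe, mem_pp]
    constructor
    · rintro ⟨h1, _, h2⟩; exact ⟨h1, h2⟩
    · rintro ⟨h1, h2⟩; exact ⟨h1, by exact_mod_cast h1.one_le, h2⟩
  rw [this, finprod_mem_coe_finset]

lemma primeProd_lower (x : ℝ) : Real.exp (-PS (pp x)) ≤ primeProd 1 x := by
  rw [primeProd_eq, PS, ← Finset.sum_neg_distrib, Real.exp_sum]
  apply Finset.prod_le_prod
  · intros; positivity
  · intro p _
    rw [Real.exp_neg, one_div]
    have : 0 ≤ (p : ℝ)⁻¹ := by positivity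
    gcongr
    linarith [Real.add_one_le_exp ((p : ℝ)⁻¹)]

lemma primeProd_upper (x : ℝ) : primeProd 1 x ≤ Real.exp (1 - PS (pp x)) := by
  have hq : PQ (pp x) ≤ 1 := by
    have := PQ_le (pp x) 2 le_rfl (fun p hp => (mem_pp.1 hp).1.two_le)
    norm_num at this; exact this
  have h : primeProd 1 x ≤ Real.exp (PQ (pp x) - PS (pp x)) := by
    rw [primeProd_eq, PS, PQ, ← Finset.sum_sub_distrib, Real.exp_sum]
    apply Finset.prod_le_prod
    · intros; positivity
    · intro p _
      have h0 : 0 ≤ (p : ℝ)⁻¹ := by positivity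
      rw [one_div]
      set a := (p : ℝ)⁻¹
      have h1 : 1 - a + a ^ 2 ≤ Real.exp (a ^ 2 - a) := by
        linarith [Real.add_one_le_exp (a ^ 2 - a)]
      refine le_trans ?_ h1
      rw [inv_le_iff_one_le_mul₀ (by positivity)]
      nlinarith [pow_nonneg h0 3]
  exact h.trans (Real.exp_le_exp.2 (by linarith))

lemma nsmall_primeFactors (n : ℕ) (y : ℝ) :
    (nsmall n y).primeFactors = n.primeFactors.filter (fun p : ℕ => (p : ℝ) < y) := by
  unfold nsmall
  exact Nat.primeFactors_prod (fun p hp => Nat.prime_of_mem_primeFactors (Finset.mem_filter.1 hp).1)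

lemma sum_eq (x y : ℝ) (hxy : y ≤ x) (k j : ℕ) :
    ∑ᶠ n ∈ {n | n ∈ Sset 1 x ∧ omegaN n = k + j ∧ omegaN (nsmall n y) = k}, ((n : ℝ))⁻¹
      = EE (pp y) k * EE (pp x \ pp y) j := by
  set F : Finset ℕ × Finset ℕ → ℕ := fun q => ∏ p ∈ q.1 ∪ q.2, p with hF
  set I := (pp y).powersetCard k ×ˢ (pp x \ pp y).powersetCard j with hI
  have hmem : ∀ q ∈ I, q.1 ⊆ pp y ∧ q.1.card = k ∧ q.2 ⊆ pp x \ pp y ∧ q.2.card = j := by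
    intro q hq
    rw [hI, Finset.mem_product, Finset.mem_powersetCard, Finset.mem_powersetCard] at hq
    exact ⟨hq.1.1, hq.1.2, hq.2.1, hq.2.2⟩
  have hdis : ∀ q ∈ I, Disjoint q.1 q.2 := by
    intro q hq
    obtain ⟨h1, _, h2, _⟩ := hmem q hq
    exact Finset.disjoint_of_subset_left h1 (Finset.disjoint_of_subset_right h2 Finset.disjoint_sdiff)
  have hx : ∀ q ∈ I, ∀ p ∈ q.1 ∪ q.2, p.Prime ∧ (p : ℝ) < x := by
    intro q hq p hp
    obtain ⟨h1, _, h2, _⟩ := hmem q hq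
    rcases Finset.mem_union.1 hp with h | h
    · have := mem_pp.1 (h1 h)
      exact ⟨this.1, lt_of_lt_of_le this.2 hxy⟩
    · exact mem_pp.1 (Finset.mem_sdiff.1 (h2 h)).1
  have hpf : ∀ q ∈ I, (F q).primeFactors = q.1 ∪ q.2 := fun q hq =>
    Nat.primeFactors_prod (fun p hp => (hx q hq p hp).1)
  have hfil : ∀ q ∈ I, (q.1 ∪ q.2).filter (fun p : ℕ => (p : ℝ) < y) = q.1 := by
    intro q hq
    obtain ⟨h1, _, h2, _⟩ := hmem q hq
    ext p
    simp only [Finset.mem_filter, Finset.mem_union]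
    constructor
    · rintro ⟨h | h, hy⟩
      · exact h
      · have := Finset.mem_sdiff.1 (h2 h)
        exact absurd (mem_pp.2 ⟨(mem_pp.1 this.1).1, hy⟩) this.2
    · intro h
      exact ⟨Or.inl h, (mem_pp.1 (h1 h)).2⟩
  have hset : {n | n ∈ Sset 1 x ∧ omegaN n = k + j ∧ omegaN (nsmall n y) = k}
      = ((I.image F : Finset ℕ) : Set ℕ) := by
    ext n
    simp only [Set.mem_ofPred_eq, Finset.coe_image, Set.mem_image, Finset.mem_coe]
    constructor
    · rintro ⟨⟨hn0, hsq, hn⟩, hr, hk⟩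
      refine ⟨(n.primeFactors.filter (fun p : ℕ => (p : ℝ) < y),
        n.primeFactors.filter (fun p : ℕ => ¬ (p : ℝ) < y)), ?_, ?_⟩
      · have hk' : (n.primeFactors.filter (fun p : ℕ => (p : ℝ) < y)).card = k := by
          rw [← nsmall_primeFactors]; exact hk
        have hc := Finset.card_filter_add_card_filter_not (s := n.primeFactors)
          (fun p : ℕ => (p : ℝ) < y)
        unfold omegaN at hr
        rw [hI, Finset.mem_product, Finset.mem_powersetCard, Finset.mem_powersetCard]
        refine ⟨⟨?_, hk'⟩, ?_, by dsimp only; omega⟩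
        · intro p hp
          rw [Finset.mem_filter] at hp
          exact mem_pp.2 ⟨Nat.prime_of_mem_primeFactors hp.1, hp.2⟩
        · intro p hp
          simp only [Finset.mem_filter] at hp
          rw [Finset.mem_sdiff, mem_pp, mem_pp]
          exact ⟨⟨Nat.prime_of_mem_primeFactors hp.1, (hn p hp.1).2⟩, fun h => hp.2 h.2⟩
      · simp only [hF]
        rw [Finset.filter_union_filter_not_eq]
        exact Nat.prod_primeFactors_of_squarefree hsq
    · rintro ⟨q, hq, rfl⟩
      obtain ⟨h1, h1', h2, h2'⟩ := hmem q hq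
      refine ⟨⟨?_, ?_, ?_⟩, ?_, ?_⟩
      · exact Finset.prod_pos (fun p hp => (hx q hq p hp).1.pos)
      · apply Finset.squarefree_prod_of_pairwise_isCoprime
        · intro a ha b hb hab
          exact Nat.coprime_iff_isRelPrime.1
            ((Nat.coprime_primes (hx q hq a ha).1 (hx q hq b hb).1).2 hab)
        · intro p hp
          exact (hx q hq p hp).1.prime.squarefree
      · intro p hp
        rw [hpf q hq] at hp
        have := hx q hq p hp
        exact ⟨by exact_mod_cast this.1.one_le, this.2⟩
      · unfold omegaN
        rw [hpf q hq, Finset.card_union_of_disjoint (hdis q hq), h1', h2']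
      · unfold omegaN
        rw [nsmall_primeFactors, hpf q hq, hfil q hq, h1']
  have hinj : Set.InjOn F (I : Set (Finset ℕ × Finset ℕ)) := by
    intro q hq q' hq' h
    have hu : q.1 ∪ q.2 = q'.1 ∪ q'.2 := by rw [← hpf q hq, ← hpf q' hq', h]
    have h1 : q.1 = q'.1 := by rw [← hfil q hq, ← hfil q' hq', hu]
    have h2 : q.2 = q'.2 := by
      rw [← Finset.union_sdiff_cancel_left (hdis q hq), ← Finset.union_sdiff_cancel_left (hdis q' hq'),
        hu, h1]
    exact Prod.ext h1 h2
  rw [hset, finsum_mem_coe_finset, Finset.sum_image hinj, EE, EE, Finset.sum_mul_sum,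
    ← Finset.sum_product']
  apply Finset.sum_congr rfl
  intro q hq
  simp only [hF]
  rw [Finset.prod_union (hdis q hq)]
  push_cast
  rw [mul_inv, Finset.prod_inv_distrib, Finset.prod_inv_distrib]

lemma core_upper (A B : Finset ℕ) (k j : ℕ) (W C M L ε v : ℝ) (hL : 0 < L) (hε : 0 < ε)
    (hv : 0 < v) (hk : 1 ≤ k) (hj : 1 ≤ j) (hW0 : 0 ≤ W)
    (hW : W ≤ Real.exp (1 - (PS A + PS B))) (hA : PS A ≤ M + C)
    (hA0 : 0 < PS A) (hB0 : 0 < PS B) (hE : Real.exp M = 2 ^ k * v)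
    (hkL : ε * L / 2 ≤ k) (hjL : ε * L / 2 ≤ j) :
    W * (EE A k * EE B j) ≤ Real.exp (1 + C) * (2 / ε) * v / L := by
  have hk0 : (0 : ℝ) < k := by exact_mod_cast hk
  have hj0 : (0 : ℝ) < j := by exact_mod_cast hj
  have h1 : EE A k ≤ Real.exp (2 * PS A) / (2 ^ k * √k) := by
    rw [le_div_iff₀ (by positivity)]
    have h := poisson_upper (PS A) 2 k hA0 (by norm_num) hk
    have h' := mul_le_mul_of_nonneg_right (EE_upper A k) (by positivity : 0 ≤ (2:ℝ) ^ k * √k)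
    have hf : (0 : ℝ) < k.factorial := by positivity
    apply le_of_mul_le_mul_left _ hf
    linarith
  have h2 : EE B j ≤ Real.exp (PS B) / √j := by
    rw [le_div_iff₀ (by positivity)]
    have h := poisson_upper (PS B) 1 j hB0 (by norm_num) hj
    rw [one_pow, one_mul, mul_one] at h
    have h' := mul_le_mul_of_nonneg_right (EE_upper B j) (by positivity : 0 ≤ √(j : ℝ))
    have hf : (0 : ℝ) < j.factorial := by positivity
    apply le_of_mul_le_mul_left _ hf
    linarith
  have h3 : ε * L / 2 ≤ √k * √j := by
    have e : ε * L / 2 = √(ε * L / 2) * √(ε * L / 2) := (Real.mul_self_sqrt (by positivity)).symm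
    rw [e]
    gcongr
  calc W * (EE A k * EE B j)
      ≤ Real.exp (1 - (PS A + PS B)) * (Real.exp (2 * PS A) / (2 ^ k * √k) * (Real.exp (PS B) / √j)) := by
        have := EE_nonneg A k
        have := EE_nonneg B j
        gcongr
    _ = Real.exp (1 + PS A) / (2 ^ k * (√k * √j)) := by
        have e : Real.exp (1 + PS A) = Real.exp (1 - (PS A + PS B)) * Real.exp (2 * PS A) * Real.exp (PS B) := by
          rw [← Real.exp_add, ← Real.exp_add]; congr 1; ring
        rw [e]
        field_simp
    _ ≤ Real.exp (1 + C + M) / (2 ^ k * (ε * L / 2)) := by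
        have hh : Real.exp (1 + PS A) ≤ Real.exp (1 + C + M) := Real.exp_le_exp.2 (by linarith)
        gcongr
    _ = Real.exp (1 + C) * (2 / ε) * v / L := by
        rw [Real.exp_add, hE]
        field_simp

lemma core_lower (A A' B : Finset ℕ) (k j : ℕ) (W C s M L Q v : ℝ) (hL : 0 < L)
    (hv : 0 < v) (hk : 1 ≤ k) (hj : 1 ≤ j)
    (hW : Real.exp (-(PS A + PS B)) ≤ W) (hAM : M - C ≤ PS A) (hAA : A' ⊆ A)
    (hAs : PS A - s ≤ PS A') (hA11 : ∀ p ∈ A', 11 ≤ p) (hB11 : ∀ p ∈ B, 11 ≤ p)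
    (hA0 : 0 < PS A') (hB0 : 0 < PS B) (hE : Real.exp M = 2 ^ k * v)
    (hk3 : (k : ℝ) ≤ 3 * PS A') (hj3 : (j : ℝ) ≤ 3 * PS B)
    (hkQ : ((k : ℝ) - 2 * PS A') ^ 2 ≤ Q * PS A') (hjQ : ((j : ℝ) - PS B) ^ 2 ≤ Q * PS B)
    (hkL : (k : ℝ) ≤ 2 * L) (hjL : (j : ℝ) ≤ 2 * L) :
    Real.exp (-C - 2 * s - 2 * Q - 2) / 8 * v / L ≤ W * (EE A k * EE B j) := by
  have hk0 : (0 : ℝ) < k := by exact_mod_cast hk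
  have hj0 : (0 : ℝ) < j := by exact_mod_cast hj
  have h1 : Real.exp (2 * PS A' - Q - 1) / (2 * (2 ^ k * √k)) ≤ EE A k := by
    refine le_trans ?_ (EE_mono hAA k)
    rw [div_le_iff₀ (by positivity)]
    have h := poisson_lower (PS A') 2 Q k hA0 (by norm_num) hk hkQ
    have h' := mul_le_mul_of_nonneg_right (EE_lower' A' hA11 hA0 k hk3)
      (by positivity : 0 ≤ (2:ℝ) ^ k * √k)
    have hf : (0 : ℝ) < k.factorial := by positivity
    rw [Real.exp_sub _ 1, div_le_iff₀ (Real.exp_pos 1)]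
    apply le_of_mul_le_mul_left _ hf
    have h'' := mul_le_mul_of_nonneg_left h' (Real.exp_pos 1).le
    linarith
  have h2 : Real.exp (PS B - Q - 1) / (2 * √j) ≤ EE B j := by
    rw [div_le_iff₀ (by positivity)]
    have h := poisson_lower (PS B) 1 Q j hB0 le_rfl hj (by simpa using hjQ)
    rw [one_pow, one_mul, mul_one] at h
    have h' := mul_le_mul_of_nonneg_right (EE_lower' B hB11 hB0 j hj3)
      (by positivity : 0 ≤ √(j : ℝ))
    have hf : (0 : ℝ) < j.factorial := by positivity
    rw [Real.exp_sub _ 1, div_le_iff₀ (Real.exp_pos 1)]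
    apply le_of_mul_le_mul_left _ hf
    have h'' := mul_le_mul_of_nonneg_left h' (Real.exp_pos 1).le
    linarith
  have h3 : √k * √j ≤ 2 * L := by
    have e : 2 * L = √(2 * L) * √(2 * L) := (Real.mul_self_sqrt (by positivity)).symm
    rw [e]
    gcongr
  calc Real.exp (-C - 2 * s - 2 * Q - 2) / 8 * v / L
      = Real.exp (M - C - 2 * s - 2 * Q - 2) / (4 * (2 ^ k * (2 * L))) := by
        have e : Real.exp (M - C - 2 * s - 2 * Q - 2) = Real.exp M * Real.exp (-C - 2 * s - 2 * Q - 2) := by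
          rw [← Real.exp_add]; congr 1; ring
        rw [e, hE]
        field_simp
        norm_num
    _ ≤ Real.exp (2 * PS A' - PS A - 2 * Q - 2) / (4 * (2 ^ k * (√k * √j))) := by
        have hh : Real.exp (M - C - 2 * s - 2 * Q - 2) ≤
            Real.exp (2 * PS A' - PS A - 2 * Q - 2) := Real.exp_le_exp.2 (by linarith)
        gcongr
    _ = Real.exp (-(PS A + PS B)) * (Real.exp (2 * PS A' - Q - 1) / (2 * (2 ^ k * √k))
          * (Real.exp (PS B - Q - 1) / (2 * √j))) := by
        have e : Real.exp (2 * PS A' - PS A - 2 * Q - 2) = Real.exp (-(PS A + PS B)) *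
            Real.exp (2 * PS A' - Q - 1) * Real.exp (PS B - Q - 1) := by
          rw [← Real.exp_add, ← Real.exp_add]; congr 1; ring
        rw [e]
        field_simp
        norm_num
    _ ≤ W * (EE A k * EE B j) := by
        have := EE_nonneg A k
        have := EE_nonneg B j
        have hW0 : 0 ≤ W := (Real.exp_pos _).le.trans hW
        gcongr

lemma LLog2_inv (y : ℝ) (h : 1 < LLog2 y) (hy : 0 < y) :
    Real.log (Real.log y) = LLog2 y ∧ y = Real.exp (Real.exp (LLog2 y)) := by
  have h1 : LLog2 y = Real.log (LLog y) := by
    unfold LLog2 at h ⊢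
    rw [LLog] at h ⊢
    exact max_eq_right (by rcases max_cases 1 (Real.log (LLog y)) with ⟨a, _⟩ | ⟨_, b⟩ <;> linarith)
  have h2 : LLog y = Real.log y := by
    have h3 : 1 < LLog y := by
      by_contra hc
      push Not at hc
      have h0 : 1 ≤ LLog y := le_max_left _ _
      have : LLog y = 1 := le_antisymm hc h0
      rw [this, Real.log_one] at h1
      linarith
    rw [LLog] at h3 ⊢
    exact max_eq_right (by rcases max_cases 1 (Real.log y) with ⟨a, _⟩ | ⟨_, b⟩ <;> linarith)
  have hpos : 0 < Real.log y := by
    rw [← h2]; exact lt_of_lt_of_le one_pos (le_max_left _ _)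
  rw [h1, h2]
  refine ⟨rfl, ?_⟩
  rw [Real.exp_log hpos, Real.exp_log hy]

lemma LLog2_large (S x : ℝ) (hS : 1 ≤ S) (hx : Real.exp (Real.exp S) ≤ x) : S ≤ LLog2 x := by
  have h1 : Real.exp S ≤ Real.log x := (Real.le_log_iff_exp_le ((Real.exp_pos _).trans_le hx)).2 hx
  have h2 : Real.exp S ≤ LLog x := h1.trans (le_max_right _ _)
  have h3 : S ≤ Real.log (LLog x) := (Real.le_log_iff_exp_le ((Real.exp_pos _).trans_le h2)).2 h2
  exact h3.trans (le_max_right _ _)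

end S11

set_option maxHeartbeats 2000000

theorem statement11 (ε : ℝ) (hε : 0 < ε) (hε' : ε < 1/2) :
    ∃ c₁ c₂ : ℝ, 0 < c₁ ∧ c₁ < c₂ ∧ ∃ x₀ : ℝ, ∀ x : ℝ, x₀ ≤ x → ∀ r : ℕ,
      (1 + ε) * LLog2 x ≤ r → (r : ℝ) ≤ (2 - ε) * LLog2 x →
      ∀ y ∈ Yset ((r : ℝ) / LLog2 x - 1) x, ∀ u ∈ Uset ((r : ℝ) / LLog2 x - 1) x,
      c₁ * (2:ℝ) ^ (-u) / LLog2 x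
          ≤ primeProd 1 x * ∑ᶠ n ∈ {n | n ∈ Sset 1 x ∧ omegaN n = r ∧
              (omegaN (nsmall n y) : ℝ) = LLog2 y / Real.log 2 + u}, ((n : ℝ))⁻¹ ∧
        primeProd 1 x * ∑ᶠ n ∈ {n | n ∈ Sset 1 x ∧ omegaN n = r ∧
              (omegaN (nsmall n y) : ℝ) = LLog2 y / Real.log 2 + u}, ((n : ℝ))⁻¹
          ≤ c₂ * (2:ℝ) ^ (-u) / LLog2 x := by
  obtain ⟨C, hC0, hC⟩ := S11.mertens2
  set s : ℝ := S11.PS (S11.pp 11) with hs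
  have hs0 : 0 ≤ s := S11.PS_nonneg _
  set S0 : ℝ := 12 / ε + 2 * (C + s) + 20 with hS0
  have hS0pos : 0 < S0 := by positivity
  have hS020 : 20 ≤ S0 := by
    have : 0 < 12 / ε := by positivity
    linarith
  refine ⟨Real.exp (-C - 2 * s - 2 * (72 / ε) - 2) / 8, Real.exp (1 + C) * (2 / ε), by positivity,
    ?_, Real.exp (Real.exp (S0 ^ 2)), ?_⟩
  · have h1 : Real.exp (-C - 2 * s - 2 * (72 / ε) - 2) ≤ 1 := by
      rw [Real.exp_le_one_iff]
      have : 0 < 72 / ε := by positivity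
      linarith
    have h2 : 1 ≤ Real.exp (1 + C) := Real.one_le_exp (by linarith)
    have h3 : 1 ≤ 2 / ε := by rw [le_div_iff₀ hε]; linarith
    nlinarith
  intro x hx r hr1 hr2 y hy u hu
  set L := LLog2 x with hL
  have hLS : S0 ^ 2 ≤ L := S11.LLog2_large _ x (by nlinarith) hx
  have hx0 : 0 < x := (Real.exp_pos _).trans_le hx
  set S := Real.sqrt L with hS
  have hSS0 : S0 ≤ S := Real.le_sqrt_of_sq_le hLS
  have hL0 : 0 < L := by nlinarith
  have hSL : S ^ 2 = L := Real.sq_sqrt hL0.le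
  have h12 : 0 < 12 / ε := by positivity
  have hS1 : 12 / ε ≤ S := by linarith
  have hS2 : 2 * (C + s) ≤ S := by linarith
  have hS3 : 20 ≤ S := by linarith
  have hεS : 12 ≤ ε * S := by rw [div_le_iff₀ hε] at hS1; linarith
  have hεL : 12 * S ≤ ε * L := by rw [← hSL]; nlinarith
  obtain ⟨hy0, hyM, m, hm⟩ := hy
  set M := LLog2 y with hM
  have hu : |(u : ℝ) - (Real.log 4 - 1) / Real.log 2 * (((r : ℝ) / L - 1) * L)| ≤ S := hu
  set a := ((r : ℝ) / L - 1) * L with ha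
  have har : (r : ℝ) = L + a := by rw [ha]; field_simp; ring
  have ha1 : ε * L ≤ a := by linarith
  have ha2 : a ≤ L - ε * L := by linarith
  have hyM' := abs_le.1 hyM
  have hu' := abs_le.1 hu
  have hl2 : 0 < Real.log 2 := Real.log_pos (by norm_num)
  have hl2' : 0.69 < Real.log 2 := by linarith [Real.log_two_gt_d9]
  have hl4 : Real.log 4 = 2 * Real.log 2 := by
    rw [show (4 : ℝ) = 2 ^ 2 by norm_num, Real.log_pow]; norm_num
  have hmM : M / Real.log 2 = m := by rw [hm]; field_simp
  have hM1 : 1 < M := by linarith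
  have hML : M ≤ L := by linarith
  obtain ⟨hyl, hye⟩ := S11.LLog2_inv y hM1 hy0
  obtain ⟨hxl, hxe⟩ := S11.LLog2_inv x (lt_of_lt_of_le hM1 hML) hx0
  have hyx : y ≤ x := by
    rw [hye, hxe]
    exact Real.exp_le_exp.2 (Real.exp_le_exp.2 hML)
  have hy11 : 11 ≤ y := by
    rw [hye]
    have h1 := Real.add_one_le_exp (Real.exp (LLog2 y))
    have h2 := Real.add_one_le_exp (LLog2 y)
    linarith
  have hk' : |((m + u : ℤ) : ℝ) - 2 * a| ≤ 2.5 * S := by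
    have e : ((m + u : ℤ) : ℝ) - 2 * a = (M - a) / Real.log 2
        + ((u : ℝ) - (Real.log 4 - 1) / Real.log 2 * a) := by
      push_cast
      rw [← hmM, hl4]
      field_simp
      ring
    have h1 : |(M - a) / Real.log 2| ≤ 1.5 * S := by
      rw [abs_div, abs_of_pos hl2, div_le_iff₀ hl2]
      nlinarith [mul_nonneg (by linarith : (0:ℝ) ≤ S) (sub_nonneg.2 hl2'.le)]
    rw [e]
    linarith [abs_add_le ((M - a) / Real.log 2) ((u : ℝ) - (Real.log 4 - 1) / Real.log 2 * a)]
  obtain ⟨k, hk⟩ : ∃ k : ℕ, (k : ℤ) = m + u := by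
    apply Int.eq_ofNat_of_zero_le _ |>.imp
    · intro k h; exact h.symm
    · have : (0 : ℝ) ≤ ((m + u : ℤ) : ℝ) := by linarith [(abs_le.1 hk').1]
      exact_mod_cast this
  have hkR : (k : ℝ) = ((m + u : ℤ) : ℝ) := by rw [← hk]; simp
  rw [← hkR] at hk'
  have hk2 := abs_le.1 hk'
  have hkr : k ≤ r := by
    have : (k : ℝ) ≤ r := by linarith [hk2.2]
    exact_mod_cast this
  obtain ⟨j, rfl⟩ := Nat.exists_eq_add_of_le hkr
  push_cast at har
  have hset : {n | n ∈ Sset 1 x ∧ omegaN n = k + j ∧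
      (omegaN (nsmall n y) : ℝ) = M / Real.log 2 + u}
      = {n | n ∈ Sset 1 x ∧ omegaN n = k + j ∧ omegaN (nsmall n y) = k} := by
    have e : M / Real.log 2 + u = (k : ℝ) := by rw [hkR, hmM]; push_cast; ring
    rw [e]
    ext n
    simp only [Set.mem_ofPred_eq, Nat.cast_inj]
  rw [hset, S11.sum_eq x y hyx k j]
  have hsub : S11.pp y ⊆ S11.pp x := by
    intro p hp
    rw [S11.mem_pp] at *
    exact ⟨hp.1, lt_of_lt_of_le hp.2 hyx⟩
  have hsub11 : S11.pp 11 ⊆ S11.pp y := by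
    intro p hp
    rw [S11.mem_pp] at *
    exact ⟨hp.1, lt_of_lt_of_le hp.2 hy11⟩
  have hPB : S11.PS (S11.pp x) = S11.PS (S11.pp y) + S11.PS (S11.pp x \ S11.pp y) := by
    unfold S11.PS
    rw [add_comm, Finset.sum_sdiff hsub]
  have hPA' : S11.PS (S11.pp y) = s + S11.PS (S11.pp y \ S11.pp 11) := by
    rw [hs]
    unfold S11.PS
    rw [add_comm, Finset.sum_sdiff hsub11]
  have hmx := hC x (by linarith)
  have hmy := hC y (by linarith)
  rw [hxl, hPB] at hmx
  rw [hyl] at hmy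
  have hmx' := abs_le.1 hmx
  have hmy' := abs_le.1 hmy
  have hWl := S11.primeProd_lower x
  have hWu := S11.primeProd_upper x
  rw [hPB] at hWl hWu
  set A := S11.pp y with hA
  set B := S11.pp x \ S11.pp y with hB
  set A' := S11.pp y \ S11.pp 11 with hA'
  set v : ℝ := (2 : ℝ) ^ (-u) with hv
  have hv0 : 0 < v := by positivity
  have hE : Real.exp M = 2 ^ k * v := by
    rw [hm, hv, ← zpow_natCast, ← zpow_add₀ (by norm_num), hk]
    rw [show m + u + -u = m by ring, mul_comm, Real.exp_mul, Real.exp_log (by norm_num),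
      Real.rpow_intCast]
  have hW0 : 0 ≤ primeProd 1 x := (Real.exp_pos _).le.trans hWl
  have hPAl : ε * L / 2 ≤ S11.PS A' := by linarith [hyM'.1, hmy'.1]
  have hPBl : ε * L / 2 ≤ S11.PS B := by linarith [hyM'.2, hmy'.2, hmx'.1]
  have hA0 : 0 < S11.PS A' := by linarith
  have hB0 : 0 < S11.PS B := by linarith
  have hk1 : ε * L / 2 ≤ k := by linarith [hk2.1]
  have hj1 : ε * L / 2 ≤ j := by linarith [hk2.2]
  have hk1' : 1 ≤ k := by
    have : (1 : ℝ) ≤ k := by linarith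
    exact_mod_cast this
  have hj1' : 1 ≤ j := by
    have : (1 : ℝ) ≤ j := by linarith
    exact_mod_cast this
  have hkd : |(k : ℝ) - 2 * S11.PS A'| ≤ 6 * S := by
    rw [abs_le]; constructor <;> linarith [hk2.1, hk2.2, hyM'.1, hyM'.2, hmy'.1, hmy'.2]
  have hjd : |(j : ℝ) - S11.PS B| ≤ 6 * S := by
    rw [abs_le]
    constructor <;> linarith [hk2.1, hk2.2, hyM'.1, hyM'.2, hmy'.1, hmy'.2, hmx'.1, hmx'.2]
  have hQ : ∀ t P : ℝ, ε * L / 2 ≤ P → |t| ≤ 6 * S → t ^ 2 ≤ 72 / ε * P := by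
    intro t P hP ht
    have h1 : t ^ 2 ≤ (6 * S) ^ 2 := sq_le_sq' (abs_le.1 ht).1 (abs_le.1 ht).2
    calc t ^ 2 ≤ 36 * L := by rw [← hSL]; linarith
      _ = 72 / ε * (ε * L / 2) := by field_simp; norm_num
      _ ≤ 72 / ε * P := by gcongr
  push_cast at hr2
  constructor
  · refine S11.core_lower A A' B k j _ C s M L (72 / ε) v hL0 hv0 hk1' hj1' hWl (by linarith [hmy'.1])
      Finset.sdiff_subset (by linarith) ?_ ?_ hA0 hB0 hE ?_ ?_ (hQ _ _ hPAl hkd) (hQ _ _ hPBl hjd)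
      ?_ ?_
    · intro p hp
      rw [hA', Finset.mem_sdiff, S11.mem_pp, S11.mem_pp] at hp
      by_contra hc
      push Not at hc
      exact hp.2 ⟨hp.1.1, by exact_mod_cast hc⟩
    · intro p hp
      rw [hB, Finset.mem_sdiff, S11.mem_pp, S11.mem_pp] at hp
      by_contra hc
      push Not at hc
      have : (p : ℝ) < 11 := by exact_mod_cast hc
      exact hp.2 ⟨hp.1.1, lt_of_lt_of_le this hy11⟩
    · linarith [(abs_le.1 hkd).2]
    · linarith [(abs_le.1 hjd).2]
    · have : (0 : ℝ) ≤ j := by positivity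
      linarith
    · have : (0 : ℝ) ≤ k := by positivity
      linarith
  · exact S11.core_upper A B k j _ C M L ε v hL0 hε hv0 hk1' hj1' hW0 hWu (by linarith [hmy'.2])
      (by linarith) hB0 hE hk1 hj1
end

section
/- For every ε ∈ (0, 1/2) there exist C = C(ε) > 0 and x₀ = x₀(ε) such that the following holds for all x ≥ x₀. Let r be an integer with (1+ε)·Log₂ x ≤ r ≤ (2−ε)·Log₂ x, set α := r/Log₂ x − 1, let y, y' ∈ 𝒴 and u ∈ 𝒰. Then ∏_{p < x}(1 + 1/p)^{-1} · ∑_{n ∈ S_{<x}, ω(n) = r, ω(n_{<y}) = Log₂ y/log 2 + u, ω(n_{<y'}) = Log₂ y'/log 2 + u} 1/n ≤ C · (2^{−u}/Log₂ x) · exp(−Q(1/log 2)·|Log₂ y − Log₂ y'|), where Q(t) := t·log t − t + 1. -/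
open Filter Topology
open scoped Classical

lemma log_factorial_eq (N : ℕ) :
    Real.log (N.factorial : ℝ) = ∑ p ∈ Nat.primesLE N, (N.factorial.factorization p : ℝ) * Real.log p := by
  rw [Real.log_nat_eq_sum_factorization, Finsupp.sum]
  apply Finset.sum_subset
  · intro p hp
    rw [Nat.support_factorization, Nat.mem_primeFactors] at hp
    rw [Nat.mem_primesLE]
    exact ⟨(hp.1.dvd_factorial).1 hp.2.1, hp.1⟩
  · intro p _ hp
    rw [Finsupp.notMem_support_iff] at hp
    simp [hp]

lemma log_fact_lower (N : ℕ) (hN : 1 ≤ N) : (N : ℝ) * Real.log N - N ≤ Real.log (N.factorial : ℝ) := by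
  have h := Stirling.le_log_factorial_stirling (n := N) (by omega)
  have hl : 0 ≤ Real.log N := Real.log_natCast_nonneg N
  have : 0 ≤ Real.log (2 * Real.pi) := Real.log_nonneg (by linarith [Real.pi_gt_three])
  linarith

lemma log_fact_upper (N : ℕ) (_hN : 1 ≤ N) : Real.log (N.factorial : ℝ) ≤ (N : ℝ) * Real.log N := by
  rw [← Real.log_pow]
  apply Real.log_le_log (by positivity)
  exact_mod_cast Nat.factorial_le_pow N

lemma logsum_bdd : ∃ C : ℝ, ∀ N : ℕ, ∑ p ∈ Nat.primesLE N, Real.log p / (p * (p - 1)) ≤ C := by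
  have hs : Summable (fun n : ℕ => 4 * ((n : ℝ) ^ (3/2 : ℝ))⁻¹) :=
    (Real.summable_nat_rpow_inv.2 (by norm_num)).mul_left 4
  refine ⟨∑' n : ℕ, 4 * ((n : ℝ) ^ (3/2 : ℝ))⁻¹, fun N => ?_⟩
  refine le_trans (Finset.sum_le_sum fun p hp => ?_) (hs.sum_le_tsum (Nat.primesLE N) (fun i _ => by positivity))
  have h2 : (2 : ℝ) ≤ p := by exact_mod_cast (Nat.mem_primesLE.1 hp).2.two_le
  have hp0 : (0 : ℝ) < p := by linarith
  have h3 : Real.log p ≤ 2 * (p : ℝ) ^ (1/2 : ℝ) := by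
    have := Real.log_le_rpow_div (x := p) (ε := 1/2) hp0.le (by norm_num)
    linarith
  have h4 : (p : ℝ) ^ (3/2 : ℝ) * (p : ℝ) ^ (1/2 : ℝ) = p ^ 2 := by
    rw [← Real.rpow_add hp0]; norm_num
  rw [← div_eq_mul_inv, div_le_div_iff₀ (by nlinarith) (by positivity)]
  have h5 : Real.log p * (p : ℝ) ^ (3/2 : ℝ) ≤ 2 * p ^ 2 := by
    rw [← h4]
    have : (0 : ℝ) ≤ (p : ℝ) ^ (3/2 : ℝ) := by positivity
    nlinarith
  nlinarith

lemma mertens1 : ∃ C : ℝ, 0 < C ∧ ∀ N : ℕ, 1 ≤ N →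
    |∑ p ∈ Nat.primesLE N, Real.log p / p - Real.log N| ≤ C := by
  obtain ⟨C, hC⟩ := logsum_bdd
  refine ⟨|C| + 2, by positivity, fun N hN => ?_⟩
  have hN0 : (0 : ℝ) < N := by exact_mod_cast hN
  have hlog4 : Real.log 4 < 2 := by
    have : Real.log 4 = 2 * Real.log 2 := by
      rw [show (4 : ℝ) = 2 ^ 2 by norm_num, Real.log_pow]; norm_num
    linarith [Real.log_two_lt_d9]
  rw [abs_le]
  constructor
  · have h1 : Real.log (N.factorial : ℝ) ≤ ∑ p ∈ Nat.primesLE N, (N * (Real.log p / p) + N * (Real.log p / (p * (p - 1)))) := by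
      rw [log_factorial_eq]
      refine Finset.sum_le_sum fun p hp => ?_
      have hpp := (Nat.mem_primesLE.1 hp).2
      have h2 : (2 : ℝ) ≤ p := by exact_mod_cast hpp.two_le
      have hl : 0 ≤ Real.log p := Real.log_natCast_nonneg p
      have hv : ((p : ℝ) - 1) * (N.factorial.factorization p : ℝ) ≤ N := by
        have := Nat.sub_one_mul_factorization_factorial (n := N) hpp
        have h3 : (p - 1) * N.factorial.factorization p ≤ N := by rw [this]; exact Nat.sub_le _ _
        have h4 : (((p - 1) * N.factorial.factorization p : ℕ) : ℝ) ≤ N := by exact_mod_cast h3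
        rw [Nat.cast_mul, Nat.cast_sub hpp.one_le] at h4
        simpa using h4
      have e : N * (Real.log p / p) + N * (Real.log p / (p * (p - 1))) = (N / ((p:ℝ) - 1)) * Real.log p := by
        have : (p : ℝ) - 1 ≠ 0 := by linarith
        field_simp
        ring
      rw [e]
      apply mul_le_mul_of_nonneg_right _ hl
      rw [le_div_iff₀ (by linarith)]
      linarith
    rw [Finset.sum_add_distrib, ← Finset.mul_sum, ← Finset.mul_sum] at h1
    have h2 := log_fact_lower N hN
    have h3 := hC N
    have h4 := le_abs_self C
    have : (N : ℝ) * (Real.log N - 1) ≤ N * (∑ p ∈ Nat.primesLE N, Real.log p / p + ∑ p ∈ Nat.primesLE N, Real.log p / (p * (p - 1))) := by linarith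
    have := le_of_mul_le_mul_left this hN0
    linarith
  · have h1 : ∑ p ∈ Nat.primesLE N, (N * (Real.log p / p) - Real.log p) ≤ Real.log (N.factorial : ℝ) := by
      rw [log_factorial_eq]
      refine Finset.sum_le_sum fun p hp => ?_
      have hpp := (Nat.mem_primesLE.1 hp).2
      have h2 : (2 : ℝ) ≤ p := by exact_mod_cast hpp.two_le
      have hl : 0 ≤ Real.log p := Real.log_natCast_nonneg p
      have hv : N / p ≤ N.factorial.factorization p := by
        rw [Nat.factorization_factorial hpp (b := Nat.log p N + 2) (by omega)]
        calc N / p = N / p ^ 1 := by simp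
          _ ≤ _ := Finset.single_le_sum (f := fun i => N / p ^ i) (fun _ _ => Nat.zero_le _) (by simp)
      have hv2 : (N : ℝ) / p - 1 ≤ (N.factorial.factorization p : ℝ) := by
        have h5 : ((N / p : ℕ) : ℝ) ≤ N.factorial.factorization p := by exact_mod_cast hv
        have h6 : (N : ℝ) / p < ((N / p : ℕ) : ℝ) + 1 := by
          rw [← Nat.floor_div_eq_div (K := ℝ)]
          exact Nat.lt_floor_add_one _
        linarith
      have e : N * (Real.log p / p) - Real.log p = ((N : ℝ) / p - 1) * Real.log p := by ring
      rw [e]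
      exact mul_le_mul_of_nonneg_right hv2 hl
    rw [Finset.sum_sub_distrib, ← Finset.mul_sum, ← Chebyshev.theta_eq_sum_primesLE_log] at h1
    have h2 := log_fact_upper N hN
    have h3 := Chebyshev.theta_le_log4_mul_x (x := N) hN0.le
    have : (N : ℝ) * (∑ p ∈ Nat.primesLE N, Real.log p / p) ≤ N * (Real.log N + 2) := by nlinarith
    have := le_of_mul_le_mul_left this hN0
    have := abs_nonneg C
    linarith

noncomputable def recipSum (N : ℕ) : ℝ := ∑ p ∈ Nat.primesLE N, (1 : ℝ) / p
noncomputable def logpSum (N : ℕ) : ℝ := ∑ p ∈ Nat.primesLE N, Real.log p / p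

lemma recip_step (N : ℕ) (hN : 2 ≤ N) :
    recipSum (N + 1) - recipSum N = (logpSum (N + 1) - logpSum N) / Real.log ((N + 1 : ℕ) : ℝ) := by
  have hl : 0 < Real.log ((N + 1 : ℕ) : ℝ) := Real.log_pos (by exact_mod_cast (by omega : 1 < N + 1))
  unfold recipSum logpSum
  rw [Nat.primesLE_eq_filter_range, Nat.primesLE_eq_filter_range, Finset.range_add_one (n := N + 1), Finset.filter_insert]
  split_ifs with h
  · rw [Finset.sum_insert (by simp), Finset.sum_insert (by simp)]
    field_simp
    ring
  · simp

lemma mertens2 : ∃ C : ℝ, 0 < C ∧ ∀ N : ℕ, 2 ≤ N →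
    |recipSum N - Real.log (Real.log N)| ≤ C := by
  obtain ⟨c, hc, hM⟩ := mertens1
  have hM' : ∀ N : ℕ, 2 ≤ N → |logpSum N - Real.log N| ≤ c := fun N hN => hM N (by omega)
  set f : ℕ → ℝ := fun N => 1 / Real.log N with hf
  set T : ℕ → ℝ := fun N => recipSum N - logpSum N * f N with hT
  have hlpos : ∀ N : ℕ, 2 ≤ N → 0 < Real.log N := fun N hN =>
    Real.log_pos (by exact_mod_cast (by omega : 1 < N))
  have step : ∀ N : ℕ, 2 ≤ N → T (N+1) - T N = logpSum N * (f N - f (N+1)) := by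
    intro N hN
    have := recip_step N hN
    simp only [hT, hf]
    rw [show recipSum (N+1) = recipSum N + (logpSum (N + 1) - logpSum N) / Real.log ((N + 1 : ℕ) : ℝ) by linarith]
    ring
  have key : ∀ N : ℕ, 2 ≤ N →
      |(T (N+1) - Real.log (Real.log ((N+1 : ℕ) : ℝ))) - (T N - Real.log (Real.log N))| ≤ (c + 1) * (f N - f (N+1)) := by
    intro N hN
    have ha := hlpos N hN
    have hb := hlpos (N+1) (by omega)
    have hN0 : (0 : ℝ) < N := by exact_mod_cast (by omega : 0 < N)
    have hab : Real.log N ≤ Real.log ((N+1 : ℕ) : ℝ) := Real.log_le_log hN0 (by exact_mod_cast Nat.le_succ N)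
    have hba : Real.log ((N+1 : ℕ) : ℝ) ≤ Real.log N + 1 := by
      have h1 : Real.log ((N+1 : ℕ) : ℝ) ≤ Real.log (N * Real.exp 1) := by
        apply Real.log_le_log (by positivity)
        have : (2:ℝ) ≤ Real.exp 1 := by linarith [Real.add_one_le_exp (1:ℝ)]
        have : (1:ℝ) ≤ N := by exact_mod_cast (by omega : 1 ≤ N)
        push_cast
        nlinarith
      rwa [Real.log_mul hN0.ne' (Real.exp_pos 1).ne', Real.log_exp] at h1
    have hE := abs_le.1 (hM' N hN)
    have hs := step N hN
    have hfd : f N - f (N+1) = (Real.log ((N+1 : ℕ) : ℝ) - Real.log N) / (Real.log N * Real.log ((N+1 : ℕ) : ℝ)) := by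
      simp only [hf]; field_simp
    have hfd0 : 0 ≤ f N - f (N+1) := by
      rw [hfd]; exact div_nonneg (by linarith) (by positivity)
    set a := Real.log N
    set b := Real.log ((N+1 : ℕ) : ℝ)
    have hr1 : Real.log b - Real.log a ≤ b / a - 1 := by
      rw [← Real.log_div hb.ne' ha.ne']
      exact Real.log_le_sub_one_of_pos (by positivity)
    have hr2 : Real.log a - Real.log b ≤ a / b - 1 := by
      rw [← Real.log_div ha.ne' hb.ne']
      exact Real.log_le_sub_one_of_pos (by positivity)
    have e1 : a * (f N - f (N+1)) = 1 - a / b := by rw [hfd]; field_simp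
    have e2 : b / a - 1 ≤ 1 - a / b + (f N - f (N+1)) := by
      have : b / a - 1 - (1 - a / b) = (b - a) * (f N - f (N+1)) := by rw [hfd]; field_simp
      nlinarith
    have e3 : (logpSum N - a) * (f N - f (N+1)) ≤ c * (f N - f (N+1)) := mul_le_mul_of_nonneg_right hE.2 hfd0
    have e4 : (-c) * (f N - f (N+1)) ≤ (logpSum N - a) * (f N - f (N+1)) := mul_le_mul_of_nonneg_right hE.1 hfd0
    rw [abs_le]
    constructor <;> nlinarith
  have ind : ∀ N : ℕ, 2 ≤ N →
      |(T N - Real.log (Real.log N)) - (T 2 - Real.log (Real.log (2 : ℕ)))| ≤ (c + 1) * (f 2 - f N) := by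
    intro N hN
    induction N, hN using Nat.le_induction with
    | base => simp
    | succ n hn ih =>
      have := key n hn
      rw [abs_le] at *
      constructor <;> linarith [ih.1, ih.2, this.1, this.2]
  refine ⟨|T 2 - Real.log (Real.log (2 : ℕ))| + (c + 1) * f 2 + 1 + c * f 2, ?_, fun N hN => ?_⟩
  · have : 0 < f 2 := by simp only [hf]; exact one_div_pos.2 (hlpos 2 le_rfl)
    positivity
  · have h1 := abs_le.1 (ind N hN)
    have h2 := abs_le.1 (hM' N hN)
    have hfN : 0 < f N := one_div_pos.2 (hlpos N hN)
    have hfN2 : f N ≤ f 2 := by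
      apply one_div_le_one_div_of_le (hlpos 2 le_rfl)
      exact Real.log_le_log (by norm_num) (by exact_mod_cast hN)
    have h3 : Real.log N * f N = 1 := by simp only [hf]; field_simp [(hlpos N hN).ne']
    have h5 : (logpSum N - Real.log N) * f N ≤ c * f N := mul_le_mul_of_nonneg_right h2.2 hfN.le
    have h6 : (-c) * f N ≤ (logpSum N - Real.log N) * f N := mul_le_mul_of_nonneg_right h2.1 hfN.le
    have h7 : recipSum N = T N + (logpSum N - Real.log N) * f N + 1 := by
      simp only [hT]; linarith
    have h8 := abs_le.1 (le_refl |T 2 - Real.log (Real.log (2 : ℕ))|)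
    have h9 : c * f N ≤ c * f 2 := mul_le_mul_of_nonneg_left hfN2 hc.le
    have h10 : (c+1) * f N ≥ 0 := by positivity
    rw [h7, abs_le]
    constructor <;> nlinarith [h8.1, h8.2, h1.1, h1.2]

noncomputable def pset (y z : ℝ) : Finset ℕ :=
  (Finset.range ⌈z⌉₊).filter (fun p => p.Prime ∧ y ≤ (p : ℝ))

lemma mem_pset {y z : ℝ} {p : ℕ} : p ∈ pset y z ↔ p.Prime ∧ y ≤ (p : ℝ) ∧ (p : ℝ) < z := by
  simp only [pset, Finset.mem_filter, Finset.mem_range, Nat.lt_ceil]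
  tauto

noncomputable def psum (y z : ℝ) : ℝ := ∑ p ∈ pset y z, (p : ℝ)⁻¹

lemma psum_nonneg (y z : ℝ) : 0 ≤ psum y z := Finset.sum_nonneg fun p _ => by positivity


lemma LLog2_mono {x y : ℝ} (hx : 0 < x) (h : x ≤ y) : LLog2 x ≤ LLog2 y := by
  have h1 : LLog x ≤ LLog y := max_le_max le_rfl (Real.log_le_log hx h)
  have h0 : 0 < LLog x := lt_of_lt_of_le one_pos (le_max_left _ _)
  exact max_le_max le_rfl (Real.log_le_log h0 h1)

lemma esymm_le (s : Finset ℕ) (f : ℕ → ℝ) (hf : ∀ i, 0 ≤ f i) (k : ℕ) :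
    ∑ T ∈ s.powersetCard k, ∏ p ∈ T, f p ≤ (∑ p ∈ s, f p) ^ k / k.factorial := by
  induction s using Finset.induction_on generalizing k with
  | empty =>
    rcases k with _ | k
    · simp
    · rw [Finset.powersetCard_eq_empty.2 (by simp)]; simp
  | insert a s ha ih =>
    rcases k with _ | k
    · simp
    · rw [Finset.powersetCard_succ_insert ha, Finset.sum_union, Finset.sum_image, Finset.sum_insert ha]
      · have e : ∑ T ∈ s.powersetCard k, ∏ p ∈ insert a T, f p = f a * ∑ T ∈ s.powersetCard k, ∏ p ∈ T, f p := by
          rw [Finset.mul_sum]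
          refine Finset.sum_congr rfl fun T hT => ?_
          rw [Finset.prod_insert]
          intro h
          exact ha ((Finset.mem_powersetCard.1 hT).1 h)
        rw [e]
        have h1 := ih (k+1)
        have h2 := mul_le_mul_of_nonneg_left (ih k) (hf a)
        set S := ∑ p ∈ s, f p
        have hS : 0 ≤ S := Finset.sum_nonneg fun i _ => hf i
        have h3 : S ^ (k+1) + (k+1) * f a * S ^ k ≤ (f a + S) ^ (k+1) := by
          have hfa := hf a
          clear h1 h2 e ih
          induction k with
          | zero => simp; linarith
          | succ m ihm =>
            have h4 := mul_le_mul_of_nonneg_right ihm (add_nonneg hfa hS)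
            rw [pow_succ (f a + S) (m+1)]
            refine le_trans ?_ h4
            have : 0 ≤ (m+1) * f a * S^m * f a := by positivity
            push_cast
            ring_nf at this ⊢
            linarith
        have hk : (0:ℝ) < (k+1).factorial := by positivity
        calc _ ≤ S ^ (k+1) / ((k+1).factorial : ℝ) + f a * (S ^ k / (k.factorial : ℝ)) := add_le_add h1 h2
          _ = (S ^ (k+1) + (k+1) * f a * S ^ k) / ((k+1).factorial : ℝ) := by
            rw [Nat.factorial_succ]; push_cast; field_simp
          _ ≤ _ := by gcongr
      · intro T hT T' hT' h
        have hT1 : a ∉ T := fun h' => ha ((Finset.mem_powersetCard.1 hT).1 h')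
        have hT2 : a ∉ T' := fun h' => ha ((Finset.mem_powersetCard.1 hT').1 h')
        rw [← Finset.erase_insert hT1, ← Finset.erase_insert hT2, h]
      · rw [Finset.disjoint_left]
        intro T hT hT'
        obtain ⟨T', _, rfl⟩ := Finset.mem_image.1 hT'
        exact ha ((Finset.mem_powersetCard.1 hT).1 (Finset.mem_insert_self a T'))

lemma omegaN_nsmall (n : ℕ) (y : ℝ) :
    omegaN (nsmall n y) = (n.primeFactors.filter (fun p : ℕ => (p : ℝ) < y)).card := by
  unfold omegaN nsmall
  rw [Nat.primeFactors_prod]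
  intro p hp
  exact Nat.prime_of_mem_primeFactors (Finset.mem_filter.1 hp).1

lemma omega_mono (n : ℕ) {y y' : ℝ} (h : y ≤ y') :
    omegaN (nsmall n y) ≤ omegaN (nsmall n y') ∧ omegaN (nsmall n y') ≤ omegaN n := by
  rw [omegaN_nsmall, omegaN_nsmall]
  constructor
  · apply Finset.card_le_card
    intro p hp
    rw [Finset.mem_filter] at *
    exact ⟨hp.1, lt_of_lt_of_le hp.2 h⟩
  · exact Finset.card_le_card (Finset.filter_subset _ _)

lemma sum_bound (x y y' : ℝ) (h : y ≤ y') (r k k' : ℕ) (S : Set ℕ)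
    (hS : ∀ n ∈ S, n ∈ Sset 1 x ∧ omegaN n = r ∧ omegaN (nsmall n y) = k ∧ omegaN (nsmall n y') = k') :
    ∑ᶠ n ∈ S, ((n : ℝ))⁻¹ ≤ (psum 1 y ^ k / k.factorial) * (psum y y' ^ (k' - k) / (k' - k).factorial) *
      (psum y' x ^ (r - k') / (r - k').factorial) := by
  set tgt := ((pset 1 y).powersetCard k ×ˢ (pset y y').powersetCard (k' - k)) ×ˢ (pset y' x).powersetCard (r - k') with htgt
  set φ : ℕ → (Finset ℕ × Finset ℕ) × Finset ℕ := fun n =>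
    ((n.primeFactors.filter (fun p : ℕ => (p : ℝ) < y), n.primeFactors.filter (fun p : ℕ => y ≤ (p : ℝ) ∧ (p : ℝ) < y')),
      n.primeFactors.filter (fun p : ℕ => y' ≤ (p : ℝ))) with hφ
  set g : (Finset ℕ × Finset ℕ) × Finset ℕ → ℝ := fun T =>
    (∏ p ∈ T.1.1, (p : ℝ)⁻¹) * (∏ p ∈ T.1.2, (p : ℝ)⁻¹) * (∏ p ∈ T.2, (p : ℝ)⁻¹) with hg
  have hunion : ∀ n : ℕ, n.primeFactors = ((φ n).1.1 ∪ (φ n).1.2) ∪ (φ n).2 := by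
    intro n
    ext p
    simp only [hφ, Finset.mem_union, Finset.mem_filter]
    constructor
    · intro hp
      rcases lt_or_ge (p : ℝ) y with h1 | h1
      · exact Or.inl (Or.inl ⟨hp, h1⟩)
      · rcases lt_or_ge (p : ℝ) y' with h2 | h2
        · exact Or.inl (Or.inr ⟨hp, h1, h2⟩)
        · exact Or.inr ⟨hp, h2⟩
    · tauto
  have hd1 : ∀ n : ℕ, Disjoint (φ n).1.1 (φ n).1.2 := by
    intro n
    rw [Finset.disjoint_left]
    intro p hp hp'
    simp only [hφ, Finset.mem_filter] at hp hp'
    linarith [hp.2, hp'.2.1]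
  have hd2 : ∀ n : ℕ, Disjoint ((φ n).1.1 ∪ (φ n).1.2) (φ n).2 := by
    intro n
    rw [Finset.disjoint_left]
    intro p hp hp'
    simp only [hφ, Finset.mem_filter, Finset.mem_union] at hp hp'
    rcases hp with hp | hp
    · linarith [hp.2, hp'.2]
    · linarith [hp.2.2, hp'.2]
  have hinj : Set.InjOn φ S := by
    intro n hn m hm hnm
    have h1 : n.primeFactors = m.primeFactors := by rw [hunion n, hunion m, hnm]
    rw [← Nat.prod_primeFactors_of_squarefree (hS n hn).1.2.1, ← Nat.prod_primeFactors_of_squarefree (hS m hm).1.2.1, h1]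
  have hmap : ∀ n ∈ S, φ n ∈ tgt := by
    intro n hn
    obtain ⟨hx, hr, hk, hk'⟩ := hS n hn
    have c1 : (φ n).1.1.card = k := by rw [← hk, omegaN_nsmall]
    have c2 : (φ n).1.1.card + (φ n).1.2.card = k' := by
      rw [← hk', omegaN_nsmall, ← Finset.card_union_of_disjoint (hd1 n)]
      congr 1
      ext p
      simp only [hφ, Finset.mem_union, Finset.mem_filter]
      constructor
      · rintro (⟨h1, h2⟩ | ⟨h1, h2, h3⟩)
        · exact ⟨h1, lt_of_lt_of_le h2 h⟩
        · exact ⟨h1, h3⟩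
      · rintro ⟨h1, h2⟩
        rcases lt_or_ge (p : ℝ) y with h3 | h3
        · exact Or.inl ⟨h1, h3⟩
        · exact Or.inr ⟨h1, h3, h2⟩
    have c3 : k' + (φ n).2.card = r := by
      rw [← hr, ← c2, ← Finset.card_union_of_disjoint (hd1 n), ← Finset.card_union_of_disjoint (hd2 n), ← hunion n]
      rfl
    rw [htgt, Finset.mem_product, Finset.mem_product, Finset.mem_powersetCard, Finset.mem_powersetCard, Finset.mem_powersetCard]
    refine ⟨⟨⟨?_, c1⟩, ?_, by omega⟩, ?_, by omega⟩
    · intro p hp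
      simp only [hφ, Finset.mem_filter] at hp
      exact mem_pset.2 ⟨Nat.prime_of_mem_primeFactors hp.1, (hx.2.2 p hp.1).1, hp.2⟩
    · intro p hp
      simp only [hφ, Finset.mem_filter] at hp
      exact mem_pset.2 ⟨Nat.prime_of_mem_primeFactors hp.1, hp.2⟩
    · intro p hp
      simp only [hφ, Finset.mem_filter] at hp
      exact mem_pset.2 ⟨Nat.prime_of_mem_primeFactors hp.1, hp.2, (hx.2.2 p hp.1).2⟩
  have hfin : S.Finite := Set.Finite.of_injOn (t := (tgt : Set _)) (fun n hn => hmap n hn) hinj tgt.finite_toSet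
  have hval : ∀ n ∈ S, (n : ℝ)⁻¹ = g (φ n) := by
    intro n hn
    simp only [hg]
    rw [← Finset.prod_union (hd1 n), ← Finset.prod_union (hd2 n), ← hunion n, Finset.prod_inv_distrib]
    congr 1
    rw [← Nat.cast_prod, Nat.prod_primeFactors_of_squarefree (hS n hn).1.2.1]
  have hg0 : ∀ T, 0 ≤ g T := fun T => by
    simp only [hg]
    have : ∀ s : Finset ℕ, 0 ≤ ∏ p ∈ s, (p : ℝ)⁻¹ := fun s => Finset.prod_nonneg fun p _ => by positivity
    exact mul_nonneg (mul_nonneg (this _) (this _)) (this _)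
  rw [finsum_mem_eq_finite_toFinset_sum _ hfin]
  calc ∑ n ∈ hfin.toFinset, (n : ℝ)⁻¹ = ∑ n ∈ hfin.toFinset, g (φ n) :=
        Finset.sum_congr rfl fun n hn => hval n (hfin.mem_toFinset.1 hn)
    _ = ∑ T ∈ hfin.toFinset.image φ, g T := by
        rw [Finset.sum_image]
        intro n hn m hm
        exact hinj (by simpa using hn) (by simpa using hm)
    _ ≤ ∑ T ∈ tgt, g T := by
        apply Finset.sum_le_sum_of_subset_of_nonneg
        · intro T hT
          obtain ⟨n, hn, rfl⟩ := Finset.mem_image.1 hT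
          exact hmap n (hfin.mem_toFinset.1 hn)
        · intro T _ _
          exact hg0 T
    _ = (∑ T ∈ (pset 1 y).powersetCard k, ∏ p ∈ T, (p : ℝ)⁻¹) * (∑ T ∈ (pset y y').powersetCard (k' - k), ∏ p ∈ T, (p : ℝ)⁻¹) *
        (∑ T ∈ (pset y' x).powersetCard (r - k'), ∏ p ∈ T, (p : ℝ)⁻¹) := by
        rw [htgt, Finset.sum_product, Finset.sum_product, Finset.sum_mul_sum, Finset.sum_mul]
        refine Finset.sum_congr rfl fun T1 _ => ?_
        rw [Finset.sum_mul]
        refine Finset.sum_congr rfl fun T2 _ => ?_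
        rw [Finset.mul_sum]
    _ ≤ _ := by
        have hp : ∀ (s : Finset ℕ) (k : ℕ), 0 ≤ ∑ T ∈ s.powersetCard k, ∏ p ∈ T, (p : ℝ)⁻¹ := fun s k =>
          Finset.sum_nonneg fun T _ => Finset.prod_nonneg fun p _ => by positivity
        have e := fun (s : Finset ℕ) (k : ℕ) => esymm_le s (fun p => (p : ℝ)⁻¹) (fun i => by positivity) k
        have q := fun (y z : ℝ) (k : ℕ) => div_nonneg (pow_nonneg (psum_nonneg y z) k) (Nat.cast_nonneg (α := ℝ) k.factorial)
        exact mul_le_mul (mul_le_mul (e _ _) (e _ _) (hp _ _) (q _ _ _)) (e _ _) (hp _ _) (mul_nonneg (q _ _ _) (q _ _ _))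

lemma LLog2_of_large {z : ℝ} (hz : 3 ≤ z) : 1 ≤ Real.log z ∧ Real.log (Real.log z) ≤ LLog2 z ∧
    LLog2 z ≤ Real.log (Real.log z) + 1 := by
  have h1 : 1 ≤ Real.log z := by
    rw [Real.le_log_iff_exp_le (by linarith)]
    linarith [Real.exp_one_lt_d9]
  have h2 : LLog z = Real.log z := max_eq_right h1
  have h3 : 0 ≤ Real.log (Real.log z) := Real.log_nonneg h1
  refine ⟨h1, ?_, ?_⟩
  · unfold LLog2; rw [h2]; exact le_max_right _ _
  · unfold LLog2; rw [h2]; exact max_le (by linarith) (by linarith)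

lemma LLog2_of_small {z : ℝ} (hz : z < 3) (h0 : 0 < z) : LLog2 z = 1 := by
  have h1 : Real.log z ≤ 2 := by
    have := Real.log_le_sub_one_of_pos h0
    linarith
  have h2 : LLog z ≤ 2 := max_le (by norm_num) h1
  have h3 : 0 < LLog z := lt_of_lt_of_le one_pos (le_max_left _ _)
  unfold LLog2
  apply max_eq_left
  have := Real.log_le_sub_one_of_pos h3
  linarith

lemma pset_one (z : ℝ) : pset 1 z = Nat.primesBelow ⌈z⌉₊ := by
  ext p
  rw [mem_pset, Nat.mem_primesBelow, Nat.lt_ceil]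
  constructor
  · rintro ⟨h1, h2, h3⟩; exact ⟨h3, h1⟩
  · rintro ⟨h1, h2⟩; exact ⟨h2, by exact_mod_cast h2.one_le, h1⟩

lemma mertens_real : ∃ C : ℝ, 0 < C ∧ ∀ z : ℝ, 0 < z → |psum 1 z - LLog2 z| ≤ C := by
  obtain ⟨c, hc, hM⟩ := mertens2
  refine ⟨c + 3, by linarith, fun z hz0 => ?_⟩
  rcases lt_or_ge z 3 with hz | hz
  · rw [LLog2_of_small hz hz0]
    have h1 : psum 1 z ≤ 1 := by
      unfold psum
      have hsub : pset 1 z ⊆ {2} := by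
        intro p hp
        rw [mem_pset] at hp
        have h3 : p < 3 := by exact_mod_cast (lt_trans hp.2.2 hz)
        have := hp.1.two_le
        rw [Finset.mem_singleton]; omega
      refine le_trans (Finset.sum_le_sum_of_subset_of_nonneg hsub fun i _ _ => by positivity) ?_
      norm_num
    have h2 := psum_nonneg 1 z
    rw [abs_le]; constructor <;> linarith
  · obtain ⟨h1, h2, h3⟩ := LLog2_of_large hz
    set N := ⌈z⌉₊ - 1 with hN
    have hce : 3 ≤ ⌈z⌉₊ := by
      have : (3 : ℝ) ≤ ⌈z⌉₊ := le_trans hz (Nat.le_ceil z)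
      exact_mod_cast this
    have hN2 : 2 ≤ N := by omega
    have hNz : (N : ℝ) < z := by rw [← Nat.lt_ceil]; omega
    have hzN : z ≤ N + 1 := by
      have := Nat.le_ceil z
      have h4 : ⌈z⌉₊ = N + 1 := by omega
      rw [h4] at this; exact_mod_cast this
    have hp : psum 1 z = recipSum N := by
      unfold psum recipSum
      rw [pset_one, Nat.primesBelow_eq_primesLE_sub_one]
      simp [hN]
    have h4 := abs_le.1 (hM N hN2)
    have hN2r : (2 : ℝ) ≤ N := by exact_mod_cast hN2
    have hl2 : Real.log 2 ≤ Real.log N := Real.log_le_log (by norm_num) hN2r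
    have hl2' := Real.log_two_gt_d9
    have hlN : Real.log N ≤ Real.log z := Real.log_le_log (by linarith) hNz.le
    have hll : Real.log (Real.log N) ≤ Real.log (Real.log z) := Real.log_le_log (by linarith) hlN
    have hup : Real.log z ≤ Real.log N + Real.log 2 := by
      rw [← Real.log_mul (by linarith) (by norm_num)]
      exact Real.log_le_log (by linarith) (by linarith)
    have hll2 : Real.log (Real.log z) ≤ Real.log (Real.log N) + Real.log 2 := by
      rw [← Real.log_mul (by linarith) (by norm_num)]
      exact Real.log_le_log (by linarith) (by linarith)
    have := Real.log_two_lt_d9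
    rw [hp, abs_le]
    constructor <;> linarith

lemma psum_split {y z : ℝ} (hy : y ≤ z) : psum 1 z = psum 1 y + psum (max 1 y) z := by
  unfold psum
  rw [← Finset.sum_union]
  · congr 1
    ext p
    simp only [Finset.mem_union, mem_pset]
    constructor
    · rintro ⟨h1, h2, h3⟩
      rcases lt_or_ge (p : ℝ) y with h | h
      · exact Or.inl ⟨h1, h2, h⟩
      · exact Or.inr ⟨h1, max_le h2 h, h3⟩
    · rintro (⟨h1, h2, h3⟩ | ⟨h1, h2, h3⟩)
      · exact ⟨h1, h2, lt_of_lt_of_le h3 hy⟩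
      · exact ⟨h1, le_trans (le_max_left _ _) h2, h3⟩
  · rw [Finset.disjoint_left]
    intro p hp hp'
    rw [mem_pset] at hp hp'
    linarith [hp.2.2, le_max_right 1 y, hp'.2.1]

lemma psum_max (y z : ℝ) : psum (max 1 y) z = psum y z := by
  unfold psum
  congr 1
  ext p
  rw [mem_pset, mem_pset]
  constructor
  · rintro ⟨h1, h2, h3⟩
    exact ⟨h1, le_trans (le_max_right _ _) h2, h3⟩
  · rintro ⟨h1, h2, h3⟩
    exact ⟨h1, max_le (by exact_mod_cast h1.one_le) h2, h3⟩

lemma psum_bounds : ∃ c : ℝ, 0 < c ∧ (∀ z : ℝ, 0 < z → psum 1 z ≤ LLog2 z + c) ∧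
    (∀ z : ℝ, 0 < z → LLog2 z - c ≤ psum 1 z) ∧
    ∀ y z : ℝ, 0 < y → y ≤ z → psum y z ≤ LLog2 z - LLog2 y + c := by
  obtain ⟨C, hC, h⟩ := mertens_real
  refine ⟨2 * C, by linarith, fun z hz => ?_, fun z hz => ?_, fun y z hy hyz => ?_⟩
  · linarith [(abs_le.1 (h z hz)).2]
  · linarith [(abs_le.1 (h z hz)).1]
  · have h1 := psum_split hyz
    rw [psum_max] at h1
    linarith [(abs_le.1 (h z (by linarith))).2, (abs_le.1 (h y hy)).1]

lemma primeProd_bound : ∃ C : ℝ, 0 < C ∧ ∀ x : ℝ, 0 < x → 0 ≤ primeProd 1 x ∧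
    primeProd 1 x ≤ C * Real.exp (-LLog2 x) := by
  obtain ⟨c, hc, _, hlow, _⟩ := psum_bounds
  have hs : Summable (fun n : ℕ => ((n : ℝ) ^ 2)⁻¹) := Real.summable_nat_pow_inv.2 (by norm_num)
  set K := ∑' n : ℕ, ((n : ℝ) ^ 2)⁻¹ with hK
  refine ⟨Real.exp (K + c), Real.exp_pos _, fun x hx => ?_⟩
  have e : primeProd 1 x = ∏ p ∈ pset 1 x, ((1 : ℝ) + 1 / p)⁻¹ := by
    unfold primeProd
    rw [← finprod_mem_coe_finset]
    have : {p : ℕ | p.Prime ∧ (1:ℝ) ≤ (p : ℝ) ∧ (p : ℝ) < x} = ↑(pset 1 x) := by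
      ext p
      rw [Finset.mem_coe, mem_pset]; rfl
    rw [this]
  rw [e]
  refine ⟨Finset.prod_nonneg fun p _ => by positivity, ?_⟩
  calc ∏ p ∈ pset 1 x, ((1 : ℝ) + 1 / p)⁻¹ ≤ ∏ p ∈ pset 1 x, Real.exp (-(p : ℝ)⁻¹ + ((p : ℝ)^2)⁻¹) := by
        refine Finset.prod_le_prod (fun p _ => by positivity) fun p hp => ?_
        have hp1 : (0 : ℝ) < p := by exact_mod_cast (mem_pset.1 hp).1.pos
        have h1 := Real.add_one_le_exp (-(p : ℝ)⁻¹ + ((p : ℝ)^2)⁻¹)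
        refine le_trans ?_ h1
        rw [inv_le_iff_one_le_mul₀ (by positivity)]
        have : (-(p : ℝ)⁻¹ + ((p : ℝ)^2)⁻¹ + 1) * (1 + 1 / p) = 1 + ((p : ℝ)^3)⁻¹ := by
          field_simp; ring
        rw [this]
        have : 0 < ((p : ℝ)^3)⁻¹ := by positivity
        linarith
    _ = Real.exp (-psum 1 x + ∑ p ∈ pset 1 x, ((p : ℝ)^2)⁻¹) := by
        rw [← Real.exp_sum, Finset.sum_add_distrib, Finset.sum_neg_distrib]; rfl
    _ ≤ Real.exp ((K + c) + -LLog2 x) := by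
        apply Real.exp_le_exp.2
        have h1 := hs.sum_le_tsum (pset 1 x) (fun i _ => by positivity)
        have h2 := hlow x hx
        linarith
    _ = _ := Real.exp_add _ _

lemma pow_shift {B c : ℝ} (hB : 0 < B) (hc : 0 ≤ c) (l : ℕ) :
    (B + c) ^ l ≤ Real.exp (c * (l / B)) * B ^ l := by
  have h1 : B + c ≤ Real.exp (c / B) * B := by
    have := Real.add_one_le_exp (c / B)
    calc B + c = (c / B + 1) * B := by field_simp; ring
      _ ≤ _ := by gcongr
  calc (B + c) ^ l ≤ (Real.exp (c / B) * B) ^ l := by gcongr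
    _ = _ := by rw [mul_pow, ← Real.exp_nat_mul]; congr 2; ring

lemma pow_exp {B : ℝ} (hB : 0 ≤ B) {l : ℕ} (hl : 0 < l) :
    B ^ l ≤ Real.exp B * (l / Real.exp 1) ^ l := by
  have hl' : (0 : ℝ) < l := by exact_mod_cast hl
  have h1 : B ≤ Real.exp (B / l) * (l / Real.exp 1) := by
    have := Real.add_one_le_exp (B / l - 1)
    rw [Real.exp_sub] at this
    calc B = (B / l - 1 + 1) * l := by field_simp; ring
      _ ≤ Real.exp (B / l) / Real.exp 1 * l := by gcongr
      _ = _ := by ring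
  calc B ^ l ≤ (Real.exp (B / l) * (l / Real.exp 1)) ^ l := by gcongr
    _ = _ := by rw [mul_pow, ← Real.exp_nat_mul]; congr 2; field_simp

lemma poisson_le {B : ℝ} (hB : 0 ≤ B) {l : ℕ} (hl : 0 < l) :
    B ^ l / l.factorial ≤ Real.exp B / √l := by
  have hl' : (0 : ℝ) < l := by exact_mod_cast hl
  have h1 := pow_exp hB hl
  have h2 := Stirling.le_factorial_stirling l
  have h3 : √(l : ℝ) ≤ √(2 * Real.pi * l) := Real.sqrt_le_sqrt (by nlinarith [Real.pi_gt_three])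
  have h4 : √(l : ℝ) * (l / Real.exp 1) ^ l ≤ l.factorial := le_trans (by gcongr) h2
  have h5 : 0 < √(l : ℝ) := Real.sqrt_pos.2 hl'
  rw [div_le_div_iff₀ (by positivity) h5]
  calc B ^ l * √l ≤ (Real.exp B * (l / Real.exp 1) ^ l) * √l := by gcongr
    _ = Real.exp B * (√(l : ℝ) * (l / Real.exp 1) ^ l) := by ring
    _ ≤ _ := by gcongr

lemma factor2 {D c : ℝ} (hD : 0 ≤ D) (hc : 0 ≤ c) (j : ℕ) (hj : (j : ℝ) * Real.log 2 = D) :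
    (D + c) ^ j / j.factorial ≤ Real.exp (c / Real.log 2) * (Real.exp D * Real.exp (-Qfun (1 / Real.log 2) * D)) := by
  have hl2 : 0 < Real.log 2 := Real.log_pos (by norm_num)
  rcases Nat.eq_zero_or_pos j with rfl | hj0
  · have : D = 0 := by simpa using hj.symm
    subst this
    simp only [pow_zero, Nat.factorial_zero, Nat.cast_one, div_one, Real.exp_zero, mul_zero, mul_one]
    exact Real.one_le_exp (by positivity)
  · have hj' : (0 : ℝ) < j := by exact_mod_cast hj0
    have hDpos : 0 < D := by rw [← hj]; positivity
    have h1 := pow_shift hDpos hc j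
    have e1 : (j : ℝ) / D = 1 / Real.log 2 := by rw [← hj]; field_simp
    rw [e1, mul_one_div] at h1
    have h2 : D ^ j / j.factorial ≤ Real.exp D * Real.exp (-Qfun (1 / Real.log 2) * D) := by
      have h3 : D ^ j = (Real.log 2 * Real.exp 1) ^ j * (j / Real.exp 1) ^ j := by
        rw [← mul_pow, ← hj]; congr 1
        have := Real.exp_pos 1
        field_simp
      have h4 := Stirling.le_factorial_stirling j
      have h5 : (1 : ℝ) ≤ √(2 * Real.pi * j) := by
        rw [Real.one_le_sqrt]
        have : (1 : ℝ) ≤ j := by exact_mod_cast hj0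
        nlinarith [Real.pi_gt_three]
      have h6 : ((j : ℝ) / Real.exp 1) ^ j ≤ j.factorial := by
        have : 0 ≤ ((j : ℝ) / Real.exp 1) ^ j := by positivity
        nlinarith
      have h7 : (Real.log 2 * Real.exp 1) ^ j = Real.exp D * Real.exp (-Qfun (1 / Real.log 2) * D) := by
        nth_rewrite 1 [← Real.exp_log hl2]
        rw [← Real.exp_add, ← Real.exp_nat_mul, ← Real.exp_add]
        congr 1
        unfold Qfun
        rw [one_div, Real.log_inv, ← hj]
        field_simp
        ring
      rw [← h7, h3, div_le_iff₀ (by positivity)]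
      gcongr
    calc (D + c) ^ j / j.factorial ≤ (Real.exp (c / Real.log 2) * D ^ j) / j.factorial := by gcongr
      _ = Real.exp (c / Real.log 2) * (D ^ j / j.factorial) := by ring
      _ ≤ _ := by gcongr

lemma factor3 {B c M : ℝ} (hB : 0 < B) (hc : 0 ≤ c) {l : ℕ} (hl : 0 < l) (hM : (l : ℝ) ≤ M * B) :
    (B + c) ^ l / l.factorial ≤ Real.exp (c * M) * (Real.exp B / √l) := by
  have h1 := pow_shift hB hc l
  have h2 : (l : ℝ) / B ≤ M := by rw [div_le_iff₀ hB]; exact hM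
  calc (B + c) ^ l / l.factorial ≤ (Real.exp (c * (l / B)) * B ^ l) / l.factorial := by gcongr
    _ = Real.exp (c * (l / B)) * (B ^ l / l.factorial) := by ring
    _ ≤ Real.exp (c * M) * (B ^ l / l.factorial) := by gcongr
    _ ≤ _ := mul_le_mul_of_nonneg_left (poisson_le hB.le hl) (Real.exp_pos _).le

lemma factor1 {A c M : ℝ} (hA : 0 < A) (hc : 0 ≤ c) {k : ℕ} (hk : 0 < k) (hM : (k : ℝ) ≤ M * A) (u : ℤ)
    (hku : (k : ℝ) * Real.log 2 = A + u * Real.log 2) :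
    (A + c) ^ k / k.factorial ≤ Real.exp (c * M) * ((2:ℝ) ^ (-u) * Real.exp A / √k) := by
  have h1 := pow_shift hA hc k
  have h2 : (k : ℝ) / A ≤ M := by rw [div_le_iff₀ hA]; exact hM
  have h3 : A ^ k / k.factorial ≤ (2:ℝ) ^ (-u) * Real.exp A / √k := by
    have h4 := poisson_le (B := 2 * A) (by linarith) hk
    have h5 : (2:ℝ) ^ (-u) = 2 ^ (-(k:ℤ)) * Real.exp A := by
      have hz : ∀ v : ℤ, (2:ℝ) ^ v = Real.exp (v * Real.log 2) := fun v => by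
        rw [← Real.rpow_intCast, Real.rpow_def_of_pos (by norm_num), mul_comm]
      rw [hz, hz, ← Real.exp_add]
      congr 1
      push_cast
      linarith
    have h6 : A ^ k / k.factorial = 2 ^ (-(k:ℤ)) * ((2 * A) ^ k / k.factorial) := by
      rw [mul_pow, zpow_neg, zpow_natCast]; field_simp
    rw [h5, h6]
    calc _ ≤ (2:ℝ) ^ (-(k:ℤ)) * (Real.exp (2 * A) / √k) := by gcongr
      _ = _ := by rw [two_mul, Real.exp_add]; ring
  calc (A + c) ^ k / k.factorial ≤ (Real.exp (c * (k / A)) * A ^ k) / k.factorial := by gcongr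
    _ = Real.exp (c * (k / A)) * (A ^ k / k.factorial) := by ring
    _ ≤ Real.exp (c * M) * (A ^ k / k.factorial) := by gcongr
    _ ≤ _ := by gcongr

lemma core (ε : ℝ) (hε : 0 < ε) (hε' : ε < 1/2) :
    ∃ C : ℝ, 0 < C ∧ ∃ x₀ : ℝ, ∀ x : ℝ, x₀ ≤ x → ∀ r : ℕ,
      (1 + ε) * LLog2 x ≤ r → (r : ℝ) ≤ (2 - ε) * LLog2 x →
      ∀ y ∈ Yset ((r : ℝ) / LLog2 x - 1) x, ∀ y' ∈ Yset ((r : ℝ) / LLog2 x - 1) x,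
      ∀ u ∈ Uset ((r : ℝ) / LLog2 x - 1) x, y ≤ y' →
      primeProd 1 x * ∑ᶠ n ∈ {n | n ∈ Sset 1 x ∧ omegaN n = r ∧
            (omegaN (nsmall n y) : ℝ) = LLog2 y / Real.log 2 + u ∧
            (omegaN (nsmall n y') : ℝ) = LLog2 y' / Real.log 2 + u}, ((n : ℝ))⁻¹
        ≤ C * ((2:ℝ) ^ (-u) / LLog2 x) *
            Real.exp (-Qfun (1 / Real.log 2) * |LLog2 y - LLog2 y'|) := by
  obtain ⟨c, hc, hP1, _, hP2⟩ := psum_bounds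
  obtain ⟨K, hK, hprod⟩ := primeProd_bound
  set W := Real.exp (c * (4 / ε)) * Real.exp (c / Real.log 2) * Real.exp (c * (4 / ε)) with hW
  have hWpos : 0 < W := by positivity
  refine ⟨K * W * (2 / ε), by positivity, Real.exp (Real.exp ((8/ε)^2)), ?_⟩
  intro x hx r hr1 hr2 y hy y' hy' u hu hyy'
  have hx0 : 0 < x := lt_of_lt_of_le (Real.exp_pos _) hx
  have hLbig : (8/ε)^2 ≤ LLog2 x := by
    have h1 : Real.exp ((8/ε)^2) ≤ Real.log x := (Real.le_log_iff_exp_le hx0).2 hx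
    have h2 : Real.exp ((8/ε)^2) ≤ LLog x := le_trans h1 (le_max_right _ _)
    have h3 : (8/ε)^2 ≤ Real.log (LLog x) := (Real.le_log_iff_exp_le (lt_of_lt_of_le (Real.exp_pos _) h2)).2 h2
    exact le_trans h3 (le_max_right _ _)
  obtain ⟨hy0, hyA, _⟩ := hy
  obtain ⟨hy0', hyA', _⟩ := hy'
  change |(u : ℝ) - (Real.log 4 - 1) / Real.log 2 * (((r : ℝ) / LLog2 x - 1) * LLog2 x)| ≤ Real.sqrt (LLog2 x) at hu
  have hAA' := LLog2_mono hy0 hyy'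
  set L := LLog2 x with hL
  set A := LLog2 y with hA
  set A' := LLog2 y' with hA'
  have hLpos : 0 < L := lt_of_lt_of_le (by positivity) hLbig
  have hαL : ((r : ℝ) / L - 1) * L = r - L := by field_simp
  rw [hαL] at hyA hyA' hu
  -- the square root is small
  have hsq : √L ≤ ε / 8 * L := by
    have h1 : 8 / ε ≤ √L := by
      rw [← Real.sqrt_sq (by positivity : (0:ℝ) ≤ 8 / ε)]
      exact Real.sqrt_le_sqrt hLbig
    have h2 : √L * √L = L := Real.mul_self_sqrt hLpos.le
    have h3 : ε / 8 * (8 / ε) = 1 := by field_simp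
    have h4 : ε / 8 * √L ≥ 1 := by rw [← h3]; gcongr
    calc √L = 1 * √L := by ring
      _ ≤ (ε / 8 * √L) * √L := by gcongr
      _ = ε / 8 * (√L * √L) := by ring
      _ = _ := by rw [h2]
  have hl2 : 0 < Real.log 2 := Real.log_pos (by norm_num)
  have hl2a := Real.log_two_gt_d9
  have hl2b := Real.log_two_lt_d9
  have hlog4 : Real.log 4 = 2 * Real.log 2 := by
    rw [show (4 : ℝ) = 2 ^ 2 by norm_num, Real.log_pow]; norm_num
  set δ := ε / 8 * L with hδ
  have hδpos : 0 < δ := by positivity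
  have hεL : ε * L = 8 * δ := by rw [hδ]; ring
  set a := (r : ℝ) - L with ha
  have ha1 : 8 * δ ≤ a := by linarith
  have ha2 : a ≤ L - 8 * δ := by linarith
  have hyA1 := abs_le.1 (le_trans hyA hsq)
  have hyA2 := abs_le.1 (le_trans hyA' hsq)
  have hu1 := abs_le.1 (le_trans hu hsq)
  -- bounds for the number of prime factors
  have hk_bound : ∀ t : ℝ, |t - a| ≤ δ → |t / Real.log 2 + u - 2 * a| ≤ 3 * δ := by
    intro t ht
    have e : t / Real.log 2 + u - 2 * a = (t - a) / Real.log 2 + (u - (Real.log 4 - 1) / Real.log 2 * a) := by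
      rw [hlog4]; field_simp; ring
    rw [e]
    refine le_trans (abs_add_le _ _) ?_
    have h1 : |(t - a) / Real.log 2| ≤ 2 * δ := by
      rw [abs_div, abs_of_pos hl2, div_le_iff₀ hl2]
      nlinarith
    have h2 := le_trans hu hsq
    linarith
  set S := {n | n ∈ Sset 1 x ∧ omegaN n = r ∧
            (omegaN (nsmall n y) : ℝ) = A / Real.log 2 + u ∧
            (omegaN (nsmall n y') : ℝ) = A' / Real.log 2 + u} with hS
  have habs : |A - A'| = A' - A := by rw [abs_sub_comm]; exact abs_of_nonneg (by linarith)
  rw [habs]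
  rcases S.eq_empty_or_nonempty with hemp | ⟨n₀, hn₀⟩
  · rw [hemp, finsum_mem_empty, mul_zero]
    positivity
  · obtain ⟨_, hr0, hk0, hk0'⟩ := hn₀
    obtain ⟨hm1, hm2⟩ := omega_mono n₀ hyy'
    rw [hr0] at hm2
    set k := omegaN (nsmall n₀ y) with hk
    set k' := omegaN (nsmall n₀ y') with hk'
    have hsum := sum_bound x y y' hyy' r k k' S (by
      rintro n ⟨h1, h2, h3, h4⟩
      refine ⟨h1, h2, ?_, ?_⟩
      · have : (omegaN (nsmall n y) : ℝ) = k := by rw [h3, hk0]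
        exact_mod_cast this
      · have : (omegaN (nsmall n y') : ℝ) = k' := by rw [h4, hk0']
        exact_mod_cast this)
    have hkb := abs_le.1 (hk_bound A (le_trans hyA hsq))
    have hkb' := abs_le.1 (hk_bound A' (le_trans hyA' hsq))
    rw [← hk0] at hkb
    rw [← hk0'] at hkb'
    set j := k' - k with hj
    set l := r - k' with hl
    have hjr : (j : ℝ) = k' - k := by rw [hj, Nat.cast_sub hm1]
    have hlr : (l : ℝ) = r - k' := by rw [hl, Nat.cast_sub hm2]
    have hj2 : (j : ℝ) * Real.log 2 = A' - A := by
      rw [hjr, hk0, hk0']; field_simp; ring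
    have hku : (k : ℝ) * Real.log 2 = A + u * Real.log 2 := by
      rw [hk0]; field_simp
    have hApos : 0 < A := by linarith
    set B := L - A' with hB
    have hBpos : 0 < B := by linarith
    have hkpos : 0 < k := by
      have : (0 : ℝ) < k := by linarith
      exact_mod_cast this
    have hlpos : 0 < l := by
      have : (0 : ℝ) < l := by linarith
      exact_mod_cast this
    have hMk : (k : ℝ) ≤ 4 / ε * A := by
      have h1 : 4 / ε * A ≥ 4 / ε * (7 * δ) := by gcongr; linarith
      have h2 : 4 / ε * (7 * δ) = 7 / 2 * L := by rw [hδ]; field_simp; norm_num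
      linarith
    have hMl : (l : ℝ) ≤ 4 / ε * B := by
      have h1 : 4 / ε * B ≥ 4 / ε * (7 * δ) := by gcongr; linarith
      have h2 : 4 / ε * (7 * δ) = 7 / 2 * L := by rw [hδ]; field_simp; norm_num
      linarith
    have hA'L : A' < L := by linarith
    have hy'x : y' ≤ x := by
      by_contra hcon
      push Not at hcon
      have := LLog2_mono hx0 hcon.le
      linarith
    have f1 : psum 1 y ^ k / k.factorial ≤ Real.exp (c * (4 / ε)) * ((2:ℝ) ^ (-u) * Real.exp A / √k) := by
      refine le_trans ?_ (factor1 hApos hc.le hkpos hMk u hku)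
      have := psum_nonneg 1 y
      gcongr
      exact hP1 y hy0
    have f2 : psum y y' ^ j / j.factorial ≤ Real.exp (c / Real.log 2) * (Real.exp (A' - A) * Real.exp (-Qfun (1 / Real.log 2) * (A' - A))) := by
      refine le_trans ?_ (factor2 (by linarith) hc.le j hj2)
      have := psum_nonneg y y'
      gcongr
      exact hP2 y y' hy0 hyy'
    have f3 : psum y' x ^ l / l.factorial ≤ Real.exp (c * (4 / ε)) * (Real.exp B / √l) := by
      refine le_trans ?_ (factor3 hBpos hc.le hlpos hMl)
      have := psum_nonneg y' x
      gcongr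
      exact hP2 y' x hy0' hy'x
    have hq := fun (y z : ℝ) (k : ℕ) => div_nonneg (pow_nonneg (psum_nonneg y z) k) (Nat.cast_nonneg (α := ℝ) k.factorial)
    have f123 := mul_le_mul (mul_le_mul f1 f2 (hq _ _ _) (by positivity)) f3 (hq _ _ _) (by positivity)
    obtain ⟨hp0, hp1⟩ := hprod x hx0
    have hsqrt : ε / 2 * L ≤ √(k : ℝ) * √(l : ℝ) := by
      have h1 : √(ε / 2 * L) ≤ √(k : ℝ) := Real.sqrt_le_sqrt (by linarith)
      have h2 : √(ε / 2 * L) ≤ √(l : ℝ) := Real.sqrt_le_sqrt (by linarith)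
      calc ε / 2 * L = √(ε / 2 * L) * √(ε / 2 * L) := (Real.mul_self_sqrt (by positivity)).symm
        _ ≤ _ := by gcongr
    have hskpos : 0 < √(k : ℝ) := Real.sqrt_pos.2 (by exact_mod_cast hkpos)
    have hslpos : 0 < √(l : ℝ) := Real.sqrt_pos.2 (by exact_mod_cast hlpos)
    have hexp : Real.exp (-L) * (Real.exp A * Real.exp (A' - A) * Real.exp B) = 1 := by
      rw [← Real.exp_add, ← Real.exp_add, ← Real.exp_add, Real.exp_eq_one_iff, hB]; ring
    have hu2 : (0:ℝ) < 2 ^ (-u) := by positivity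
    set E := Real.exp (-Qfun (1 / Real.log 2) * (A' - A)) with hE
    have hEpos : 0 < E := Real.exp_pos _
    have hinv : (√(k : ℝ) * √(l : ℝ))⁻¹ ≤ (ε / 2 * L)⁻¹ := inv_anti₀ (by positivity) hsqrt
    refine le_trans (mul_le_mul_of_nonneg_left (le_trans hsum f123) hp0) ?_
    refine le_trans (mul_le_mul_of_nonneg_right hp1 (by positivity)) ?_
    calc _ = K * W * ((2:ℝ) ^ (-u)) * E * (√(k : ℝ) * √(l : ℝ))⁻¹ *
          (Real.exp (-L) * (Real.exp A * Real.exp (A' - A) * Real.exp B)) := by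
          rw [hW]; rw [← hL]; field_simp
      _ = K * W * ((2:ℝ) ^ (-u)) * E * (√(k : ℝ) * √(l : ℝ))⁻¹ := by rw [hexp, mul_one]
      _ ≤ K * W * ((2:ℝ) ^ (-u)) * E * (ε / 2 * L)⁻¹ := by gcongr
      _ = _ := by field_simp

theorem statement12 (ε : ℝ) (hε : 0 < ε) (hε' : ε < 1/2) :
    ∃ C : ℝ, 0 < C ∧ ∃ x₀ : ℝ, ∀ x : ℝ, x₀ ≤ x → ∀ r : ℕ,
      (1 + ε) * LLog2 x ≤ r → (r : ℝ) ≤ (2 - ε) * LLog2 x →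
      ∀ y ∈ Yset ((r : ℝ) / LLog2 x - 1) x, ∀ y' ∈ Yset ((r : ℝ) / LLog2 x - 1) x,
      ∀ u ∈ Uset ((r : ℝ) / LLog2 x - 1) x,
      primeProd 1 x * ∑ᶠ n ∈ {n | n ∈ Sset 1 x ∧ omegaN n = r ∧
            (omegaN (nsmall n y) : ℝ) = LLog2 y / Real.log 2 + u ∧
            (omegaN (nsmall n y') : ℝ) = LLog2 y' / Real.log 2 + u}, ((n : ℝ))⁻¹
        ≤ C * ((2:ℝ) ^ (-u) / LLog2 x) *
            Real.exp (-Qfun (1 / Real.log 2) * |LLog2 y - LLog2 y'|) := by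
  obtain ⟨C, hC, x₀, h⟩ := core ε hε hε'
  refine ⟨C, hC, x₀, fun x hx r hr1 hr2 y hy y' hy' u hu => ?_⟩
  rcases le_total y y' with hyy | hyy
  · exact h x hx r hr1 hr2 y hy y' hy' u hu hyy
  · have h1 := h x hx r hr1 hr2 y' hy' y hy u hu hyy
    rw [abs_sub_comm (LLog2 y) (LLog2 y')]
    have e : {n | n ∈ Sset 1 x ∧ omegaN n = r ∧
            (omegaN (nsmall n y) : ℝ) = LLog2 y / Real.log 2 + u ∧
            (omegaN (nsmall n y') : ℝ) = LLog2 y' / Real.log 2 + u} =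
        {n | n ∈ Sset 1 x ∧ omegaN n = r ∧
            (omegaN (nsmall n y') : ℝ) = LLog2 y' / Real.log 2 + u ∧
            (omegaN (nsmall n y) : ℝ) = LLog2 y / Real.log 2 + u} := by
      ext n
      simp only [Set.mem_ofPred_eq]
      tauto
    rw [e]
    exact h1
end

section
/- For every ε ∈ (0, 1/2) there exist c = c(ε) > 0 and x₀ = x₀(ε) such that the following holds for all x ≥ x₀. Let r be an integer with (1+ε)·Log₂ x ≤ r ≤ (2−ε)·Log₂ x, set α := r/Log₂ x − 1, and let u ∈ 𝒰. Then ∏_{p < x}(1 + 1/p)^{-1} · ∑ 1/n ≥ c · 2^{−u}/√(Log₂ x), where the sum is over those n ∈ S_{<x} with ω(n) = r for which there exists y ∈ 𝒴 with ω(n_{<y}) = Log₂ y/log 2 + u. -/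
open Filter Topology
open scoped Classical

lemma log_fact_eq (N : ℕ) : Real.log (N.factorial : ℝ) =
    ∑ p ∈ N.primesLE, (N.factorial.factorization p : ℝ) * Real.log p := by
  rw [Real.log_nat_eq_sum_factorization]
  apply Finsupp.sum_of_support_subset
  · intro p hp
    rw [Nat.support_factorization, Nat.mem_primeFactors] at hp
    rw [Nat.mem_primesLE]
    exact ⟨(hp.1.dvd_factorial).1 hp.2.1, hp.1⟩
  · simp

lemma fact_factor_lower {N p : ℕ} (hp : p.Prime) : (N : ℝ) / p - 1 ≤ (N.factorial.factorization p : ℝ) := by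
  have h : N / p ≤ N.factorial.factorization p := by
    rw [Nat.factorization_factorial hp (b := Nat.log p N + 2) (by omega)]
    have := Finset.single_le_sum (f := fun i => N / p ^ i) (s := Finset.Ico 1 (Nat.log p N + 2))
      (fun i _ => Nat.zero_le _) (a := 1) (by simp)
    simpa using this
  have h2 : (N:ℝ) / p < (N / p : ℕ) + 1 := by
    have := Nat.lt_floor_add_one ((N:ℝ)/p)
    rwa [Nat.floor_div_eq_div] at this
  have : ((N / p : ℕ) : ℝ) ≤ N.factorial.factorization p := by exact_mod_cast h
  linarith

lemma fact_factor_upper {N p : ℕ} (hp : p.Prime) : (N.factorial.factorization p : ℝ) ≤ N / ((p:ℝ) - 1) := by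
  have h := Nat.factorization_factorial_le_div_pred hp N
  have h3 : ((N / (p-1) : ℕ) : ℝ) ≤ (N:ℝ) / ((p - 1 : ℕ) : ℝ) := Nat.cast_div_le
  rw [Nat.cast_sub hp.one_le] at h3
  have : (N.factorial.factorization p : ℝ) ≤ ((N / (p-1) : ℕ) : ℝ) := by exact_mod_cast h
  push_cast at h3 this ⊢
  linarith

noncomputable def AM (N : ℕ) : ℝ := ∑ p ∈ N.primesLE, Real.log p / p
noncomputable def TM (N : ℕ) : ℝ := ∑ p ∈ N.primesLE, 1 / (p:ℝ)

lemma log_fact_le (N : ℕ) : Real.log (N.factorial : ℝ) ≤ N * Real.log N := by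
  have : (N.factorial : ℝ) ≤ (N:ℝ)^N := by exact_mod_cast Nat.factorial_le_pow N
  calc _ ≤ Real.log ((N:ℝ)^N) := Real.log_le_log (by exact_mod_cast N.factorial_pos) this
    _ = _ := by rw [Real.log_pow]

lemma AM_upper {N : ℕ} (hN : 1 ≤ N) : AM N ≤ Real.log N + Real.log 4 := by
  have hN0 : (0:ℝ) < N := by exact_mod_cast hN
  have h1 : N * AM N - Chebyshev.theta N ≤ Real.log (N.factorial : ℝ) := by
    rw [log_fact_eq, Chebyshev.theta_eq_sum_primesLE_log, AM, Finset.mul_sum, ← Finset.sum_sub_distrib]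
    apply Finset.sum_le_sum
    intro p hp
    have hpp := Nat.prime_of_mem_primesLE hp
    have h0 : 0 ≤ Real.log p := Real.log_natCast_nonneg p
    have := mul_le_mul_of_nonneg_right (fact_factor_lower (N := N) hpp) h0
    calc _ = ((N:ℝ)/p - 1) * Real.log p := by ring
      _ ≤ _ := this
  have h2 := Chebyshev.theta_le_log4_mul_x (x := (N:ℝ)) hN0.le
  have h3 := log_fact_le N
  have : N * AM N ≤ N * (Real.log N + Real.log 4) := by nlinarith
  exact le_of_mul_le_mul_left this hN0

lemma AM_lower : ∃ C : ℝ, 0 ≤ C ∧ ∀ N : ℕ, 1 ≤ N → Real.log N - C ≤ AM N := by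
  have hs : Summable (fun n : ℕ => 4 * (1 / (n:ℝ) ^ (3/2:ℝ))) :=
    (Real.summable_one_div_nat_rpow.2 (by norm_num)).mul_left 4
  refine ⟨1 + ∑' n : ℕ, 4 * (1 / (n:ℝ) ^ (3/2:ℝ)), ?_, ?_⟩
  · have : 0 ≤ ∑' n : ℕ, 4 * (1 / (n:ℝ) ^ (3/2:ℝ)) := tsum_nonneg (fun n => by positivity)
    linarith
  intro N hN
  have hN0 : (0:ℝ) < N := by exact_mod_cast hN
  have h1 : Real.log (N.factorial : ℝ) ≤ N * (AM N + ∑' n : ℕ, 4 * (1 / (n:ℝ) ^ (3/2:ℝ))) := by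
    have hle : ∑ p ∈ N.primesLE, 4 * (1 / (p:ℝ) ^ (3/2:ℝ)) ≤ ∑' n : ℕ, 4 * (1 / (n:ℝ) ^ (3/2:ℝ)) :=
      hs.sum_le_tsum _ (fun n _ => by positivity)
    refine le_trans ?_ (mul_le_mul_of_nonneg_left (add_le_add (le_refl (AM N)) hle) hN0.le)
    rw [log_fact_eq, AM, ← Finset.sum_add_distrib, Finset.mul_sum]
    apply Finset.sum_le_sum
    intro p hp
    have hpp := Nat.prime_of_mem_primesLE hp
    have h0 : 0 ≤ Real.log p := Real.log_natCast_nonneg p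
    have hp2 : (2:ℝ) ≤ p := by exact_mod_cast hpp.two_le
    have hp0 : (0:ℝ) < p := by linarith
    have := mul_le_mul_of_nonneg_right (fact_factor_upper (N := N) hpp) h0
    refine this.trans ?_
    rw [div_mul_eq_mul_div, mul_div_assoc]
    apply mul_le_mul_of_nonneg_left _ hN0.le
    have e1 : Real.log p / ((p:ℝ) - 1) = Real.log p / p + Real.log p / (p * (p - 1)) := by
      have : (p:ℝ) - 1 ≠ 0 := by linarith
      field_simp
      ring
    rw [e1]
    gcongr
    have hsq : (p:ℝ)^(3/2:ℝ) = p * Real.sqrt p := by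
      rw [Real.sqrt_eq_rpow, show (3/2:ℝ) = 1 + 1/2 by norm_num, Real.rpow_add hp0, Real.rpow_one]
    rw [hsq]
    have hs0 : 0 < Real.sqrt p := Real.sqrt_pos.2 hp0
    have hss : Real.sqrt p * Real.sqrt p = p := Real.mul_self_sqrt hp0.le
    have hl : Real.log p ≤ 2 * Real.sqrt p := by
      have := Real.log_le_sub_one_of_pos hs0
      rw [Real.log_sqrt hp0.le] at this
      linarith
    rw [mul_one_div, div_le_div_iff₀ (by nlinarith) (by positivity)]
    calc Real.log p * (p * Real.sqrt p) ≤ (2 * Real.sqrt p) * (p * Real.sqrt p) := by gcongr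
      _ = 2 * p * (Real.sqrt p * Real.sqrt p) := by ring
      _ = 2 * p * p := by rw [hss]
      _ ≤ 4 * (p * (p - 1)) := by nlinarith
  have h2 := Stirling.le_log_factorial_stirling (n := N) (by omega)
  have h3 : 0 ≤ Real.log N := Real.log_natCast_nonneg N
  have h4 : 0 ≤ Real.log (2 * Real.pi) := Real.log_nonneg (by linarith [Real.pi_gt_three])
  have : N * (Real.log N - 1) ≤ N * (AM N + ∑' n : ℕ, 4 * (1 / (n:ℝ) ^ (3/2:ℝ))) := by
    linarith
  have := le_of_mul_le_mul_left this hN0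
  linarith

lemma step_eq (N : ℕ) : TM (N+1) - TM N = (AM (N+1) - AM N) / Real.log ((N+1:ℕ):ℝ) := by
  unfold TM AM
  rw [Nat.primesLE_succ]
  split_ifs with h
  · rw [Finset.sum_insert (Nat.notMem_primesLE N), Finset.sum_insert (Nat.notMem_primesLE N)]
    have : Real.log ((N+1:ℕ):ℝ) ≠ 0 := (Real.log_pos (by exact_mod_cast h.one_lt)).ne'
    field_simp
    ring
  · simp

lemma loglog_step {N : ℕ} (hN : 2 ≤ N) :
    (Real.log ((N+1:ℕ):ℝ) - Real.log N) / Real.log ((N+1:ℕ):ℝ) ≤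
      Real.log (Real.log ((N+1:ℕ):ℝ)) - Real.log (Real.log N) ∧
    Real.log (Real.log ((N+1:ℕ):ℝ)) - Real.log (Real.log N) ≤
      (Real.log ((N+1:ℕ):ℝ) - Real.log N) / Real.log N := by
  have hN2 : (2:ℝ) ≤ N := by exact_mod_cast hN
  have a : 0 < Real.log N := Real.log_pos (by linarith)
  have b : 0 < Real.log ((N+1:ℕ):ℝ) := Real.log_pos (by push_cast; linarith)
  constructor
  · have := Real.log_le_sub_one_of_pos (div_pos a b)
    rw [Real.log_div a.ne' b.ne'] at this
    rw [sub_div, div_self b.ne']; linarith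
  · have := Real.log_le_sub_one_of_pos (div_pos b a)
    rw [Real.log_div b.ne' a.ne'] at this
    rw [sub_div, div_self a.ne']; linarith

lemma mertens_nat : ∃ C : ℝ, 0 < C ∧ ∀ N : ℕ, 2 ≤ N → |TM N - Real.log (Real.log N)| ≤ C := by
  obtain ⟨C1, hC1, hA⟩ := AM_lower
  set C := max C1 (Real.log 4) with hC
  have hC0 : 0 ≤ C := le_max_of_le_left hC1
  have hAl : ∀ N : ℕ, 1 ≤ N → Real.log N - C ≤ AM N := fun N hN => by
    have := hA N hN; have := le_max_left C1 (Real.log 4); linarith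
  have hAu : ∀ N : ℕ, 1 ≤ N → AM N ≤ Real.log N + C := fun N hN => by
    have := AM_upper hN; have := le_max_right C1 (Real.log 4); linarith
  let U : ℕ → ℝ := fun N => TM N - Real.log (Real.log N) - (AM N - Real.log N) / Real.log N + C / Real.log N
  let V : ℕ → ℝ := fun N => TM N - Real.log (Real.log N) - (AM N - Real.log N) / Real.log N - (C + 1) / Real.log N
  have key : ∀ N : ℕ, 2 ≤ N → U (N+1) ≤ U N ∧ V N ≤ V (N+1) := by
    intro N hN
    have hN2 : (2:ℝ) ≤ N := by exact_mod_cast hN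
    have a : 0 < Real.log N := Real.log_pos (by linarith)
    have ab : Real.log N ≤ Real.log ((N+1:ℕ):ℝ) := Real.log_le_log (by linarith) (by push_cast; linarith)
    have b : 0 < Real.log ((N+1:ℕ):ℝ) := lt_of_lt_of_le a ab
    have ab1 : Real.log ((N+1:ℕ):ℝ) - Real.log N ≤ 1 := by
      rw [← Real.log_div (by positivity) (by positivity)]
      have := Real.log_le_sub_one_of_pos (show (0:ℝ) < ((N+1:ℕ):ℝ)/N by positivity)
      have h2 : ((N+1:ℕ):ℝ)/N ≤ 2 := by
        rw [div_le_iff₀ (by linarith)]; push_cast; linarith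
      linarith
    obtain ⟨l1, l2⟩ := loglog_step hN
    have hst := step_eq N
    have r1 := hAl N (by omega)
    have r2 := hAu N (by omega)
    simp only [U, V]
    set x := Real.log (N:ℝ)
    set y := Real.log ((N+1:ℕ):ℝ)
    set A0 := AM N
    set A1 := AM (N+1)
    have hd : 0 ≤ 1/x - 1/y := by
      have := one_div_le_one_div_of_le a ab
      linarith
    have e1 : (A1 - A0) / y = (y - x)/y + (A1 - y)/y - (A0 - x)/x + (A0 - x) * (1/x - 1/y) := by
      field_simp; ring
    have e2 : (y-x)/x = (y-x)/y + (y-x)*(1/x-1/y) := by field_simp; ring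
    have e3 : (A0 - x) * (1/x - 1/y) ≤ C * (1/x-1/y) := by gcongr; linarith
    have e4 : -C * (1/x - 1/y) ≤ (A0 - x) * (1/x-1/y) := by gcongr; linarith
    have e5 : (y-x)*(1/x-1/y) ≤ 1 * (1/x-1/y) := by gcongr
    have e6 : C / x - C / y = C * (1/x-1/y) := by ring
    have e7 : (C+1) / x - (C+1) / y = C * (1/x-1/y) + 1 * (1/x-1/y) := by ring
    constructor
    · linarith
    · linarith
  have hU : ∀ N : ℕ, 2 ≤ N → U N ≤ U 2 ∧ V 2 ≤ V N := by
    intro N hN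
    induction N, hN using Nat.le_induction with
    | base => exact ⟨le_rfl, le_rfl⟩
    | succ n hn ih => exact ⟨(key n hn).1.trans ih.1, ih.2.trans (key n hn).2⟩
  refine ⟨|U 2| + |V 2| + (2 * C + 1) / Real.log 2 + 1, by positivity, ?_⟩
  intro N hN
  obtain ⟨h1, h2⟩ := hU N hN
  have hN2 : (2:ℝ) ≤ N := by exact_mod_cast hN
  have l2 : 0 < Real.log 2 := Real.log_pos (by norm_num)
  have ab : Real.log 2 ≤ Real.log N := Real.log_le_log (by norm_num) hN2
  have a : 0 < Real.log N := lt_of_lt_of_le l2 ab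
  have r1 := hAl N (by omega)
  have r2 := hAu N (by omega)
  have f1 : (AM N - Real.log N) / Real.log N ≤ C / Real.log N := by gcongr; linarith
  have f2 : - C / Real.log N ≤ (AM N - Real.log N) / Real.log N := by gcongr; linarith
  have f3 : (2 * C + 1) / Real.log N ≤ (2 * C + 1) / Real.log 2 := by gcongr
  have f4 : (2 * C + 1) / Real.log N = C / Real.log N + (C + 1) / Real.log N := by ring
  have f5 : (C + 1) / Real.log N = C / Real.log N + 1 / Real.log N := by ring
  have f6 : 0 ≤ C / Real.log N := by positivity
  have f7 : 0 ≤ 1 / Real.log N := by positivity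
  have f8 : - C / Real.log N = - (C / Real.log N) := by ring
  have g1 := le_abs_self (U 2)
  have g2 := neg_abs_le (V 2)
  have g3 := abs_nonneg (U 2)
  have g4 := abs_nonneg (V 2)
  simp only [U, V] at h1 h2 g1 g2 g3 g4 ⊢
  rw [abs_le]
  constructor <;> linarith

lemma pois_up {l : ℝ} (hl : 0 ≤ l) {k : ℕ} (hk : 1 ≤ k) :
    l^k * Real.sqrt k ≤ k.factorial * Real.exp l := by
  have hk0 : (0:ℝ) < k := by exact_mod_cast hk
  have h1 := Stirling.le_factorial_stirling k
  have h2 : Real.sqrt k ≤ Real.sqrt (2 * Real.pi * k) := by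
    apply Real.sqrt_le_sqrt
    nlinarith [Real.pi_gt_three]
  have h3 : Real.sqrt k * (k / Real.exp 1)^k ≤ k.factorial := by
    refine le_trans ?_ h1
    gcongr
  have h4 : l^k ≤ (k / Real.exp 1)^k * Real.exp l := by
    have h5 : l / k ≤ Real.exp (l / k - 1) := by
      have := Real.add_one_le_exp (l / k - 1); linarith
    have h6 : l ≤ k / Real.exp 1 * Real.exp (l/k) := by
      rw [Real.exp_sub] at h5
      calc l = k * (l / k) := by field_simp
        _ ≤ k * (Real.exp (l/k) / Real.exp 1) := by gcongr
        _ = _ := by ring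
    calc l^k ≤ (k / Real.exp 1 * Real.exp (l/k))^k := by gcongr
      _ = (k / Real.exp 1)^k * Real.exp l := by
        rw [mul_pow, ← Real.exp_nat_mul]; congr 2; field_simp
  calc l^k * Real.sqrt k ≤ ((k / Real.exp 1)^k * Real.exp l) * Real.sqrt k := by gcongr
    _ = (Real.sqrt k * (k / Real.exp 1)^k) * Real.exp l := by ring
    _ ≤ _ := by gcongr

lemma fact_up {k : ℕ} (hk : 1 ≤ k) :
    (k.factorial : ℝ) ≤ Real.exp 1 * Real.sqrt k * (k / Real.exp 1)^k := by
  have hk0 : (0:ℝ) < k := by exact_mod_cast hk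
  have h := Stirling.stirlingSeq'_antitone (show 0 ≤ k - 1 by omega)
  simp only [Function.comp] at h
  have e : Nat.succ (k-1) = k := by omega
  rw [e] at h
  have e2 : Stirling.stirlingSeq (Nat.succ 0) = Real.exp 1 / Real.sqrt 2 := Stirling.stirlingSeq_one
  rw [e2, Stirling.stirlingSeq] at h
  rw [div_le_iff₀ (by positivity)] at h
  refine h.trans (le_of_eq ?_)
  rw [Real.sqrt_mul (by norm_num)]
  have : Real.sqrt 2 ≠ 0 := by positivity
  field_simp

lemma pois_low {l D : ℝ} (hl : 0 < l) {k : ℕ} (hk : 1 ≤ k) (hD : (k - l)^2 ≤ D * l) :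
    Real.exp (l - D) * k.factorial ≤ Real.exp 1 * Real.sqrt k * l^k := by
  have hk0 : (0:ℝ) < k := by exact_mod_cast hk
  have h1 := fact_up hk
  have h2 : Real.exp (l - D) * (k / Real.exp 1)^k ≤ l^k := by
    have h3 : k / l ≤ Real.exp (k / l - 1) := by
      have := Real.add_one_le_exp (k / l - 1); linarith
    have h4 : (k / l)^k ≤ Real.exp (k - l + D) := by
      calc (k/l)^k ≤ (Real.exp (k / l - 1))^k := by gcongr
        _ = Real.exp (k * (k/l - 1)) := by rw [← Real.exp_nat_mul]
        _ ≤ _ := by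
          apply Real.exp_le_exp.2
          have : (k - l)^2 / l ≤ D := by rw [div_le_iff₀ hl]; exact hD
          have e : k * (k/l - 1) = (k - l) + (k-l)^2/l := by field_simp; ring
          linarith
    have e : Real.exp (l - D) * (k / Real.exp 1)^k = l^k * ((k/l)^k * Real.exp (l - D - k)) := by
      rw [div_pow, div_pow, ← Real.exp_nat_mul, mul_one, Real.exp_sub (l - D)]
      field_simp
    rw [e]
    have : (k/l)^k * Real.exp (l - D - k) ≤ 1 := by
      calc _ ≤ Real.exp (k - l + D) * Real.exp (l - D - k) := by gcongr
        _ = 1 := by rw [← Real.exp_add, show (k:ℝ) - l + D + (l - D - k) = 0 by ring, Real.exp_zero]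
    calc _ ≤ l^k * 1 := by gcongr
      _ = _ := mul_one _
  calc Real.exp (l - D) * k.factorial ≤ Real.exp (l - D) * (Real.exp 1 * Real.sqrt k * (k / Real.exp 1)^k) := by gcongr
    _ = Real.exp 1 * Real.sqrt k * (Real.exp (l - D) * (k / Real.exp 1)^k) := by ring
    _ ≤ _ := by gcongr

noncomputable def PP (y : ℝ) : Finset ℕ := (Finset.range ⌈y⌉₊).filter (fun p => p.Prime ∧ 11 ≤ p)

lemma mem_PP {y : ℝ} {p : ℕ} : p ∈ PP y ↔ (p:ℝ) < y ∧ p.Prime ∧ 11 ≤ p := by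
  simp [PP, Nat.lt_ceil]

lemma PP_mono {y z : ℝ} (h : y ≤ z) : PP y ⊆ PP z := by
  intro p hp
  rw [mem_PP] at *
  exact ⟨hp.1.trans_le h, hp.2⟩

lemma PP_sq {y : ℝ} {A : Finset ℕ} (hA : A ⊆ PP y) : ∑ p ∈ A, (1 / (p:ℝ))^2 ≤ 1/10 := by
  have h := sum_Ioc_inv_sq_le_sub (α := ℝ) (k := 10) (n := 10 + ⌈y⌉₊) (by norm_num) (by omega)
  have h2 : ∑ p ∈ A, (1 / (p:ℝ))^2 ≤ ∑ i ∈ Finset.Ioc 10 (10 + ⌈y⌉₊), ((i:ℝ)^2)⁻¹ := by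
    have : ∀ p : ℕ, (1 / (p:ℝ))^2 = ((p:ℝ)^2)⁻¹ := fun p => by simp
    simp only [this]
    apply Finset.sum_le_sum_of_subset_of_nonneg
    · intro p hp
      have := hA hp
      simp [PP] at this
      simp; omega
    · intros; positivity
  have : (0:ℝ) ≤ ((10 + ⌈y⌉₊ : ℕ):ℝ)⁻¹ := by positivity
  push_cast at h this
  norm_num at h
  linarith

lemma mertens_real_s13 : ∃ C : ℝ, 0 < C ∧ ∀ y : ℝ, 16 ≤ y →
    |∑ p ∈ PP y, 1 / (p:ℝ) - Real.log (Real.log y)| ≤ C ∧ TM (⌈y⌉₊ - 1) ≤ Real.log (Real.log y) + C := by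
  obtain ⟨C, hC, h⟩ := mertens_nat
  refine ⟨C + 1 + 11, by positivity, ?_⟩
  intro y hy
  set N := ⌈y⌉₊ - 1 with hN
  have hc : 16 ≤ ⌈y⌉₊ := by
    have : (16:ℝ) ≤ ⌈y⌉₊ := hy.trans (Nat.le_ceil y)
    exact_mod_cast this
  have hN2 : 2 ≤ N := by omega
  have hNy : (N:ℝ) < y := by
    rw [← Nat.lt_ceil]; omega
  have hyN : y - 1 ≤ N := by
    have := Nat.le_ceil y
    rw [hN, Nat.cast_sub (by omega)]; push_cast; linarith
  have hl : 0 < Real.log N := Real.log_pos (by linarith)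
  have hly : 0 < Real.log y := Real.log_pos (by linarith)
  have u1 : Real.log (Real.log N) ≤ Real.log (Real.log y) :=
    Real.log_le_log hl (Real.log_le_log (by linarith) hNy.le)
  have u2 : Real.log (Real.log y) - 1 ≤ Real.log (Real.log N) := by
    have h1 : Real.log y ≤ 2 * Real.log N := by
      have : Real.log y ≤ Real.log ((N:ℝ)^2) := Real.log_le_log (by linarith) (by nlinarith)
      rw [Real.log_pow] at this
      exact_mod_cast this
    have h2 : Real.log (Real.log y) ≤ Real.log (2 * Real.log N) := Real.log_le_log hly h1
    rw [Real.log_mul (by norm_num) hl.ne'] at h2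
    have := Real.log_two_lt_d9
    linarith
  have hT := abs_le.1 (h N hN2)
  have e : TM N = ∑ p ∈ PP y, 1 / (p:ℝ) + ∑ p ∈ N.primesLE.filter (fun p => ¬ 11 ≤ p), 1/(p:ℝ) := by
    rw [TM, ← Finset.sum_filter_add_sum_filter_not N.primesLE (fun p => 11 ≤ p)]
    congr 1
    apply Finset.sum_congr _ (fun _ _ => rfl)
    ext p
    simp only [Finset.mem_filter, Nat.mem_primesLE, PP, Finset.mem_range]
    constructor
    · rintro ⟨⟨h1, h2⟩, h3⟩; exact ⟨by omega, h2, h3⟩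
    · rintro ⟨h1, h2, h3⟩; exact ⟨⟨by omega, h2⟩, h3⟩
  have r0 : 0 ≤ ∑ p ∈ N.primesLE.filter (fun p => ¬ 11 ≤ p), 1/(p:ℝ) :=
    Finset.sum_nonneg fun p _ => by positivity
  have r1 : ∑ p ∈ N.primesLE.filter (fun p => ¬ 11 ≤ p), 1/(p:ℝ) ≤ 11 := by
    have hs : N.primesLE.filter (fun p => ¬ 11 ≤ p) ⊆ Finset.range 11 := by
      intro p hp; simp at hp ⊢; omega
    calc _ ≤ ∑ p ∈ Finset.range 11, 1/(p:ℝ) :=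
          Finset.sum_le_sum_of_subset_of_nonneg hs (fun _ _ _ => by positivity)
      _ ≤ ∑ p ∈ Finset.range 11, (1:ℝ) := by
          apply Finset.sum_le_sum
          intro p _
          rcases Nat.eq_zero_or_pos p with rfl | hp
          · simp
          · rw [div_le_one (by exact_mod_cast hp)]; exact_mod_cast hp
      _ = 11 := by simp
  refine ⟨?_, by linarith [hT.2]⟩
  rw [abs_le]
  constructor <;> linarith [hT.1, hT.2]


lemma primeProd_lower (x : ℝ) : Real.exp (- TM (⌈x⌉₊ - 1)) ≤ primeProd 1 x := by
  have e : {p : ℕ | p.Prime ∧ (1:ℝ) ≤ (p : ℝ) ∧ (p : ℝ) < x} = ((⌈x⌉₊ - 1).primesLE : Set ℕ) := by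
    ext p
    simp only [Set.mem_ofPred_eq, Finset.mem_coe, Nat.mem_primesLE]
    rw [← Nat.lt_ceil]
    constructor
    · rintro ⟨h1, h2, h3⟩; exact ⟨by omega, h1⟩
    · rintro ⟨h1, h2⟩
      exact ⟨h2, by exact_mod_cast h2.one_le, by have := h2.pos; omega⟩
  rw [primeProd, e, finprod_mem_coe_finset, TM, ← Finset.sum_neg_distrib, Real.exp_sum]
  apply Finset.prod_le_prod
  · intros; positivity
  · intro p hp
    rw [Real.exp_neg]
    have : (0:ℝ) ≤ 1 / p := by positivity
    apply inv_anti₀ (by positivity)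
    have := Real.add_one_le_exp (1/(p:ℝ))
    linarith

lemma Sset_finite (x : ℝ) : (Sset 1 x).Finite := by
  apply (Finset.finite_toSet ((primorial ⌈x⌉₊).divisors)).subset
  intro n hn
  obtain ⟨h0, h1, h2⟩ := hn
  simp only [Finset.mem_coe, Nat.mem_divisors]
  refine ⟨?_, (primorial_pos _).ne'⟩
  rw [← Nat.prod_primeFactors_of_squarefree h1, primorial_eq_prod_primesLE]
  apply Finset.prod_dvd_prod_of_subset
  intro p hp
  rw [Nat.mem_primesLE]
  refine ⟨?_, Nat.prime_of_mem_primeFactors hp⟩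
  have := (h2 p hp).2
  rw [← Nat.lt_ceil] at this
  exact this.le

lemma primeFactors_prod' {x : ℝ} {T : Finset ℕ} (hT : T ⊆ PP x) : (∏ p ∈ T, p).primeFactors = T :=
  Nat.primeFactors_prod fun p hp => (mem_PP.1 (hT hp)).2.1

lemma prod_mem_Sset {x : ℝ} {T : Finset ℕ} (hT : T ⊆ PP x) : (∏ p ∈ T, p) ∈ Sset 1 x := by
  have hpr : ∀ p ∈ T, p.Prime := fun p hp => (mem_PP.1 (hT hp)).2.1
  refine ⟨Finset.prod_pos fun p hp => (hpr p hp).pos, ?_, ?_⟩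
  · refine Finset.squarefree_prod_of_pairwise_isCoprime ?_ fun _ hp => (hpr _ hp).squarefree
    intro p hp q hq hpq
    simpa [Function.onFun, Nat.coprime_iff_isRelPrime] using (Nat.coprime_primes (hpr p hp) (hpr q hq)).2 hpq
  · rw [primeFactors_prod' hT]
    intro p hp
    have := mem_PP.1 (hT hp)
    exact ⟨by exact_mod_cast this.2.1.one_le, this.1⟩

lemma omega_nsmall {x y : ℝ} {T : Finset ℕ} (hT : T ⊆ PP x) :
    omegaN (nsmall (∏ p ∈ T, p) y) = (T ∩ PP y).card := by
  rw [nsmall, primeFactors_prod' hT, omegaN, primeFactors_prod' ((Finset.filter_subset _ _).trans hT)]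
  congr 1
  ext p
  simp only [Finset.mem_filter, Finset.mem_inter]
  constructor
  · rintro ⟨h1, h2⟩; exact ⟨h1, mem_PP.2 ⟨h2, (mem_PP.1 (hT h1)).2⟩⟩
  · rintro ⟨h1, h2⟩; exact ⟨h1, (mem_PP.1 h2).1⟩

lemma link {x : ℝ} {D : Set ℕ} (hD : D ⊆ Sset 1 x) (F : Finset (Finset ℕ))
    (hF : ∀ T ∈ F, T ⊆ PP x ∧ (∏ p ∈ T, p) ∈ D) :
    ∑ T ∈ F, ∏ p ∈ T, 1 / (p:ℝ) ≤ ∑ᶠ n ∈ D, ((n:ℝ))⁻¹ := by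
  have hfin : D.Finite := (Sset_finite x).subset hD
  rw [finsum_mem_eq_finite_toFinset_sum _ hfin]
  have hinj : Set.InjOn (fun T : Finset ℕ => ∏ p ∈ T, p) F := by
    intro T hT T' hT' h
    rw [← primeFactors_prod' (hF T hT).1, ← primeFactors_prod' (hF T' hT').1]
    simp only at h
    rw [h]
  have e : ∑ T ∈ F, ∏ p ∈ T, 1 / (p:ℝ) = ∑ n ∈ F.image (fun T : Finset ℕ => ∏ p ∈ T, p), ((n:ℝ))⁻¹ := by
    rw [Finset.sum_image hinj]
    apply Finset.sum_congr rfl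
    intro T _
    push_cast
    rw [← Finset.prod_inv_distrib]
    simp
  rw [e]
  apply Finset.sum_le_sum_of_subset_of_nonneg
  · intro n hn
    obtain ⟨T, hT, rfl⟩ := Finset.mem_image.1 hn
    exact hfin.mem_toFinset.2 (hF T hT).2
  · intros; positivity

noncomputable def EE (a : ℕ → ℝ) (k : ℕ) (P : Finset ℕ) : ℝ := ∑ T ∈ P.powersetCard k, ∏ p ∈ T, a p

lemma EE_zero (a : ℕ → ℝ) (P : Finset ℕ) : EE a 0 P = 1 := by simp [EE]

lemma EE_insert (a : ℕ → ℝ) (k : ℕ) {P : Finset ℕ} {q : ℕ} (hq : q ∉ P) :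
    EE a (k+1) (insert q P) = EE a (k+1) P + a q * EE a k P := by
  unfold EE
  rw [Finset.powersetCard_succ_insert hq, Finset.sum_union, Finset.sum_image, Finset.mul_sum]
  · congr 1
    apply Finset.sum_congr rfl
    intro T hT
    rw [Finset.prod_insert]
    exact fun h => hq ((Finset.mem_powersetCard.1 hT).1 h)
  · intro T hT T' hT' h
    have h1 : q ∉ T := fun h => hq ((Finset.mem_powersetCard.1 hT).1 h)
    have h2 : q ∉ T' := fun h => hq ((Finset.mem_powersetCard.1 hT').1 h)
    have := congrArg (fun s => Finset.erase s q) h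
    simpa [Finset.erase_insert h1, Finset.erase_insert h2] using this
  · rw [Finset.disjoint_left]
    intro T hT hT'
    obtain ⟨T', hT'', rfl⟩ := Finset.mem_image.1 hT'
    exact hq ((Finset.mem_powersetCard.1 hT).1 (Finset.mem_insert_self _ _))

lemma EE_nonneg {a : ℕ → ℝ} (ha : ∀ p, 0 ≤ a p) (k : ℕ) (P : Finset ℕ) : 0 ≤ EE a k P :=
  Finset.sum_nonneg fun _ _ => Finset.prod_nonneg fun p _ => ha p

lemma bern {S a : ℝ} (hS : 0 ≤ S) (ha : 0 ≤ a) (k : ℕ) :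
    S^(k+1) + (k+1) * a * S^k ≤ (S+a)^(k+1) := by
  induction k with
  | zero => simp
  | succ k ih =>
    have h1 : S^k ≤ (S + a)^k := by gcongr; linarith
    calc S^(k+1+1) + ((k+1:ℕ)+1) * a * S^(k+1)
        ≤ (S + a) * (S^(k+1) + (k+1) * a * S^k) := by
          push_cast
          have : 0 ≤ (k+1) * a * a * S^k := by positivity
          have e : (S + a) * (S^(k+1) + (k+1) * a * S^k) = S^(k+1+1) + ((k+1:ℝ)+1) * a * S^(k+1) + (k+1) * a * a * S^k := by ring
          linarith
      _ ≤ (S+a) * (S+a)^(k+1) := by gcongr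
      _ = _ := by ring

lemma bern2 {S a : ℝ} (hS : 0 ≤ S) (ha : 0 ≤ a) (j : ℕ) :
    (S+a)^(j+2) ≤ S^(j+2) + (j+2) * a * S^(j+1) + (j+2)*(j+1)/2 * a^2 * (S+a)^j := by
  induction j with
  | zero => simp; ring_nf; rfl
  | succ j ih =>
    have h1 : S^(j+1) ≤ (S + a)^(j+1) := by gcongr; linarith
    have h2 : ((j:ℝ)+2) * a^2 * S^(j+1) ≤ ((j:ℝ)+2) * a^2 * (S+a)^(j+1) := by gcongr
    have h3 := mul_le_mul_of_nonneg_left ih (add_nonneg hS ha)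
    push_cast
    have e1 : (S+a) * (S+a)^(j+2) = (S+a)^(j+1+2) := by ring
    have e2 : (S+a) * (S^(j+2) + (j+2) * a * S^(j+1) + (j+2)*(j+1)/2 * a^2 * (S+a)^j)
      = S^(j+1+2) + (j+1+2) * a * S^(j+1+1) + ((j:ℝ)+2) * a^2 * S^(j+1) + (j+2)*(j+1)/2 * a^2 * (S+a)^(j+1) := by ring
    have e3 : ((j:ℝ)+1+2)*(j+1+1)/2 * a^2 * (S+a)^(j+1) = ((j:ℝ)+2) * a^2 * (S+a)^(j+1) + (j+2)*(j+1)/2 * a^2 * (S+a)^(j+1) := by ring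
    linarith

lemma EE_upper {a : ℕ → ℝ} (ha : ∀ p, 0 ≤ a p) (P : Finset ℕ) :
    ∀ k : ℕ, (k.factorial : ℝ) * EE a k P ≤ (∑ p ∈ P, a p)^k := by
  induction P using Finset.induction_on with
  | empty =>
    intro k
    cases k with
    | zero => simp [EE]
    | succ k => rw [EE, Finset.powersetCard_eq_empty.2 (by simp)]; simp
  | insert q P hq ih =>
    intro k
    cases k with
    | zero => simp [EE]
    | succ k =>
      rw [EE_insert a k hq, Finset.sum_insert hq]
      have h1 := ih (k+1)
      have h2 := ih k
      have hS : 0 ≤ ∑ p ∈ P, a p := Finset.sum_nonneg fun p _ => ha p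
      have h3 := bern hS (ha q) k
      have h4 : ((k:ℝ)+1) * a q * ((k.factorial:ℝ) * EE a k P) ≤ ((k:ℝ)+1) * a q * (∑ p ∈ P, a p)^k := by
        have := ha q
        gcongr
      have e : ((k+1).factorial : ℝ) * (EE a (k+1) P + a q * EE a k P) =
        ((k+1).factorial : ℝ) * EE a (k+1) P + ((k:ℝ)+1) * a q * ((k.factorial:ℝ) * EE a k P) := by
        rw [Nat.factorial_succ]; push_cast; ring
      rw [e, add_comm (a q)]
      linarith

lemma EE_lower_aux {a : ℕ → ℝ} (ha : ∀ p, 0 ≤ a p) (P : Finset ℕ) :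
    ∀ k : ℕ, (∑ p ∈ P, a p)^k - (k:ℝ) * (k-1) / 2 * (∑ p ∈ P, a p ^ 2) * (∑ p ∈ P, a p)^(k-2)
      ≤ (k.factorial : ℝ) * EE a k P := by
  induction P using Finset.induction_on with
  | empty =>
    intro k
    cases k with
    | zero => simp [EE]
    | succ k => rw [EE, Finset.powersetCard_eq_empty.2 (by simp)]; simp
  | insert q P hq ih =>
    intro k
    rcases k with _ | _ | j
    · simp [EE]
    · have h := ih 1
      rw [EE_insert a 0 hq, Finset.sum_insert hq, EE_zero]
      simp at h ⊢
      linarith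
    · rw [EE_insert a (j+1) hq, Finset.sum_insert hq, Finset.sum_insert hq]
      have h1 := ih (j+2)
      have h2 := ih (j+1)
      have hS : 0 ≤ ∑ p ∈ P, a p := Finset.sum_nonneg fun p _ => ha p
      have hQ : 0 ≤ ∑ p ∈ P, a p ^ 2 := Finset.sum_nonneg fun p _ => sq_nonneg _
      have hq0 := ha q
      have h3 := bern2 hS hq0 j
      set S := ∑ p ∈ P, a p
      set Q := ∑ p ∈ P, a p ^ 2
      have h4 : S^j + j * a q * S^(j-1) ≤ (S + a q)^j := by
        cases j with
        | zero => simp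
        | succ i => 
          have := bern hS hq0 i
          push_cast
          simpa using this
      have e : ((j+1+1).factorial : ℝ) * (EE a (j+1+1) P + a q * EE a (j+1) P) =
        ((j+1+1).factorial : ℝ) * EE a (j+1+1) P + ((j:ℝ)+2) * a q * (((j+1).factorial:ℝ) * EE a (j+1) P) := by
        rw [Nat.factorial_succ (j+1)]; push_cast; ring
      rw [e, add_comm (a q)]
      have h5 := mul_le_mul_of_nonneg_left h2 (show 0 ≤ ((j:ℝ)+2) * a q by positivity)
      have h6 := mul_le_mul_of_nonneg_left h4 (show 0 ≤ ((j:ℝ)+2) * (j+1) / 2 * Q by positivity)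
      have hj1 : j + 1 - 2 = j - 1 := by omega
      have hj2 : j + 1 + 1 - 2 = j := by omega
      have hj3 : j + 2 - 2 = j := by omega
      rw [hj1] at h5
      rw [hj3] at h1
      rw [hj2]
      push_cast at h1 h5 ⊢
      have i1 : ((j:ℝ)+2) * a q * (S ^ (j+1) - (j+1) * (j+1-1)/2 * Q * S^(j-1)) =
        (j+2) * a q * S^(j+1) - ((j:ℝ)+2) * (j+1) / 2 * Q * (j * a q * S^(j-1)) := by ring
      have i2 : ((j:ℝ)+1+1) * (j+1+1-1)/2 * (a q ^2 + Q) * (S + a q)^j =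
        (j+2)*(j+1)/2 * (a q)^2 * (S+a q)^j + ((j:ℝ)+2) * (j+1) / 2 * Q * (S + a q)^j := by ring
      have i3 : ((j:ℝ)+2) * (j+2-1)/2 * Q * S^j = ((j:ℝ)+2) * (j+1) / 2 * Q * S^j := by ring
      rw [i2]
      rw [i1] at h5
      rw [i3] at h1
      rw [mul_add] at h6
      show (S + a q)^(j+2) - _ ≤ ((j+2).factorial : ℝ) * EE a (j+2) P + _
      linarith

lemma EE_lower {a : ℕ → ℝ} (ha : ∀ p, 0 ≤ a p) (P : Finset ℕ) (k : ℕ)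
    (h : (k:ℝ)^2 * ∑ p ∈ P, a p ^ 2 ≤ (∑ p ∈ P, a p)^2) :
    (∑ p ∈ P, a p)^k / 2 ≤ (k.factorial : ℝ) * EE a k P := by
  refine le_trans ?_ (EE_lower_aux ha P k)
  have hS : 0 ≤ ∑ p ∈ P, a p := Finset.sum_nonneg fun p _ => ha p
  have hQ : 0 ≤ ∑ p ∈ P, a p ^ 2 := Finset.sum_nonneg fun p _ => sq_nonneg _
  set S := ∑ p ∈ P, a p
  set Q := ∑ p ∈ P, a p ^ 2
  rcases k with _ | _ | j
  · norm_num
  · simp; linarith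
  · have : j + 1 + 1 - 2 = j := by omega
    rw [this]
    have h1 : ((j+1+1:ℕ):ℝ) * (((j+1+1:ℕ):ℝ)-1)/2 * Q ≤ S^2/2 := by
      push_cast at h ⊢
      nlinarith [mul_nonneg (show (0:ℝ) ≤ (j:ℝ)+2 by positivity) hQ]
    have h2 := mul_le_mul_of_nonneg_right h1 (pow_nonneg hS j)
    have e : S^2/2 * S^j = S^(j+1+1)/2 := by ring
    linarith

lemma decomp (a : ℕ → ℝ) {A P : Finset ℕ} (hA : A ⊆ P) (k : ℕ) (φ : Finset ℕ → Prop) [DecidablePred φ] :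
    ∑ T ∈ P.powerset.filter (fun T => (T ∩ A).card = k ∧ φ (T \ A)), ∏ p ∈ T, a p
      = EE a k A * ∑ T ∈ (P \ A).powerset.filter φ, ∏ p ∈ T, a p := by
  unfold EE
  rw [Finset.sum_mul_sum, ← Finset.sum_product']
  apply Finset.sum_nbij' (fun T => (T ∩ A, T \ A)) (fun T => T.1 ∪ T.2)
  · intro T hT
    simp only [Finset.mem_filter, Finset.mem_powerset] at hT
    simp only [Finset.mem_product, Finset.mem_powersetCard, Finset.mem_filter, Finset.mem_powerset]
    exact ⟨⟨Finset.inter_subset_right, hT.2.1⟩, Finset.sdiff_subset_sdiff hT.1 le_rfl, hT.2.2⟩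
  · intro T hT
    simp only [Finset.mem_product, Finset.mem_powersetCard, Finset.mem_filter, Finset.mem_powerset] at hT
    obtain ⟨⟨h1, h2⟩, h3, h4⟩ := hT
    have hd : Disjoint T.2 A := Finset.disjoint_of_subset_left h3 Finset.sdiff_disjoint
    have e1 : (T.1 ∪ T.2) ∩ A = T.1 := by
      rw [Finset.union_inter_distrib_right, Finset.inter_eq_left.2 h1, Finset.disjoint_iff_inter_eq_empty.1 hd, Finset.union_empty]
    have e2 : (T.1 ∪ T.2) \ A = T.2 := by
      rw [Finset.union_sdiff_distrib, Finset.sdiff_eq_empty_iff_subset.2 h1, Finset.empty_union, Finset.sdiff_eq_self_of_disjoint hd]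
    simp only [Finset.mem_filter, Finset.mem_powerset, e1, e2]
    exact ⟨Finset.union_subset (h1.trans hA) (h3.trans Finset.sdiff_subset), h2, h4⟩
  · intro T hT
    ext p; simp; tauto
  · intro T hT
    simp only [Finset.mem_product, Finset.mem_powersetCard, Finset.mem_filter, Finset.mem_powerset] at hT
    obtain ⟨⟨h1, h2⟩, h3, h4⟩ := hT
    have hd : Disjoint T.2 A := Finset.disjoint_of_subset_left h3 Finset.sdiff_disjoint
    have e1 : (T.1 ∪ T.2) ∩ A = T.1 := by
      rw [Finset.union_inter_distrib_right, Finset.inter_eq_left.2 h1, Finset.disjoint_iff_inter_eq_empty.1 hd, Finset.union_empty]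
    have e2 : (T.1 ∪ T.2) \ A = T.2 := by
      rw [Finset.union_sdiff_distrib, Finset.sdiff_eq_empty_iff_subset.2 h1, Finset.empty_union, Finset.sdiff_eq_self_of_disjoint hd]
    ext1 <;> simp [e1, e2]
  · intro T hT
    simp only
    rw [mul_comm]
    rw [← Finset.prod_union]
    · congr 1
      ext p; simp; tauto
    · rw [Finset.disjoint_left]; intro p; simp; tauto

lemma single_eq (a : ℕ → ℝ) {A P : Finset ℕ} (hA : A ⊆ P) (k s : ℕ) :
    ∑ T ∈ P.powerset.filter (fun T => T.card = k + s ∧ (T ∩ A).card = k), ∏ p ∈ T, a p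
      = EE a k A * EE a s (P \ A) := by
  have := decomp a hA k (fun T => T.card = s)
  have e : (P \ A).powerset.filter (fun T => T.card = s) = (P \ A).powersetCard s := by
    ext T; simp [Finset.mem_powersetCard]
  rw [e] at this
  rw [show EE a s (P \ A) = ∑ T ∈ (P \ A).powersetCard s, ∏ p ∈ T, a p from rfl, ← this]
  apply Finset.sum_congr _ (fun _ _ => rfl)
  ext T
  simp only [Finset.mem_filter]
  have := Finset.card_inter_add_card_sdiff T A
  constructor
  · rintro ⟨h1, h2, h3⟩; exact ⟨h1, h3, by omega⟩
  · rintro ⟨h1, h2, h3⟩; exact ⟨h1, by omega, h2⟩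

lemma pair_eq (a : ℕ → ℝ) {A B P : Finset ℕ} (hAB : A ⊆ B) (hB : B ⊆ P) (k j s : ℕ) :
    ∑ T ∈ P.powerset.filter (fun T => T.card = k + j + s ∧ (T ∩ A).card = k ∧ (T ∩ B).card = k + j), ∏ p ∈ T, a p
      = EE a k A * (EE a j (B \ A) * EE a s (P \ B)) := by
  have h1 := decomp a (hAB.trans hB) k (fun T => T.card = j + s ∧ (T ∩ (B \ A)).card = j)
  have h2 := single_eq a (A := B \ A) (P := P \ A) (Finset.sdiff_subset_sdiff hB le_rfl) j s
  have e : (P \ A) \ (B \ A) = P \ B := by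
    ext p; simp; 
    constructor
    · rintro ⟨⟨h1, h2⟩, h3⟩; exact ⟨h1, fun h => h2 (h3 h)⟩
    · rintro ⟨h1, h2⟩; exact ⟨⟨h1, fun h => h2 (hAB h)⟩, fun h => absurd h h2⟩
  rw [e] at h2
  rw [← h2, ← h1]
  apply Finset.sum_congr _ (fun _ _ => rfl)
  ext T
  simp only [Finset.mem_filter]
  have g1 := Finset.card_inter_add_card_sdiff T A
  have g2 : ((T \ A) ∩ (B \ A)).card + (T ∩ A).card = (T ∩ B).card := by
    rw [← Finset.card_union_of_disjoint]
    · congr 1; ext p; simp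
      constructor
      · rintro (⟨⟨h1, h2⟩, h3, h4⟩ | ⟨h1, h2⟩)
        · exact ⟨h1, h3⟩
        · exact ⟨h1, hAB h2⟩
      · rintro ⟨h1, h2⟩; by_cases h : p ∈ A <;> simp [*]
    · rw [Finset.disjoint_left]; intro p; simp; tauto
  constructor
  · rintro ⟨h1, h2, h3, h4⟩; exact ⟨h1, h3, by omega, by omega⟩
  · rintro ⟨h1, h2, h3, h4⟩; exact ⟨h1, by omega, h2, by omega⟩

lemma bonf {ι : Type*} (F : Finset ι) (w : ι → ℝ) (hw : ∀ T ∈ F, 0 ≤ w T) (M : ℕ) (Q : ℕ → ι → Prop) [∀ i, DecidablePred (Q i)] :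
    ∑ i ∈ Finset.range M, ∑ T ∈ F.filter (Q i), w T
      - ∑ i ∈ Finset.range M, ∑ i' ∈ (Finset.range M).filter (fun i' => i < i'),
          ∑ T ∈ F.filter (fun T => Q i T ∧ Q i' T), w T
      ≤ ∑ T ∈ F.filter (fun T => ∃ i < M, Q i T), w T := by
  simp only [Finset.sum_filter]
  have e1 : ∑ i ∈ Finset.range M, ∑ T ∈ F, (if Q i T then w T else 0) =
    ∑ T ∈ F, ∑ i ∈ Finset.range M, (if Q i T then w T else 0) := Finset.sum_comm
  have e2 : ∑ i ∈ Finset.range M, ∑ i' ∈ Finset.range M, (if i < i' then ∑ T ∈ F, (if Q i T ∧ Q i' T then w T else 0) else 0) =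
    ∑ T ∈ F, ∑ i ∈ Finset.range M, ∑ i' ∈ Finset.range M, (if i < i' then (if Q i T ∧ Q i' T then w T else 0) else 0) := by
    rw [Finset.sum_comm' (t' := Finset.range M) (s' := fun _ => F) (by simp)]
    apply Finset.sum_congr rfl
    intro i _
    rw [Finset.sum_comm]
    apply Finset.sum_congr rfl
    intro i' _
    split_ifs <;> simp
  rw [e1, e2, ← Finset.sum_sub_distrib]
  apply Finset.sum_le_sum
  intro T hT
  have hw0 := hw T hT
  rw [← Finset.sum_sub_distrib]
  split_ifs with h
  · set G := (Finset.range M).filter (fun i => Q i T)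
    have hG : G.Nonempty := by
      obtain ⟨i, hi, hQ⟩ := h
      exact ⟨i, by simp [G, hi, hQ]⟩
    set i0 := G.max' hG
    have hi0 : i0 ∈ G := G.max'_mem hG
    have hi0' := Finset.mem_filter.1 hi0
    rw [← Finset.add_sum_erase _ _ hi0'.1]
    have A1 : (if Q i0 T then w T else 0) - ∑ i' ∈ Finset.range M, (if i0 < i' then (if Q i0 T ∧ Q i' T then w T else 0) else 0) ≤ w T := by
      have : 0 ≤ ∑ i' ∈ Finset.range M, (if i0 < i' then (if Q i0 T ∧ Q i' T then w T else 0) else 0) :=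
        Finset.sum_nonneg fun i _ => by split_ifs <;> simp [hw0]
      rw [if_pos hi0'.2]
      linarith
    have A2 : ∑ i ∈ (Finset.range M).erase i0, ((if Q i T then w T else 0) - ∑ i' ∈ Finset.range M, (if i < i' then (if Q i T ∧ Q i' T then w T else 0) else 0)) ≤ 0 := by
      apply Finset.sum_nonpos
      intro i hi
      obtain ⟨hne, hi⟩ := Finset.mem_erase.1 hi
      by_cases hQ : Q i T
      · have hlt : i < i0 := lt_of_le_of_ne (G.le_max' i (by simp only [G, Finset.mem_filter]; exact ⟨hi, hQ⟩)) hne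
        have := Finset.single_le_sum (f := fun i' => (if i < i' then (if Q i T ∧ Q i' T then w T else 0) else 0))
          (s := Finset.range M) (fun i _ => by split_ifs <;> simp [hw0]) hi0'.1
        rw [if_pos hlt, if_pos ⟨hQ, hi0'.2⟩] at this
        rw [if_pos hQ]
        linarith
      · simp [hQ]
    linarith
  · apply Finset.sum_nonpos
    intro i hi
    have : ¬ Q i T := fun hQ => h ⟨i, Finset.mem_range.1 hi, hQ⟩
    simp [this]


lemma EE_pois_low {x t D R : ℝ} {A : Finset ℕ} {k : ℕ} (hA : A ⊆ PP x) (ht : 0 < t) (hR : 0 < R)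
    (hk : 1 ≤ k) (h3 : (k:ℝ) ≤ 3 * ∑ p ∈ A, 1 / (p:ℝ))
    (hD : ((k:ℝ) - t * ∑ p ∈ A, 1 / (p:ℝ))^2 ≤ D * (t * ∑ p ∈ A, 1 / (p:ℝ)))
    (h4 : (k:ℝ) ≤ 4 * R^2) :
    Real.exp (t * ∑ p ∈ A, 1 / (p:ℝ) - D) / (t^k * (4 * Real.exp 1 * R)) ≤ EE (fun p => 1 / (p:ℝ)) k A := by
  have hk0 : (0:ℝ) < k := by exact_mod_cast hk
  have hsq := PP_sq hA
  have hE := EE_lower (a := fun p => 1 / (p:ℝ)) (fun p => by positivity) A k (by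
    have : 0 ≤ ∑ p ∈ A, (1 / (p:ℝ))^2 := Finset.sum_nonneg fun p _ => by positivity
    nlinarith)
  set S := ∑ p ∈ A, 1 / (p:ℝ)
  have hS : 0 < S := by linarith
  have hp := pois_low (l := t * S) (D := D) (by positivity) hk hD
  have hs : Real.sqrt k ≤ 2 * R := by
    rw [Real.sqrt_le_left (by positivity)]; nlinarith
  have hf : (0:ℝ) < k.factorial := by exact_mod_cast k.factorial_pos
  have ht' : 0 < t^k := by positivity
  rw [div_le_iff₀ (by positivity)]
  have h5 : Real.exp (t * S - D) * k.factorial ≤ Real.exp 1 * (2 * R) * (t * S)^k := by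
    refine hp.trans ?_
    gcongr
  have h6 : Real.exp 1 * (2 * R) * (t * S)^k ≤ Real.exp 1 * (2 * R) * (t^k * (2 * (k.factorial * EE (fun p => 1 / (p:ℝ)) k A))) := by
    rw [mul_pow]
    gcongr
    linarith
  have h7 : Real.exp (t * S - D) * k.factorial ≤ (EE (fun p => 1 / (p:ℝ)) k A * (t^k * (4 * Real.exp 1 * R))) * k.factorial := by
    refine (h5.trans h6).trans (le_of_eq ?_)
    ring
  exact le_of_mul_le_mul_right h7 hf

lemma EE_exp_up {t : ℝ} {A : Finset ℕ} {k : ℕ} (ht : 0 < t) :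
    EE (fun p => 1 / (p:ℝ)) k A ≤ Real.exp (t * ∑ p ∈ A, 1 / (p:ℝ)) / t^k := by
  have hE := EE_upper (a := fun p => 1 / (p:ℝ)) (fun p => by positivity) A k
  have hS : 0 ≤ ∑ p ∈ A, 1 / (p:ℝ) := Finset.sum_nonneg fun p _ => by positivity
  set S := ∑ p ∈ A, 1 / (p:ℝ)
  have hf : (0:ℝ) < k.factorial := by exact_mod_cast k.factorial_pos
  have h1 := Real.pow_div_factorial_le_exp (t * S) (by positivity) k
  rw [div_le_iff₀ hf, mul_pow] at h1
  rw [le_div_iff₀ (by positivity)]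
  have h2 := mul_le_mul_of_nonneg_left hE (show 0 ≤ t^k by positivity)
  refine le_of_mul_le_mul_right ?_ hf
  linarith

lemma EE_pois_up {t q : ℝ} {A : Finset ℕ} {k : ℕ} (ht : 0 < t) (hq : 0 < q) (hk : 1 ≤ k)
    (hqk : q ^ 2 ≤ k) :
    EE (fun p => 1 / (p:ℝ)) k A ≤ Real.exp (t * ∑ p ∈ A, 1 / (p:ℝ)) / (t^k * q) := by
  have hE := EE_upper (a := fun p => 1 / (p:ℝ)) (fun p => by positivity) A k
  have hE0 := EE_nonneg (a := fun p => 1 / (p:ℝ)) (fun p => by positivity) k A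
  have hS : 0 ≤ ∑ p ∈ A, 1 / (p:ℝ) := Finset.sum_nonneg fun p _ => by positivity
  set S := ∑ p ∈ A, 1 / (p:ℝ)
  have hf : (0:ℝ) < k.factorial := by exact_mod_cast k.factorial_pos
  have h1 := pois_up (l := t * S) (by positivity) hk
  have hs : q ≤ Real.sqrt k := Real.le_sqrt_of_sq_le hqk
  rw [le_div_iff₀ (by positivity)]
  refine le_of_mul_le_mul_right ?_ hf
  calc EE (fun p => 1 / (p:ℝ)) k A * (t^k * q) * k.factorial
      = t^k * (k.factorial * EE (fun p => 1 / (p:ℝ)) k A) * q := by ring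
    _ ≤ t^k * S^k * Real.sqrt k := by gcongr
    _ = (t * S)^k * Real.sqrt k := by rw [mul_pow]
    _ ≤ _ := by rw [mul_comm (Real.exp _)]; exact h1

lemma arith1 {ε C0 R a l S Sx u m r : ℝ} (hε : 0 < ε) (hε1 : ε < 1/2) (hC0 : 0 < C0)
    (hR1 : 100 * (C0 + 1) ≤ R) (hR2 : 100 ≤ ε * R) (ha1 : ε * R^2 ≤ a) (ha2 : a ≤ (1-ε) * R^2)
    (hr : r = R^2 + a) (hl : l = m * Real.log 2) (hla : |l - a| ≤ R)
    (hu : |u - (Real.log 4 - 1) / Real.log 2 * a| ≤ R) (hS : |S - l| ≤ C0) (hSx : |Sx - R^2| ≤ C0) :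
    ε / 4 * R^2 ≤ m + u ∧ ε / 4 * R^2 ≤ r - (m + u) ∧ m + u ≤ 4 * R^2 ∧ r - (m+u) ≤ 4 * R^2 ∧
    m + u ≤ 3 * S ∧ r - (m+u) ≤ 3 * (Sx - S) ∧ (m + u - 2 * S)^2 ≤ 32 / ε * (2 * S) ∧
    (r - (m+u) - 1 * (Sx - S))^2 ≤ 32/ε * (1 * (Sx - S)) ∧ l ≤ R^2 ∧ 100 ≤ l ∧ 1 ≤ ε/4 * R^2 := by
  have l2 : 0 < Real.log 2 := Real.log_pos (by norm_num)
  have l2a := Real.log_two_gt_d9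
  have l2b := Real.log_two_lt_d9
  have l4 : Real.log 4 = 2 * Real.log 2 := by
    rw [show (4:ℝ) = 2^2 by norm_num, Real.log_pow]; push_cast; ring
  set c := (Real.log 4 - 1) / Real.log 2 with hc
  have hc0 : 0 ≤ c := by rw [hc, l4]; apply div_nonneg <;> linarith
  have hc1 : c ≤ 1 := by rw [hc, l4, div_le_one l2]; linarith
  have hm : m = (2 - c) * l := by
    rw [hc, l4, hl]; field_simp; ring
  obtain ⟨hl1, hl2⟩ := abs_le.1 hla
  obtain ⟨hu1, hu2⟩ := abs_le.1 hu
  obtain ⟨hS1, hS2⟩ := abs_le.1 hS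
  obtain ⟨hx1, hx2⟩ := abs_le.1 hSx
  have hR0 : 100 ≤ R := by linarith
  have e : m + u - 2 * l = (u - c * a) + c * (a - l) := by rw [hm]; ring
  have f1 : c * (a - l) ≤ R := by nlinarith
  have f2 : -R ≤ c * (a - l) := by nlinarith
  set W := ε * R^2 with hW
  have hW1 : 100 * R ≤ W := by rw [hW]; nlinarith
  have hW2 : 2 * W ≤ R^2 := by rw [hW]; nlinarith
  have ha2' : a ≤ R^2 - W := by rw [hW]; linarith
  have b1 : m + u - 2 * S ≤ 3 * R := by linarith
  have b2 : -(3 * R) ≤ m + u - 2 * S := by linarith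
  have b3 : r - (m + u) - (Sx - S) ≤ 4 * R := by linarith
  have b4 : -(4 * R) ≤ r - (m + u) - (Sx - S) := by linarith
  have hSlow : W / 2 ≤ S := by linarith
  have hSxlow : W / 2 ≤ Sx - S := by linarith
  have hW4 : ε / 4 * R^2 = W / 4 := by rw [hW]; ring
  have g : ∀ z, W / 2 ≤ z → 16 * R^2 ≤ 32 / ε * z := by
    intro z hz
    have : 32 / ε * (W/2) ≤ 32/ε * z := by gcongr
    have e : 32 / ε * (W/2) = 16 * R^2 := by rw [hW]; field_simp; ring
    linarith
  rw [hW4]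
  refine ⟨by linarith, by linarith, by linarith, by linarith, by linarith, by linarith, ?_, ?_, by linarith, by linarith, by linarith⟩
  · have := g (2 * S) (by linarith)
    have h9 := sq_le_sq' b2 b1
    have h10 : (3 * R)^2 = 9 * R^2 := by ring
    linarith [sq_nonneg R]
  · have := g (Sx - S) (by linarith)
    have h9 := sq_le_sq' b4 b3
    have h10 : (4 * R)^2 = 16 * R^2 := by ring
    rw [one_mul]
    linarith [sq_nonneg R]

noncomputable def yy (m : ℕ) : ℝ := Real.exp ((2:ℝ)^m)

lemma loglog_yy (m : ℕ) : Real.log (Real.log (yy m)) = m * Real.log 2 := by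
  rw [yy, Real.log_exp, Real.log_pow]

lemma LLog2_yy {m : ℕ} (hm : 2 ≤ m) : LLog2 (yy m) = m * Real.log 2 := by
  have h1 : (1:ℝ) ≤ 2^m := one_le_pow₀ (by norm_num)
  have h2 : (2:ℝ) ≤ m := by exact_mod_cast hm
  have := Real.log_two_gt_d9
  rw [LLog2, LLog, LLog, yy, Real.log_exp, max_eq_right h1, Real.log_pow, max_eq_right]
  nlinarith

lemma yy_mono {m n : ℕ} (h : m ≤ n) : yy m ≤ yy n := by
  unfold yy
  apply Real.exp_le_exp.2
  exact pow_le_pow_right₀ (by norm_num) h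

lemma yy_ge {m : ℕ} (hm : 2 ≤ m) : 16 ≤ yy m := by
  have h := yy_mono hm
  have : (16:ℝ) ≤ yy 2 := by
    unfold yy
    have h1 := Real.exp_one_gt_d9
    have : Real.exp ((2:ℝ)^2) = (Real.exp 1)^4 := by
      rw [← Real.exp_nat_mul]; norm_num
    rw [this]
    have : (2:ℝ)^4 ≤ (Real.exp 1)^4 := by gcongr; linarith
    linarith
  linarith

lemma two_pow_eq {k m : ℕ} {u : ℤ} (hk : (k:ℤ) = m + u) :
    (2:ℝ)^k = Real.exp (m * Real.log 2) * (2:ℝ)^u := by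
  rw [← zpow_natCast, hk, zpow_add₀ (by norm_num), Real.exp_nat_mul, Real.exp_log (by norm_num),
    zpow_natCast]

lemma single_low {x C0 D R : ℝ} {A : Finset ℕ} {k s m : ℕ} {u : ℤ} (hA : A ⊆ PP x)
    (hR : 0 < R) (hk : (k:ℤ) = m + u) (hk1 : 1 ≤ k) (hs1 : 1 ≤ s)
    (hS : |∑ p ∈ A, 1 / (p:ℝ) - m * Real.log 2| ≤ C0)
    (hSx : |∑ p ∈ PP x, 1 / (p:ℝ) - R^2| ≤ C0)
    (k4 : (k:ℝ) ≤ 4 * R^2) (s4 : (s:ℝ) ≤ 4 * R^2)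
    (k3 : (k:ℝ) ≤ 3 * ∑ p ∈ A, 1 / (p:ℝ))
    (s3 : (s:ℝ) ≤ 3 * (∑ p ∈ PP x, 1 / (p:ℝ) - ∑ p ∈ A, 1 / (p:ℝ)))
    (kD : ((k:ℝ) - 2 * ∑ p ∈ A, 1 / (p:ℝ))^2 ≤ D * (2 * ∑ p ∈ A, 1 / (p:ℝ)))
    (sD : ((s:ℝ) - 1 * (∑ p ∈ PP x, 1 / (p:ℝ) - ∑ p ∈ A, 1 / (p:ℝ)))^2
      ≤ D * (1 * (∑ p ∈ PP x, 1 / (p:ℝ) - ∑ p ∈ A, 1 / (p:ℝ)))) :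
    Real.exp (-2 * C0 - 2 * D - 2) / 16 * (((2:ℝ)^u)⁻¹ * Real.exp (R^2) / R^2)
      ≤ EE (fun p => 1 / (p:ℝ)) k A * EE (fun p => 1 / (p:ℝ)) s (PP x \ A) := by
  have hsd : ∑ p ∈ PP x \ A, 1 / (p:ℝ) = ∑ p ∈ PP x, 1 / (p:ℝ) - ∑ p ∈ A, 1 / (p:ℝ) := by
    rw [← Finset.sum_sdiff hA]; ring
  rw [← hsd] at s3 sD
  have e1 := EE_pois_low hA (t := 2) (by norm_num) hR hk1 k3 kD k4
  have e2 := EE_pois_low (Finset.sdiff_subset (s := PP x) (t := A)) (t := 1) (by norm_num) hR hs1 s3 sD s4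
  rw [hsd] at e2
  rw [two_pow_eq hk] at e1
  set S := ∑ p ∈ A, 1 / (p:ℝ)
  set Sx := ∑ p ∈ PP x, 1 / (p:ℝ)
  have hV : (0:ℝ) < (2:ℝ)^u := by positivity
  refine le_trans ?_ (mul_le_mul e1 e2 (by positivity) (EE_nonneg (fun p => by positivity) _ _))
  obtain ⟨a1, a2⟩ := abs_le.1 hS
  obtain ⟨b1, b2⟩ := abs_le.1 hSx
  have key : Real.exp (-2 * C0 - 2 * D - 2) * Real.exp (R^2) * Real.exp (m * Real.log 2) * (Real.exp 1 * Real.exp 1)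
     ≤ Real.exp (2 * S - D) * Real.exp (1 * (Sx - S) - D) := by
    simp only [← Real.exp_add]
    apply Real.exp_le_exp.2
    linarith
  have hE : 0 < Real.exp (m * Real.log 2) := Real.exp_pos _
  have hE1 : 0 < Real.exp 1 := Real.exp_pos _
  set P := Real.exp (-2 * C0 - 2 * D - 2)
  set E := Real.exp (m * Real.log 2)
  set e := Real.exp 1
  set G := Real.exp (R^2)
  set V := (2:ℝ)^u
  calc P / 16 * (V⁻¹ * G / R^2) = (P * G * E * (e * e)) / (E * V * (4 * e * R) * (4 * e * R)) := by
        field_simp; ring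
    _ ≤ (Real.exp (2 * S - D) * Real.exp (1 * (Sx - S) - D)) / (E * V * (4 * e * R) * (4 * e * R)) := by
        gcongr
    _ = _ := by rw [one_pow]; field_simp

lemma pair_up {x C0 R ε : ℝ} {A B : Finset ℕ} {k j s m : ℕ} {u : ℤ} (hε : 0 < ε) (hAB : A ⊆ B) (hB : B ⊆ PP x)
    (hR : 0 < R) (hk : (k:ℤ) = m + u) (hk1 : 1 ≤ k) (hs1 : 1 ≤ s)
    (hS : |∑ p ∈ A, 1 / (p:ℝ) - m * Real.log 2| ≤ C0)
    (hS' : |∑ p ∈ B, 1 / (p:ℝ) - (m + j) * Real.log 2| ≤ C0)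
    (hSx : |∑ p ∈ PP x, 1 / (p:ℝ) - R^2| ≤ C0)
    (k4 : ε / 4 * R^2 ≤ k) (s4 : ε / 4 * R^2 ≤ s) :
    EE (fun p => 1 / (p:ℝ)) k A * (EE (fun p => 1 / (p:ℝ)) j (B \ A) * EE (fun p => 1 / (p:ℝ)) s (PP x \ B))
     ≤ (((2:ℝ)^u)⁻¹ * Real.exp (R^2) / R^2) * (4 / ε * Real.exp (2 * C0)) *
        (Real.exp (Real.log 2 / 2) / (3/2))^j := by
  have hsd : ∑ p ∈ PP x \ B, 1 / (p:ℝ) = ∑ p ∈ PP x, 1 / (p:ℝ) - ∑ p ∈ B, 1 / (p:ℝ) := by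
    rw [← Finset.sum_sdiff hB]; ring
  have hsd2 : ∑ p ∈ B \ A, 1 / (p:ℝ) = ∑ p ∈ B, 1 / (p:ℝ) - ∑ p ∈ A, 1 / (p:ℝ) := by
    rw [← Finset.sum_sdiff hAB]; ring
  set q := Real.sqrt (ε / 4 * R^2) with hq
  have hq0 : 0 < q := Real.sqrt_pos.2 (by positivity)
  have hq2 : q^2 = ε / 4 * R^2 := Real.sq_sqrt (by positivity)
  have e1 := EE_pois_up (A := A) (t := 2) (by norm_num) hq0 hk1 (by rw [hq2]; exact k4)
  have e2 := EE_exp_up (A := B \ A) (t := 3/2) (k := j) (by norm_num)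
  have e3 := EE_pois_up (A := PP x \ B) (t := 1) (by norm_num) hq0 hs1 (by rw [hq2]; exact s4)
  rw [hsd] at e3
  rw [hsd2] at e2
  rw [two_pow_eq hk] at e1
  set S := ∑ p ∈ A, 1 / (p:ℝ)
  set SB := ∑ p ∈ B, 1 / (p:ℝ)
  set Sx := ∑ p ∈ PP x, 1 / (p:ℝ)
  have hV : (0:ℝ) < (2:ℝ)^u := by positivity
  have n : ∀ k A, 0 ≤ EE (fun p => 1 / (p:ℝ)) k A := fun k A => EE_nonneg (fun p => by positivity) _ _
  refine le_trans (mul_le_mul e1 (mul_le_mul e2 e3 (n _ _) (by positivity)) (mul_nonneg (n _ _) (n _ _)) (by positivity)) ?_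
  obtain ⟨a1, a2⟩ := abs_le.1 hS
  obtain ⟨b1, b2⟩ := abs_le.1 hSx
  obtain ⟨c1, c2⟩ := abs_le.1 hS'
  have key : Real.exp (2 * S) * Real.exp (3/2 * (SB - S)) * Real.exp (1 * (Sx - SB)) ≤
     Real.exp (R^2) * Real.exp (2 * C0) * Real.exp (m * Real.log 2) * Real.exp (Real.log 2 / 2) ^ j := by
    rw [← Real.exp_nat_mul]
    simp only [← Real.exp_add]
    apply Real.exp_le_exp.2
    linarith
  have hE : 0 < Real.exp (m * Real.log 2) := Real.exp_pos _
  have hE1 : 0 < Real.exp (Real.log 2 / 2) := Real.exp_pos _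
  rw [div_pow (Real.exp _)]
  set E := Real.exp (m * Real.log 2)
  set e := Real.exp (Real.log 2 / 2)
  set G := Real.exp (R^2)
  set V := (2:ℝ)^u
  have h32 : (0:ℝ) < (3/2:ℝ)^j := by positivity
  set w := (3/2:ℝ)^j
  rw [one_pow]
  calc _ = (Real.exp (2 * S) * Real.exp (3/2 * (SB - S)) * Real.exp (1 * (Sx - SB))) / (E * V * w * q^2) := by
        field_simp
    _ ≤ (G * Real.exp (2 * C0) * E * e ^ j) / (E * V * w * q^2) := by gcongr
    _ = _ := by rw [hq2]; field_simp

lemma rho_lt : Real.exp (Real.log 2 / 2) / (3/2) < 1 := by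
  have h : Real.exp (Real.log 2 / 2) ^ 2 = 2 := by
    rw [← Real.exp_nat_mul]; push_cast
    rw [mul_div_cancel₀ _ (by norm_num), Real.exp_log (by norm_num)]
  rw [div_lt_one (by norm_num)]
  by_contra hh
  push Not at hh
  nlinarith

lemma geo_pair {ρ : ℝ} (h0 : 0 ≤ ρ) (K M : ℕ) (hK : ρ ^ K ≤ 1/2) :
    ∑ i ∈ Finset.range M, ∑ i' ∈ (Finset.range M).filter (fun i' => i < i'), ρ ^ (K * (i' - i))
      ≤ M * (2 * ρ ^ K) := by
  have : ∀ i ∈ Finset.range M, ∑ i' ∈ (Finset.range M).filter (fun i' => i < i'), ρ ^ (K * (i' - i))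
      ≤ 2 * ρ ^ K := by
    intro i _
    set b := ρ ^ K
    have hb : 0 ≤ b := by positivity
    have h1 : ∑ i' ∈ (Finset.range M).filter (fun i' => i < i'), ρ ^ (K * (i' - i))
       ≤ ∑ d ∈ Finset.range M, b * b ^ d := by
      have : ∑ i' ∈ (Finset.range M).filter (fun i' => i < i'), ρ ^ (K * (i' - i))
         = ∑ d ∈ ((Finset.range M).filter (fun i' => i < i')).image (fun i' => i' - i - 1), b * b ^ d := by
        rw [Finset.sum_image]
        · apply Finset.sum_congr rfl
          intro i' hi'
          simp only [Finset.mem_filter] at hi'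
          rw [← pow_succ', pow_mul]
          congr 1; omega
        · intro p hp q hq hpq
          simp only [Finset.coe_filter, Set.mem_ofPred_eq] at hp hq hpq
          omega
      rw [this]
      apply Finset.sum_le_sum_of_subset_of_nonneg
      · intro d hd
        simp only [Finset.mem_image, Finset.mem_filter, Finset.mem_range] at hd ⊢
        omega
      · intros; positivity
    refine h1.trans ?_
    rw [← Finset.mul_sum]
    have h2 : ∑ d ∈ Finset.range M, b ^ d ≤ 2 := by
      calc _ ≤ ∑ d ∈ Finset.range M, (1/2:ℝ)^d := by gcongr
        _ ≤ 2 := sum_geometric_two_le M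
    nlinarith
  refine (Finset.sum_le_sum this).trans ?_
  simp

lemma facts {ε C0 R a x : ℝ} {r m : ℕ} {u : ℤ} (hε : 0 < ε) (hε1 : ε < 1/2) (hC0 : 0 < C0)
    (hM : ∀ y : ℝ, 16 ≤ y → |∑ p ∈ PP y, 1 / (p:ℝ) - Real.log (Real.log y)| ≤ C0)
    (hx : 16 ≤ x) (hxR : Real.log (Real.log x) = R^2)
    (hR1 : 100 * (C0 + 1) ≤ R) (hR2 : 100 ≤ ε * R) (ha1 : ε * R^2 ≤ a) (ha2 : a ≤ (1-ε) * R^2)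
    (hr : (r:ℝ) = R^2 + a) (hla : |m * Real.log 2 - a| ≤ R)
    (hu : |(u:ℝ) - (Real.log 4 - 1) / Real.log 2 * a| ≤ R) :
    ∃ k s : ℕ, (k:ℤ) = m + u ∧ k + s = r ∧ 1 ≤ k ∧ 1 ≤ s ∧ 2 ≤ m ∧ PP (yy m) ⊆ PP x ∧
      |∑ p ∈ PP (yy m), 1 / (p:ℝ) - m * Real.log 2| ≤ C0 ∧
      ε / 4 * R^2 ≤ k ∧ ε / 4 * R^2 ≤ s ∧
      Real.exp (-2 * C0 - 2 * (32 / ε) - 2) / 16 * (((2:ℝ)^u)⁻¹ * Real.exp (R^2) / R^2)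
      ≤ EE (fun p => 1 / (p:ℝ)) k (PP (yy m)) * EE (fun p => 1 / (p:ℝ)) s (PP x \ PP (yy m)) := by
  have hR0 : 100 ≤ R := by linarith
  have hm2 : 2 ≤ m := by
    by_contra hh
    have : m ≤ 1 := by omega
    have h1 : (m:ℝ) ≤ 1 := by exact_mod_cast this
    have := Real.log_two_lt_d9
    have := Real.log_two_gt_d9
    have h2 := (abs_le.1 hla).1
    have : 100 * R ≤ a := by nlinarith
    nlinarith
  have hS := hM (yy m) (yy_ge hm2)
  rw [loglog_yy] at hS
  have hSx := hM x hx
  rw [hxR] at hSx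
  obtain ⟨f1, f2, f3, f4, f5, f6, f7, f8, f9, f10, f11⟩ := arith1 hε hε1 hC0 hR1 hR2 ha1 ha2 hr rfl hla hu hS hSx
  have hk0 : (0:ℝ) ≤ ((m + u : ℤ) : ℝ) := by push_cast; linarith
  have hk0' : (0:ℤ) ≤ m + u := by exact_mod_cast hk0
  obtain ⟨k, hk⟩ := Int.eq_ofNat_of_zero_le hk0'
  have hkr : (m:ℝ) + u = k := by
    have : ((m + u : ℤ) : ℝ) = ((k:ℤ):ℝ) := by rw [hk]
    push_cast at this; exact this
  rw [hkr] at f1 f2 f3 f4 f5 f6 f7 f8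
  have hkr' : k ≤ r := by
    have : (k:ℝ) ≤ r := by linarith
    exact_mod_cast this
  obtain ⟨s, rfl⟩ := Nat.exists_eq_add_of_le hkr'
  have hs : ((k + s : ℕ) : ℝ) - k = s := by push_cast; ring
  rw [hs] at f2 f4 f6 f8
  have hk1 : 1 ≤ k := by
    have : (1:ℝ) ≤ k := by linarith
    exact_mod_cast this
  have hs1 : 1 ≤ s := by
    have : (1:ℝ) ≤ s := by linarith
    exact_mod_cast this
  have hyx : yy m ≤ x := by
    rw [← hxR, ← loglog_yy] at f9
    have hy := yy_ge hm2
    have l1 : 0 < Real.log (yy m) := Real.log_pos (by linarith)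
    have l2 : 0 < Real.log x := Real.log_pos (by linarith)
    rwa [Real.log_le_log_iff l1 l2, Real.log_le_log_iff (by linarith) (by linarith)] at f9
  have hsub := PP_mono hyx
  exact ⟨k, s, hk.symm, rfl, hk1, hs1, hm2, hsub, hS, f1, f2,
    single_low hsub (by linarith) hk.symm hk1 hs1 hS hSx f3 f4 f5 f6 f7 f8⟩

lemma core_s13 {ε C0 R a x : ℝ} {r K : ℕ} {u : ℤ} (hε : 0 < ε) (hε1 : ε < 1/2) (hC0 : 0 < C0)
    (hM : ∀ y : ℝ, 16 ≤ y → |∑ p ∈ PP y, 1 / (p:ℝ) - Real.log (Real.log y)| ≤ C0)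
    (hx : 16 ≤ x) (hxR : Real.log (Real.log x) = R^2)
    (hR1 : 100 * (C0 + 1) ≤ R) (hR2 : 100 ≤ ε * R) (ha1 : ε * R^2 ≤ a) (ha2 : a ≤ (1-ε) * R^2)
    (hr : (r:ℝ) = R^2 + a)
    (hu : |(u:ℝ) - (Real.log 4 - 1) / Real.log 2 * a| ≤ R)
    (hK1 : 1 ≤ K) (hKR : 2 * (K:ℝ) ≤ R) 
    (hK2 : (Real.exp (Real.log 2 / 2) / (3/2))^K ≤ 1/2)
    (hK3 : (Real.exp (Real.log 2 / 2) / (3/2))^K * (4 * (4 / ε * Real.exp (2 * C0))) ≤ Real.exp (-2 * C0 - 2 * (32 / ε) - 2) / 16) :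
    ∃ F : Finset (Finset ℕ), 
      (∀ T ∈ F, T ⊆ PP x ∧ T.card = r ∧ ∃ m : ℕ, 2 ≤ m ∧ |m * Real.log 2 - a| ≤ R ∧ ((T ∩ PP (yy m)).card : ℤ) = m + u) ∧
      Real.exp (-2 * C0 - 2 * (32 / ε) - 2) / 16 / (4 * K) * (((2:ℝ)^u)⁻¹ * Real.exp (R^2) / R) ≤ ∑ T ∈ F, ∏ p ∈ T, 1 / (p:ℝ) := by
  have hR0 : 100 ≤ R := by linarith
  have l2 : 0 < Real.log 2 := Real.log_pos (by norm_num)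
  have l2b := Real.log_two_lt_d9
  have hKp : (0:ℝ) < K := by exact_mod_cast hK1
  have ha0 : 0 ≤ a := le_trans (by positivity) ha1
  set M := ⌊R / K⌋₊ with hMdef
  have hM1 : (M:ℝ) * K ≤ R := by
    have := Nat.floor_le (show 0 ≤ R / K by positivity)
    rwa [le_div_iff₀ hKp] at this
  have hM2 : R / (2 * K) ≤ M := by
    have h1 := Nat.lt_floor_add_one (R / K)
    have h2 : 2 ≤ R / K := by rw [le_div_iff₀ hKp]; exact hKR
    have h3 : R / (2 * K) = R / K / 2 := by field_simp
    rw [h3]; linarith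
  set mm : ℕ → ℕ := fun i => ⌈a / Real.log 2⌉₊ + K * i with hmm
  have hmla : ∀ i, i < M → |(mm i : ℝ) * Real.log 2 - a| ≤ R := by
    intro i hi
    have c1 := Nat.le_ceil (a / Real.log 2)
    have c2 := Nat.ceil_lt_add_one (show 0 ≤ a / Real.log 2 by positivity)
    set z := ⌈a / Real.log 2⌉₊
    have hi' : (i:ℝ) + 1 ≤ M := by exact_mod_cast hi
    have e : (mm i : ℝ) * Real.log 2 - a = ((z:ℝ) - a / Real.log 2) * Real.log 2 + K * i * Real.log 2 := by
      simp only [hmm]; push_cast; field_simp; ring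
    have h1 : (K:ℝ) * (i + 1) ≤ R := by nlinarith
    have hK1' : (1:ℝ) ≤ K := by exact_mod_cast hK1
    have h2 : ((z:ℝ) - a / Real.log 2) + K * i ≤ R := by nlinarith
    have h3 : 0 ≤ ((z:ℝ) - a / Real.log 2) + K * i := by
      have : (0:ℝ) ≤ K * i := by positivity
      linarith
    rw [e, ← add_mul, abs_of_nonneg (by positivity)]
    nlinarith
  have hf : ∀ i, ∃ k s : ℕ, i < M → ((k:ℤ) = mm i + u ∧ k + s = r ∧ 1 ≤ k ∧ 1 ≤ s ∧ 2 ≤ mm i ∧ PP (yy (mm i)) ⊆ PP x ∧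
      |∑ p ∈ PP (yy (mm i)), 1 / (p:ℝ) - mm i * Real.log 2| ≤ C0 ∧
      ε / 4 * R^2 ≤ k ∧ ε / 4 * R^2 ≤ s ∧
      Real.exp (-2 * C0 - 2 * (32 / ε) - 2) / 16 * (((2:ℝ)^u)⁻¹ * Real.exp (R^2) / R^2)
      ≤ EE (fun p => 1 / (p:ℝ)) k (PP (yy (mm i))) * EE (fun p => 1 / (p:ℝ)) s (PP x \ PP (yy (mm i)))) := by
    intro i
    by_cases hi : i < M
    · obtain ⟨k, s, h⟩ := facts hε hε1 hC0 hM hx hxR hR1 hR2 ha1 ha2 hr (hmla i hi) hu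
      exact ⟨k, s, fun _ => h⟩
    · exact ⟨0, 0, fun h => absurd h hi⟩
  choose kk ss hks using hf
  set c1 := Real.exp (-2 * C0 - 2 * (32 / ε) - 2) / 16 with hc1
  set X := ((2:ℝ)^u)⁻¹ * Real.exp (R^2) / R^2 with hX
  set C1 := 4 / ε * Real.exp (2 * C0) with hC1
  set ρ := Real.exp (Real.log 2 / 2) / (3/2) with hρ
  have hX0 : 0 < X := by positivity
  have hC10 : 0 < C1 := by positivity
  have hc10 : 0 < c1 := by positivity
  have hρ0 : 0 ≤ ρ := by positivity
  set F0 := (PP x).powerset.filter (fun T => T.card = r) with hF0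
  set Q : ℕ → Finset ℕ → Prop := fun i T => (T ∩ PP (yy (mm i))).card = kk i with hQ
  set w : Finset ℕ → ℝ := fun T => ∏ p ∈ T, 1 / (p:ℝ) with hw
  have hb := bonf F0 w (fun T _ => Finset.prod_nonneg fun p _ => by positivity) M Q
  have hSx := hM x hx
  rw [hxR] at hSx
  have hsing : ∀ i ∈ Finset.range M, c1 * X ≤ ∑ T ∈ F0.filter (Q i), w T := by
    intro i hi
    obtain ⟨g1, g2, g3, g4, g5, g6, g7, g8, g9, g10⟩ := hks i (Finset.mem_range.1 hi)
    refine g10.trans (le_of_eq ?_)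
    rw [← single_eq _ g6]
    apply Finset.sum_congr _ (fun _ _ => rfl)
    ext T
    simp only [hF0, hQ, Finset.mem_filter, g2, and_assoc]
  have hpair : ∀ i ∈ Finset.range M, ∀ i' ∈ (Finset.range M).filter (fun i' => i < i'),
      ∑ T ∈ F0.filter (fun T => Q i T ∧ Q i' T), w T ≤ X * C1 * ρ ^ (K * (i' - i)) := by
    intro i hi i' hi'
    obtain ⟨hi'1, hii⟩ := Finset.mem_filter.1 hi'
    obtain ⟨g1, g2, g3, g4, g5, g6, g7, g8, g9, g10⟩ := hks i (Finset.mem_range.1 hi)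
    obtain ⟨g1', g2', g3', g4', g5', g6', g7', g8', g9', g10'⟩ := hks i' (Finset.mem_range.1 hi'1)
    obtain ⟨d, rfl⟩ := Nat.exists_eq_add_of_lt hii
    have hd : i + d + 1 - i = d + 1 := by omega
    rw [hd]
    have hmm' : mm (i + d + 1) = mm i + K * (d + 1) := by simp only [hmm]; ring
    have hkk' : kk (i + d + 1) = kk i + K * (d + 1) := by
      have := g1'; rw [hmm'] at this; push_cast at this
      zify; linarith
    have hsub : PP (yy (mm i)) ⊆ PP (yy (mm (i + d + 1))) := PP_mono (yy_mono (by rw [hmm']; omega))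
    have hp := pair_up (j := K * (d+1)) hε hsub g6' (by linarith) g1 g3 g4' g7
      (by rw [hmm'] at g7' ⊢; push_cast at g7' ⊢; exact g7') hSx g8 g9'
    refine le_trans (le_of_eq ?_) hp
    rw [← pair_eq _ hsub g6']
    apply Finset.sum_congr _ (fun _ _ => rfl)
    ext T
    simp only [hF0, hQ, Finset.mem_filter, and_assoc]
    rw [← hkk', g2']
  have h1 : M * (c1 * X) ≤ ∑ i ∈ Finset.range M, ∑ T ∈ F0.filter (Q i), w T := by
    have := Finset.sum_le_sum hsing
    simpa using this
  have h2 : ∑ i ∈ Finset.range M, ∑ i' ∈ (Finset.range M).filter (fun i' => i < i'),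
      ∑ T ∈ F0.filter (fun T => Q i T ∧ Q i' T), w T ≤ X * C1 * (M * (2 * ρ ^ K)) := by
    refine (Finset.sum_le_sum fun i hi => Finset.sum_le_sum (hpair i hi)).trans ?_
    simp only [← Finset.mul_sum]
    gcongr
    exact geo_pair hρ0 K M hK2
  refine ⟨F0.filter (fun T => ∃ i < M, Q i T), ?_, ?_⟩
  · intro T hT
    obtain ⟨hT1, i, hi, hq⟩ := Finset.mem_filter.1 hT
    obtain ⟨hT2, hT3⟩ := Finset.mem_filter.1 hT1
    obtain ⟨g1, g2, g3, g4, g5, g6, g7, g8, g9, g10⟩ := hks i hi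
    refine ⟨Finset.mem_powerset.1 hT2, hT3, mm i, g5, hmla i hi, ?_⟩
    rw [← g1]
    exact_mod_cast hq
  · have h3 : c1 / (4 * K) * (((2:ℝ)^u)⁻¹ * Real.exp (R^2) / R) ≤ M * (c1 * X) - X * C1 * (M * (2 * ρ ^ K)) := by
      have e1 : c1 / (4 * K) * (((2:ℝ)^u)⁻¹ * Real.exp (R^2) / R) = R / (2 * K) * (X * c1 / 2) := by
        rw [hX]; field_simp; ring
      have e2 : X * C1 * (M * (2 * ρ ^ K)) ≤ M * (X * c1 / 2) := by
        have := mul_le_mul_of_nonneg_left hK3 (show 0 ≤ M * X / 2 by positivity)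
        linarith
      rw [e1]
      have e3 : R / (2 * K) * (X * c1 / 2) ≤ M * (X * c1 / 2) := by gcongr
      linarith
    refine h3.trans (le_trans ?_ hb)
    linarith

theorem statement13 (ε : ℝ) (hε : 0 < ε) (hε' : ε < 1/2) :
    ∃ c : ℝ, 0 < c ∧ ∃ x₀ : ℝ, ∀ x : ℝ, x₀ ≤ x → ∀ r : ℕ,
      (1 + ε) * LLog2 x ≤ r → (r : ℝ) ≤ (2 - ε) * LLog2 x →
      ∀ u ∈ Uset ((r : ℝ) / LLog2 x - 1) x,
      c * (2:ℝ) ^ (-u) / Real.sqrt (LLog2 x)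
        ≤ primeProd 1 x * ∑ᶠ n ∈ {n | n ∈ Sset 1 x ∧ omegaN n = r ∧
            ∃ y ∈ Yset ((r : ℝ) / LLog2 x - 1) x,
              (omegaN (nsmall n y) : ℝ) = LLog2 y / Real.log 2 + u}, ((n : ℝ))⁻¹ := by
  obtain ⟨C0, hC0, hM⟩ := mertens_real_s13
  have hρ0 : 0 ≤ Real.exp (Real.log 2 / 2) / (3/2) := by positivity
  obtain ⟨K0, hK0⟩ := exists_pow_lt_of_lt_one
    (show 0 < min (1/2) (Real.exp (-2 * C0 - 2 * (32 / ε) - 2) / 16 / (4 * (4 / ε * Real.exp (2 * C0)))) by positivity) rho_lt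
  have hK : (Real.exp (Real.log 2 / 2) / (3/2)) ^ (K0 + 1) ≤
      min (1/2) (Real.exp (-2 * C0 - 2 * (32 / ε) - 2) / 16 / (4 * (4 / ε * Real.exp (2 * C0)))) :=
    (pow_le_pow_of_le_one hρ0 rho_lt.le (Nat.le_succ K0)).trans hK0.le
  set K := K0 + 1 with hKdef
  have hK1 : 1 ≤ K := by omega
  have hK2 := hK.trans (min_le_left _ _)
  have hK3 := hK.trans (min_le_right _ _)
  rw [le_div_iff₀ (by positivity)] at hK3
  have hKp : (0:ℝ) < K := by exact_mod_cast hK1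
  set c1 := Real.exp (-2 * C0 - 2 * (32 / ε) - 2) / 16 with hc1
  have hc10 : 0 < c1 := by positivity
  set R0 := 100 * (C0 + 1) + 100 / ε + 2 * K with hR0
  have h100 : 0 < 100 / ε := by positivity
  have hR0100 : 100 ≤ R0 := by linarith
  refine ⟨c1 / (4 * K) * Real.exp (-C0), by positivity, Real.exp (Real.exp (R0^2)), ?_⟩
  intro x hx r hr1 hr2 u hu
  have hxp : 0 < x := lt_of_lt_of_le (Real.exp_pos _) hx
  have hlx : Real.exp (R0^2) ≤ Real.log x := (Real.le_log_iff_exp_le hxp).2 hx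
  have hlxp : 0 < Real.log x := lt_of_lt_of_le (Real.exp_pos _) hlx
  have hllx : R0^2 ≤ Real.log (Real.log x) := (Real.le_log_iff_exp_le hlxp).2 hlx
  have hE1 : 10001 ≤ Real.exp (R0^2) := by
    have := Real.add_one_le_exp (R0^2)
    nlinarith
  have hx16 : 16 ≤ x := by
    have := Real.add_one_le_exp (Real.exp (R0^2))
    linarith
  have hL : LLog2 x = Real.log (Real.log x) := by
    rw [LLog2, LLog, LLog, max_eq_right (show 1 ≤ Real.log x by linarith), max_eq_right (by nlinarith)]
  have hLpos : 0 < LLog2 x := by rw [hL]; nlinarith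
  have hRL : Real.sqrt (LLog2 x) ^ 2 = LLog2 x := Real.sq_sqrt hLpos.le
  have hRR : R0 ≤ Real.sqrt (LLog2 x) := Real.le_sqrt_of_sq_le (by rw [hL]; exact hllx)
  have haL : ((r:ℝ) / LLog2 x - 1) * LLog2 x = r - LLog2 x := by field_simp
  simp only [Uset, Set.mem_ofPred_eq] at hu
  rw [haL] at hu
  set R := Real.sqrt (LLog2 x) with hRdef
  have hRpos : 0 < R := by linarith
  obtain ⟨F, hF1, hF2⟩ := core_s13 (a := r - LLog2 x) (R := R) hε hε' hC0 (fun y hy => (hM y hy).1) hx16 (by rw [hRL, hL])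
    (by linarith) (by
      have : ε * (100 / ε) = 100 := by field_simp
      have h2 : 100 / ε ≤ R := by linarith
      nlinarith) (by rw [hRL]; linarith) (by rw [hRL]; linarith) (by rw [hRL]; ring) hu hK1 (by linarith) hK2 hK3
  have hlink := link (x := x) (D := {n | n ∈ Sset 1 x ∧ omegaN n = r ∧
            ∃ y ∈ Yset ((r : ℝ) / LLog2 x - 1) x,
              (omegaN (nsmall n y) : ℝ) = LLog2 y / Real.log 2 + u}) (fun n hn => hn.1) F (by
    intro T hT
    obtain ⟨t1, t2, m, t3, t4, t5⟩ := hF1 T hT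
    refine ⟨t1, prod_mem_Sset t1, ?_, yy m, ⟨Real.exp_pos _, ?_, m, ?_⟩, ?_⟩
    · rw [omegaN, primeFactors_prod' t1, t2]
    · rw [LLog2_yy t3, haL]; exact t4
    · rw [LLog2_yy t3]; push_cast; rfl
    · rw [LLog2_yy t3, omega_nsmall t1, mul_div_cancel_right₀ _ (Real.log_pos (by norm_num)).ne']
      exact_mod_cast t5)
  have hpp := primeProd_lower x
  have hpp2 : Real.exp (-R^2) * Real.exp (-C0) ≤ primeProd 1 x := by
    refine le_trans ?_ hpp
    rw [← Real.exp_add]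
    apply Real.exp_le_exp.2
    have := (hM x hx16).2
    rw [hRL, hL]
    linarith
  refine le_trans ?_ (mul_le_mul hpp2 (hF2.trans hlink) (by positivity) (le_trans (by positivity) hpp2))
  apply le_of_eq
  rw [← hc1, Real.exp_neg (R^2), zpow_neg]
  clear_value c1
  field_simp
end
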